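/- Every pure double circulant self-dual binary code of length 90 with minimum weight 14 has automorphism group of order exactly 90, where the automorphism group is the group of coordinate permutations of F_2^90 mapping the code onto itself. -/

import Mathlib

/-- The standard inner product on `ι → ZMod 2`. -/
def dot {ι : Type*} [Fintype ι] (x y : ι → ZMod 2) : ZMod 2 := ∑ i, x i * y i

/-- A binary linear code is self-dual if it coincides with its dual. -/
def IsSelfDual {ι : Type*} [Fintype ι] (C : Submodule (ZMod 2) (ι → ZMod 2)) : Prop :=
  ∀ x, x ∈ C ↔ ∀ y ∈ C, dot x y = 0

/-- `C` has minimum (nonzero) weight exactly `d`. -/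
def MinWeightIs {ι : Type*} [Fintype ι] (C : Submodule (ZMod 2) (ι → ZMod 2)) (d : ℕ) : Prop :=
  (∃ x ∈ C, x ≠ 0 ∧ hammingNorm x = d) ∧ ∀ x ∈ C, x ≠ 0 → d ≤ hammingNorm x

/-- `A_i(C)`: the number of codewords of `C` of Hamming weight `i`. -/
noncomputable def weightEnum {ι : Type*} [Fintype ι] (C : Submodule (ZMod 2) (ι → ZMod 2)) (i : ℕ) : ℕ :=
  Set.ncard {x : ι → ZMod 2 | x ∈ C ∧ hammingNorm x = i}

/-- Two codes are equivalent if a coordinate permutation maps one onto the other. -/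
def CodeEquiv {ι : Type*} [Fintype ι] (C C' : Submodule (ZMod 2) (ι → ZMod 2)) : Prop :=
  ∃ σ : Equiv.Perm ι, Submodule.map (LinearMap.funLeft (ZMod 2) (ZMod 2) ⇑σ) C = C'

/-- The order of the automorphism group of a code: the number of coordinate
permutations mapping the code onto itself. -/
noncomputable def autGroupOrder {ι : Type*} [Fintype ι] (C : Submodule (ZMod 2) (ι → ZMod 2)) : ℕ :=
  Nat.card {σ : Equiv.Perm ι // Submodule.map (LinearMap.funLeft (ZMod 2) (ZMod 2) ⇑σ) C = C}

/-- A circulant matrix: each row is the cyclic shift of the previous one. -/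
def IsCirculant {n : ℕ} (R : Matrix (Fin n) (Fin n) (ZMod 2)) : Prop :=
  ∃ v : Fin n → ZMod 2, R = Matrix.circulant v

/-- The pure double circulant code with generator matrix `(I_n | R)`. -/
def pureDCC {n : ℕ} (R : Matrix (Fin n) (Fin n) (ZMod 2)) :
    Submodule (ZMod 2) (Fin n ⊕ Fin n → ZMod 2) :=
  Submodule.span (ZMod 2)
    (Set.range fun i : Fin n =>
      Sum.elim (fun j => if j = i then (1 : ZMod 2) else 0) (R i))

/-- A bordered matrix: first row `(0,1,…,1)`, first column `(0,1,…,1)ᵀ`, and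
lower-right block an `n × n` circulant matrix. -/
def IsBorderMatrix {n : ℕ} (B : Matrix (Fin (n + 1)) (Fin (n + 1)) (ZMod 2)) : Prop :=
  B 0 0 = 0 ∧ (∀ j, j ≠ 0 → B 0 j = 1) ∧ (∀ i, i ≠ 0 → B i 0 = 1) ∧
  ∃ R' : Matrix (Fin n) (Fin n) (ZMod 2), IsCirculant R' ∧
    ∀ i j : Fin n, B i.succ j.succ = R' i j

/-- The bordered double circulant code with generator matrix `(I_{n+1} | B)`. -/
def borderedDCC {n : ℕ} (B : Matrix (Fin (n + 1)) (Fin (n + 1)) (ZMod 2)) :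
    Submodule (ZMod 2) (Fin (n + 1) ⊕ Fin (n + 1) → ZMod 2) :=
  Submodule.span (ZMod 2)
    (Set.range fun i : Fin (n + 1) =>
      Sum.elim (fun j => if j = i then (1 : ZMod 2) else 0) (B i))

/-! ## Lanes -/
section Lanes

/-- the lane width -/
def lw : ℕ := 72

/-- lanes packed into one number -/
def evN (n : ℕ) (f : ℕ → ℕ) : ℕ := ∑ i ∈ Finset.range n, f i * 2 ^ (lw * i)

theorem evN_succ (n : ℕ) (f : ℕ → ℕ) : evN (n + 1) f = f n * 2 ^ (lw * n) + evN n f := by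
  unfold evN; rw [Finset.sum_range_succ, add_comm]

theorem evN_lt (n : ℕ) (f : ℕ → ℕ) (hf : ∀ i < n, f i < 2 ^ lw) : evN n f < 2 ^ (lw * n) := by
  induction n with
  | zero => simp [evN]
  | succ n ih =>
    rw [evN_succ]
    have h1 := ih fun i hi => hf i (by omega)
    have h2 := hf n (by omega)
    have : 2 ^ (lw * (n + 1)) = 2 ^ lw * 2 ^ (lw * n) := by rw [← pow_add]; ring_nf
    rw [this]
    nlinarith

theorem evN_testBit (n : ℕ) (f : ℕ → ℕ) (hf : ∀ i < n, f i < 2 ^ lw) (q t : ℕ) (ht : t < lw) :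
    (evN n f).testBit (lw * q + t) = (decide (q < n) && (f q).testBit t) := by
  induction n with
  | zero => simp [evN]
  | succ n ih =>
    have h1 := evN_lt n f fun i hi => hf i (by omega)
    rw [evN_succ, mul_comm, Nat.testBit_two_pow_mul_add _ h1]
    have ih := ih fun i hi => hf i (by omega)
    rcases lt_trichotomy q n with h | h | h
    · have : lw * q + t < lw * n := by
        have : lw * (q + 1) ≤ lw * n := Nat.mul_le_mul_left _ h
        rw [mul_add] at this; omega
      simp [this, ih, h, Nat.lt_succ_of_lt h]
    · subst h
      simp
    · have : ¬ (lw * q + t < lw * n) := by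
        have : lw * n ≤ lw * q := Nat.mul_le_mul_left _ h.le
        omega
      have h3 : ¬ (q < n + 1) := by omega
      rw [if_neg this]
      simp only [h3, decide_false, Bool.false_and]
      apply Nat.testBit_lt_two_pow
      refine lt_of_lt_of_le (hf n (by omega)) (Nat.pow_le_pow_right (by norm_num) ?_)
      have : lw * (n + 1) ≤ lw * q := Nat.mul_le_mul_left _ h
      rw [mul_add] at this; omega

theorem evN_land (n : ℕ) (f g : ℕ → ℕ) (hf : ∀ i < n, f i < 2 ^ lw) (hg : ∀ i < n, g i < 2 ^ lw) :
    evN n f &&& evN n g = evN n (fun i => f i &&& g i) := by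
  have hl : 0 < lw := by norm_num [lw]
  have hfg : ∀ i < n, f i &&& g i < 2 ^ lw := fun i hi => Nat.and_lt_two_pow _ (hg i hi)
  apply Nat.eq_of_testBit_eq
  intro i
  obtain ⟨q, t, ht, rfl⟩ : ∃ q t, t < lw ∧ i = lw * q + t :=
    ⟨i / lw, i % lw, Nat.mod_lt _ hl, (Nat.div_add_mod _ _).symm⟩
  rw [Nat.testBit_and, evN_testBit n f hf q t ht, evN_testBit n g hg q t ht,
    evN_testBit n _ hfg q t ht, Nat.testBit_and]
  cases decide (q < n) <;> simp

theorem evN_digit (n : ℕ) (f : ℕ → ℕ) (hf : ∀ i < n, f i < 2 ^ lw) (q : ℕ) (hq : q < n) :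
    evN n f / 2 ^ (lw * q) % 2 ^ lw = f q := by
  apply Nat.eq_of_testBit_eq
  intro t
  rw [Nat.testBit_mod_two_pow, Nat.testBit_div_two_pow]
  by_cases ht : t < lw
  · rw [add_comm, evN_testBit n f hf q t ht]; simp [ht, hq]
  · simp only [ht, decide_false, Bool.false_and]
    symm; apply Nat.testBit_lt_two_pow
    exact lt_of_lt_of_le (hf q hq) (Nat.pow_le_pow_right (by norm_num) (by omega))

theorem evN_modsum (n : ℕ) (f : ℕ → ℕ) : evN n f ≡ ∑ i ∈ Finset.range n, f i [MOD (2 ^ lw - 1)] := by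
  have hx : 2 ^ lw ≡ 1 [MOD (2 ^ lw - 1)] := by
    refine ((Nat.modEq_iff_dvd' (Nat.one_le_two_pow)).2 dvd_rfl).symm
  induction n with
  | zero => simp [evN]; rfl
  | succ n ih =>
    rw [evN_succ, Finset.sum_range_succ, add_comm]
    refine ih.add ?_
    have := (hx.pow n).mul_left (f n)
    simpa [pow_mul] using this

abbrev Z := ZMod 45

def lM : ℕ := 2 ^ (lw * 45) - 1

/-- lanes packed, indices in `Z` -/
def ev (f : Z → ℕ) : ℕ := ∑ j : Z, f j * 2 ^ (lw * j.val)

theorem ev_eq (f : Z → ℕ) : ev f = evN 45 (fun i => f (i : Z)) := by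
  unfold ev evN
  rw [Finset.sum_range]
  refine Finset.sum_congr rfl fun j _ => ?_
  have : ((ZMod.val (n := 45) j : ℕ) : Z) = j := ZMod.natCast_zmod_val (n := 45) j
  change f j * _ = f ((ZMod.val (n := 45) j : ℕ) : Z) * _
  rw [this]; rfl

theorem ev_lt_pow (f : Z → ℕ) (hf : ∀ i, f i < 2 ^ lw) : ev f < 2 ^ (lw * 45) := by
  rw [ev_eq]; exact evN_lt _ _ fun i _ => hf _

theorem ev_land (f g : Z → ℕ) (hf : ∀ i, f i < 2 ^ lw) (hg : ∀ i, g i < 2 ^ lw) :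
    ev f &&& ev g = ev (fun i => f i &&& g i) := by
  rw [ev_eq, ev_eq, ev_eq, evN_land _ _ _ (fun i _ => hf _) (fun i _ => hg _)]

theorem ev_digit (f : Z → ℕ) (hf : ∀ i, f i < 2 ^ lw) (q : Z) :
    ev f / 2 ^ (lw * q.val) % 2 ^ lw = f q := by
  rw [ev_eq, evN_digit _ _ (fun i _ => hf _) _ (ZMod.val_lt q)]
  congr 1; exact ZMod.natCast_zmod_val q

theorem ev_inj {f g : Z → ℕ} (hf : ∀ i, f i < 2 ^ lw) (hg : ∀ i, g i < 2 ^ lw) (h : ev f = ev g) :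
    f = g := by
  funext q; rw [← ev_digit f hf q, h, ev_digit g hg q]

theorem ev_add (f g : Z → ℕ) : ev (fun i => f i + g i) = ev f + ev g := by
  simp [ev, add_mul, Finset.sum_add_distrib]

theorem ev_smul (c : ℕ) (f : Z → ℕ) : ev (fun i => c * f i) = c * ev f := by
  simp [ev, mul_assoc, Finset.mul_sum]

theorem ev_sum {ι : Type*} (s : Finset ι) (f : ι → Z → ℕ) :
    ev (fun i => ∑ a ∈ s, f a i) = ∑ a ∈ s, ev (f a) := by
  unfold ev; rw [Finset.sum_comm]; simp [Finset.sum_mul]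

theorem ev_modsum (f : Z → ℕ) : ev f ≡ ∑ i, f i [MOD (2 ^ lw - 1)] := by
  rw [ev_eq]
  refine (evN_modsum _ _).trans ?_
  rw [Finset.sum_range]
  have : (∑ i : Fin 45, f ((i : ℕ) : Z)) = ∑ i : Z, f i := by
    refine Finset.sum_congr rfl fun j _ => ?_
    congr 1; exact ZMod.natCast_zmod_val (n := 45) j
  rw [this]

theorem ev_wt (f : Z → ℕ) (h : ∑ i, f i < 2 ^ lw - 1) : ev f % (2 ^ lw - 1) = ∑ i, f i :=
  Nat.mod_eq_of_modEq (ev_modsum f) h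

/-- all-ones lanes -/
def lO : ℕ := ev (fun _ => 1)

theorem ev_lt_lM (f : Z → ℕ) (hf : ∀ i, f i < 2 ^ lw - 1) : ev f < lM := by
  have h1 : ev (fun i => f i + 1) < 2 ^ (lw * 45) := ev_lt_pow _ fun i => by have := hf i; omega
  rw [ev_add] at h1
  have h2 : 0 < ev (fun _ => 1) := by
    unfold ev
    exact Finset.sum_pos (fun i _ => Nat.mul_pos one_pos (Nat.two_pow_pos _)) ⟨0, Finset.mem_univ _⟩
  exact Nat.lt_sub_of_add_lt (lt_of_le_of_lt (Nat.add_le_add_left h2 _) h1)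

def cv (f g : Z → ℕ) : Z → ℕ := fun k => ∑ i, f i * g (k - i)

theorem modEq_aux (N : ℕ) (h : 1 ≤ N) : N ≡ 1 [MOD (N - 1)] :=
  ((Nat.modEq_iff_dvd' h).2 dvd_rfl).symm

theorem pow_val_add (i j : Z) : 2 ^ (lw * i.val) * 2 ^ (lw * j.val) ≡ 2 ^ (lw * (i + j).val) [MOD lM] := by
  rw [ZMod.val_add, ← pow_add, ← mul_add, pow_mul, pow_mul]
  have hx : (2 ^ lw) ^ 45 ≡ 1 [MOD lM] := by
    rw [← pow_mul, lM]
    exact modEq_aux _ Nat.one_le_two_pow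
  conv_lhs => rw [← Nat.div_add_mod (i.val + j.val) 45, pow_add, pow_mul]
  simpa using (hx.pow ((i.val + j.val) / 45)).mul_right ((2 ^ lw) ^ ((i.val + j.val) % 45))

theorem ev_mul (f g : Z → ℕ) : ev f * ev g ≡ ev (cv f g) [MOD lM] := by
  have h1 : ev (cv f g) = ∑ i : Z, ∑ j : Z, f i * g j * 2 ^ (lw * (i + j).val) := by
    unfold ev cv
    simp only [Finset.sum_mul]
    rw [Finset.sum_comm]
    refine Finset.sum_congr rfl fun i _ => ?_
    refine Fintype.sum_equiv (Equiv.subRight i) _ _ fun k => ?_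
    simp
  rw [h1]; unfold ev
  rw [Finset.sum_mul_sum]
  refine Nat.ModEq.sum fun i _ => Nat.ModEq.sum fun j _ => ?_
  have := (pow_val_add i j).mul_left (f i * g j)
  have h2 : f i * 2 ^ (lw * i.val) * (g j * 2 ^ (lw * j.val)) =
    f i * g j * (2 ^ (lw * i.val) * 2 ^ (lw * j.val)) := by ring
  rw [h2]; exact this

theorem ev_mul_mod (f g : Z → ℕ) (h : ∀ k, cv f g k < 2 ^ lw - 1) : ev f * ev g % lM = ev (cv f g) :=
  Nat.mod_eq_of_modEq (ev_mul f g) (ev_lt_lM _ h)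

end Lanes

/-! ## The ring and the codes -/
section Ring

abbrev A := AddMonoidAlgebra (ZMod 2) Z

def co (x : A) (k : Z) : ZMod 2 := x.coeff k

noncomputable def X (k : Z) : A := AddMonoidAlgebra.single k 1

noncomputable def mkA (f : Z → ZMod 2) : A := AddMonoidAlgebra.ofCoeff (Finsupp.equivFunOnFinite.symm f)

theorem co_mkA (f : Z → ZMod 2) : co (mkA f) = f := by
  funext k; simp [co, mkA]

theorem co_ext {x y : A} (h : ∀ k, co x k = co y k) : x = y := by
  apply AddMonoidAlgebra.coeff_injective
  ext k; exact h k

theorem co_mul (x y : A) (k : Z) : co (x * y) k = ∑ i, co x i * co y (k - i) := by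
  unfold co
  rw [AddMonoidAlgebra.coeff_mul_apply_left, Finsupp.sum_fintype]
  · refine Finset.sum_congr rfl fun i _ => ?_
    rw [neg_add_eq_sub]
  · simp

theorem co_add (x y : A) (k : Z) : co (x + y) k = co x k + co y k := rfl
theorem co_zero (k : Z) : co 0 k = 0 := rfl
theorem co_smul (c : ZMod 2) (x : A) (k : Z) : co (c • x) k = c * co x k := rfl

theorem co_X (i k : Z) : co (X i) k = if k = i then 1 else 0 := by
  unfold co X
  rw [AddMonoidAlgebra.coeff_single, Finsupp.single_apply]
  simp [eq_comm]

theorem co_one (k : Z) : co 1 k = if k = 0 then 1 else 0 := co_X 0 k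

theorem X_add (i j : Z) : X (i + j) = X i * X j := by
  unfold X; rw [AddMonoidAlgebra.single_mul_single]; simp

theorem X_zero : X 0 = 1 := rfl

theorem X_pow (i : Z) (n : ℕ) : X i ^ n = X (n • i) := by
  unfold X; rw [AddMonoidAlgebra.single_pow]; simp

theorem co_X_mul (i : Z) (x : A) (k : Z) : co (X i * x) k = co x (k - i) := by
  rw [co_mul]; simp [co_X]

/-- the involution `x ↦ x⁻¹` -/
noncomputable def st : A →+* A := AddMonoidAlgebra.mapDomainRingHom (ZMod 2) (-AddMonoidHom.id Z)

theorem st_X (i : Z) : st (X i) = X (-i) := by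
  simp [st, X]

theorem eq_sum_X (x : A) : x = ∑ i, co x i • X i := by
  apply co_ext; intro k
  have : co (∑ i, co x i • X i) k = ∑ i, co (co x i • X i) k := by
    unfold co; rw [AddMonoidAlgebra.coeff_sum, Finsupp.finsetSum_apply]
  rw [this]; simp [co_smul, co_X]

theorem co_sum {ι : Type*} (s : Finset ι) (f : ι → A) (k : Z) : co (∑ i ∈ s, f i) k = ∑ i ∈ s, co (f i) k := by
  unfold co; rw [AddMonoidAlgebra.coeff_sum, Finsupp.finsetSum_apply]

theorem zmod2_smul (c : ZMod 2) (x : A) (f : A →+* A) : f (c • x) = c • f x := by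
  rcases (by decide +revert : c = 0 ∨ c = 1) with h | h <;> simp [h]

theorem co_st (x : A) (k : Z) : co (st x) k = co x (-k) := by
  conv_lhs => rw [eq_sum_X x, map_sum, co_sum]
  simp only [zmod2_smul, st_X, co_smul, co_X]
  simp [eq_neg_iff_add_eq_zero]
  rw [Finset.sum_eq_single (-k)]
  · simp
  · intro b _ hb
    rw [if_neg]; intro h; apply hb; rw [eq_neg_iff_add_eq_zero, add_comm]; exact h
  · simp

theorem st_st (x : A) : st (st x) = x := co_ext fun k => by simp [co_st]

instance : CharP A 2 := by
  refine (CharTwo.of_one_ne_zero_of_two_eq_zero ?_ ?_)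
  · exact one_ne_zero
  · apply co_ext; intro k
    have h : (2 : A) = 1 + 1 := one_add_one_eq_two.symm
    exact (congrArg (fun z => co z k) h).trans (CharTwo.add_self_eq_zero _)

theorem fr_eq : frobenius A 2 = AddMonoidAlgebra.mapDomainRingHom (ZMod 2) (AddMonoidHom.mulLeft (2 : Z)) := by
  apply AddMonoidAlgebra.ringHom_ext
  · intro r
    rw [frobenius_def, AddMonoidAlgebra.single_pow]
    rcases (by decide +revert : r = 0 ∨ r = 1) with h | h <;> simp [h]
  · intro a
    rw [frobenius_def, AddMonoidAlgebra.single_pow]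
    simp

theorem co_sq (x : A) (k : Z) : co (x ^ 2) (2 * k) = co x k := by
  have h : x ^ 2 = frobenius A 2 x := rfl
  rw [h]
  conv_lhs => rw [eq_sum_X x, map_sum, co_sum]
  simp only [zmod2_smul]
  simp only [frobenius_def, X_pow, co_smul, co_X]
  rw [Finset.sum_eq_single k]
  · simp
  · intro b _ hb
    rw [if_neg, mul_zero]; intro h; apply hb
    have h3 : ∀ x y : Z, 2 * x = 2 • y → y = x := by decide +kernel
    exact h3 _ _ h
  · simp

theorem sq_surj (y : A) : ∃ x : A, x ^ 2 = y := by
  refine ⟨mkA fun k => co y (2 * k), co_ext fun k => ?_⟩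
  have h3 : k = 2 * (23 * k) := by revert k; decide
  rw [h3, co_sq, co_mkA]

/-- the code `{(a, a r)}` -/
def D (r : A) : Submodule (ZMod 2) (Z ⊕ Z → ZMod 2) where
  carrier := {f | ∃ a : A, f = Sum.elim (co a) (co (a * r))}
  add_mem' := by
    rintro _ _ ⟨a, rfl⟩ ⟨b, rfl⟩
    refine ⟨a + b, ?_⟩
    funext j; rcases j with j | j <;> simp [co_add, add_mul]
  zero_mem' := ⟨0, by funext j; rcases j with j | j <;> simp [co_zero]⟩
  smul_mem' := by
    rintro c _ ⟨a, rfl⟩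
    refine ⟨c • a, ?_⟩
    funext j; rcases j with j | j <;> simp [co_smul]

theorem mem_D {r : A} {f} : f ∈ D r ↔ ∃ a : A, f = Sum.elim (co a) (co (a * r)) := Iff.rfl

theorem pureDCC_eq (v : Z → ZMod 2) :
    pureDCC (n := 45) (Matrix.circulant v) = D (mkA fun k => v (-k)) := by
  have hrow : ∀ i : Z, (Sum.elim (fun j => if j = i then (1 : ZMod 2) else 0) (Matrix.circulant v i) : Z ⊕ Z → ZMod 2)
      = Sum.elim (co (X i)) (co (X i * mkA fun k => v (-k))) := by
    intro i
    funext j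
    rcases j with j | j
    · simp [co_X]
    · simp [co_X_mul, co_mkA, Matrix.circulant_apply]
  apply le_antisymm
  · refine Submodule.span_le.2 ?_
    rintro _ ⟨i, rfl⟩
    exact ⟨X i, hrow i⟩
  · rintro _ ⟨a, rfl⟩
    have : (Sum.elim (co a) (co (a * mkA fun k => v (-k))) : Z ⊕ Z → ZMod 2) =
        ∑ i : Z, co a i • (Sum.elim (fun j => if j = i then (1 : ZMod 2) else 0) (Matrix.circulant v i) : Z ⊕ Z → ZMod 2) := by
      simp only [hrow]
      conv_lhs => rw [eq_sum_X a]
      funext j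
      rw [Finset.sum_apply]
      rcases j with j | j
      · simp [co_sum, co_smul]
      · simp [co_sum, co_smul, Finset.sum_mul]
    rw [this]
    refine Submodule.sum_mem _ fun i _ => Submodule.smul_mem _ _ (Submodule.subset_span ?_)
    exact ⟨i, rfl⟩

theorem unitary_of_selfDual (r : A) (h : IsSelfDual (D r)) : r * st r = 1 := by
  apply co_ext; intro k
  have h1 : (Sum.elim (co (X k)) (co (X k * r)) : Z ⊕ Z → ZMod 2) ∈ D r := ⟨X k, rfl⟩
  have h0 : (Sum.elim (co 1) (co (1 * r)) : Z ⊕ Z → ZMod 2) ∈ D r := ⟨1, rfl⟩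
  have h2 := (h _).1 h0 _ h1
  unfold dot at h2
  rw [Fintype.sum_sum_type] at h2
  simp only [Sum.elim_inl, Sum.elim_inr, one_mul, co_X_mul, co_X, co_one] at h2
  simp only [ite_mul, one_mul, zero_mul, Finset.sum_ite_eq', Finset.mem_univ, if_true] at h2
  rw [co_mul, co_one]
  simp only [co_st, neg_sub]
  rw [CharTwo.add_eq_zero] at h2
  rw [← h2]; simp [eq_comm]

def Good (r : A) : Prop := MinWeightIs (D r) 14 → autGroupOrder (D r) = 90

theorem funLeft_comp_apply {ι : Type*} (σ : Equiv.Perm ι) (f : ι → ZMod 2) :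
    LinearMap.funLeft (ZMod 2) (ZMod 2) σ f = f ∘ σ := rfl

theorem mem_map_funLeft {ι : Type*} (σ : Equiv.Perm ι) (C : Submodule (ZMod 2) (ι → ZMod 2)) (f : ι → ZMod 2) :
    f ∈ Submodule.map (LinearMap.funLeft (ZMod 2) (ZMod 2) σ) C ↔ f ∘ σ.symm ∈ C := by
  rw [Submodule.mem_map]
  constructor
  · rintro ⟨g, hg, rfl⟩
    rw [funLeft_comp_apply]
    have : (g ∘ σ) ∘ σ.symm = g := by funext; simp
    rwa [this]
  · intro h
    refine ⟨_, h, ?_⟩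
    rw [funLeft_comp_apply]; funext; simp

theorem good_of_equiv {r r' : A} (e : Equiv.Perm (Z ⊕ Z))
    (he : ∀ f, f ∈ D r' ↔ f ∘ e ∈ D r) (h : Good r) : Good r' := by
  intro hm
  have he' : ∀ f, f ∈ D r ↔ f ∘ e.symm ∈ D r' := by
    intro f; rw [he]
    have : (f ∘ e.symm) ∘ e = f := by funext; simp
    rw [this]
  have hw : ∀ (f : Z ⊕ Z → ZMod 2) (e : Equiv.Perm (Z ⊕ Z)), hammingNorm (f ∘ e) = hammingNorm f := by
    intro f e
    unfold hammingNorm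
    apply Finset.card_bij (fun i _ => e i)
    · intro i hi; simpa using hi
    · intro i _ j _ hij; exact e.injective hij
    · intro j hj; exact ⟨e.symm j, by simpa using hj, by simp⟩
  have hz : ∀ (f : Z ⊕ Z → ZMod 2) (e : Equiv.Perm (Z ⊕ Z)), f ≠ 0 → f ∘ e ≠ 0 := by
    intro f e hf h0; apply hf; funext i
    have := congrFun h0 (e.symm i); simpa using this
  have hm' : MinWeightIs (D r) 14 := by
    obtain ⟨⟨x, hx, hx0, hx14⟩, hall⟩ := hm
    refine ⟨⟨x ∘ e, (he x).1 hx, hz _ _ hx0, by rw [hw, hx14]⟩, ?_⟩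
    intro y hy hy0
    have := hall (y ∘ e.symm) ((he' y).1 hy) (hz _ _ hy0)
    rwa [hw] at this
  rw [← h hm']
  unfold autGroupOrder
  have key : ∀ σ : Equiv.Perm (Z ⊕ Z), ∀ C : Submodule (ZMod 2) (Z ⊕ Z → ZMod 2),
    Submodule.map (LinearMap.funLeft (ZMod 2) (ZMod 2) σ) C = C ↔ ∀ f, f ∘ σ.symm ∈ C ↔ f ∈ C := by
    intro σ C
    rw [SetLike.ext_iff]
    exact forall_congr' fun f => by rw [mem_map_funLeft]
  apply Nat.card_congr
  refine Equiv.subtypeEquiv (e.symm.permCongr) ?_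
  intro σ
  rw [key, key]
  constructor
  · intro H f
    have : (f ∘ ⇑e.symm) ∘ ⇑(Equiv.symm σ) = (f ∘ ⇑(Equiv.symm (e.symm.permCongr σ))) ∘ ⇑e.symm := by
      funext i
      change f (e.symm (σ.symm i)) = f (e.symm (σ.symm (e (e.symm i))))
      rw [Equiv.apply_symm_apply]
    rw [he' f, he' (f ∘ _), ← this, H]
  · intro H f
    have : (f ∘ ⇑(Equiv.symm σ)) ∘ ⇑e = (f ∘ ⇑e) ∘ ⇑(Equiv.symm (e.symm.permCongr σ)) := by
      funext i
      change f (σ.symm (e i)) = f (e (e.symm (σ.symm (e i))))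
      rw [Equiv.apply_symm_apply]
    rw [he f, he (f ∘ _), this, H]

theorem good_shift (k : Z) (r : A) (h : Good r) : Good (X k * r) := by
  refine good_of_equiv (Equiv.sumCongr (Equiv.refl _) (Equiv.addRight k)) ?_ h
  intro f
  rw [mem_D, mem_D]
  refine exists_congr fun a => ?_
  constructor
  · rintro rfl
    funext j; rcases j with j | j
    · simp
    · simp [mul_left_comm a, co_X_mul]
  · intro hf
    funext j; rcases j with j | j
    · simpa using congrFun hf (.inl j)
    · simpa [mul_left_comm a, co_X_mul] using congrFun hf (.inr (j - k))

def mul2 : Equiv.Perm Z where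
  toFun k := 2 * k
  invFun k := 23 * k
  left_inv := by decide
  right_inv := by decide

theorem good_sq (r : A) (h : Good r) : Good (r ^ 2) := by
  refine good_of_equiv (Equiv.sumCongr mul2 mul2) ?_ h
  intro f
  rw [mem_D, mem_D]
  constructor
  · rintro ⟨a, rfl⟩
    obtain ⟨b, rfl⟩ := sq_surj a
    refine ⟨b, ?_⟩
    funext j; rcases j with j | j
    · simp [mul2, co_sq]
    · simp [mul2, ← mul_pow, co_sq]
  · rintro ⟨b, hb⟩
    refine ⟨b ^ 2, ?_⟩
    funext j; rcases j with j | j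
    · obtain ⟨j, rfl⟩ := mul2.surjective j
      have := congrFun hb (.inl j)
      simpa [mul2, co_sq] using this
    · obtain ⟨j, rfl⟩ := mul2.surjective j
      have := congrFun hb (.inr j)
      simpa [mul2, ← mul_pow, co_sq] using this

theorem good_inv (r s : A) (hrs : r * s = 1) (h : Good r) : Good s := by
  refine good_of_equiv (Equiv.sumComm _ _) ?_ h
  intro f
  rw [mem_D, mem_D]
  constructor
  · rintro ⟨a, rfl⟩
    refine ⟨a * s, ?_⟩
    have : a * s * r = a := by rw [mul_assoc, mul_comm s, hrs, mul_one]
    rw [this]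
    funext j; rcases j with j | j <;> simp
  · rintro ⟨a, ha⟩
    refine ⟨a * r, ?_⟩
    have : a * r * s = a := by rw [mul_assoc, hrs, mul_one]
    rw [this]
    funext j; rcases j with j | j
    · simpa using congrFun ha (.inr j)
    · simpa using congrFun ha (.inl j)

/-! lane encoding of ring elements -/
def S (x : A) : ℕ := ev fun k => (co x k).val

theorem val_le_one (c : ZMod 2) : c.val ≤ 1 := by have := ZMod.val_lt c; omega

theorem val_lt_lw (c : ZMod 2) : c.val < 2 ^ lw := lt_of_le_of_lt (val_le_one c) (by norm_num [lw])

theorem S_inj {x y : A} (h : S x = S y) : x = y := by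
  apply co_ext; intro k
  have := congrFun (ev_inj (fun i => val_lt_lw _) (fun i => val_lt_lw _) h) k
  exact ZMod.val_injective 2 this

theorem cv_le (f g : Z → ℕ) (a b : ℕ) (hf : ∀ i, f i ≤ a) (hg : ∀ i, g i ≤ b) (k : Z) :
    cv f g k ≤ 45 * (a * b) := by
  unfold cv
  refine (Finset.sum_le_sum (g := fun _ => a * b) fun i _ => Nat.mul_le_mul (hf _) (hg _)).trans ?_
  rw [Finset.sum_const, Finset.card_univ, ZMod.card, smul_eq_mul]

theorem cast_cv (f g : Z → ℕ) (k : Z) : ((cv f g k : ℕ) : ZMod 2) = ∑ i, (f i : ZMod 2) * (g (k - i) : ZMod 2) := by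
  unfold cv
  rw [Nat.cast_sum]
  exact Finset.sum_congr rfl fun i _ => Nat.cast_mul _ _

theorem land_one_val (n : ℕ) : n &&& 1 = ((n : ZMod 2)).val := by
  rw [Nat.and_one_is_mod, ZMod.val_natCast]

theorem S_mul (x y : A) : S (x * y) = (S x * S y % lM) &&& lO := by
  have hb : ∀ k, cv (fun k => (co x k).val) (fun k => (co y k).val) k ≤ 45 := fun k => by
    simpa using cv_le _ _ 1 1 (fun i => val_le_one (co x i)) (fun i => val_le_one (co y i)) k
  unfold S
  rw [ev_mul_mod, lO, ev_land]
  · congr 1; funext k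
    rw [land_one_val, cast_cv, co_mul]
    simp
  · intro k; exact lt_of_le_of_lt (hb k) (by norm_num [lw])
  · intro k; norm_num [lw]
  · intro k; exact lt_of_le_of_lt (hb k) (by norm_num [lw])

theorem S_add (x y : A) : S (x + y) = (S x + S y) &&& lO := by
  unfold S
  rw [← ev_add, lO, ev_land]
  · congr 1; funext k
    rw [land_one_val, co_add]; simp
  · intro k
    have := val_le_one (co x k)
    have := val_le_one (co y k)
    exact lt_of_le_of_lt (by omega : _ ≤ 2) (by norm_num [lw])
  · intro k; norm_num [lw]

/-- weight -/
def wt (x : A) : ℕ := ∑ k, (co x k).val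

theorem wt_le (x : A) : wt x ≤ 45 := by
  unfold wt
  refine (Finset.sum_le_sum (g := fun _ => 1) fun i _ => val_le_one _).trans ?_
  simp [ZMod.card]

theorem S_wt (x : A) : S x % (2 ^ lw - 1) = wt x := by
  unfold S; rw [ev_wt]; rfl
  exact lt_of_le_of_lt (wt_le x) (by norm_num [lw])

theorem S_X (k : Z) : S (X k) = 2 ^ (lw * k.val) := by
  unfold S ev
  rw [Finset.sum_eq_single k]
  · simp [co_X]; rfl
  · intro b _ hb; simp [co_X, hb]
  · simp

theorem hammingNorm_D (r a : A) : hammingNorm (Sum.elim (co a) (co (a * r)) : Z ⊕ Z → ZMod 2) = wt a + wt (a * r) := by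
  have h2 : ∀ (c : ZMod 2) (_ : Decidable (c ≠ 0)), (if c ≠ 0 then 1 else 0) = c.val := by
    intro c _
    split_ifs with h
    · have h3 : ∀ c : ZMod 2, c ≠ 0 → 1 = c.val := by decide
      exact h3 c h
    · rw [not_not] at h; subst h; rfl
  unfold hammingNorm wt
  rw [Finset.card_filter, Fintype.sum_sum_type]
  simp only [Sum.elim_inl, Sum.elim_inr]
  exact congrArg₂ _ (Finset.sum_congr rfl fun k _ => h2 _ _) (Finset.sum_congr rfl fun k _ => h2 _ _)

theorem good_of_low (r a : A) (ha : a ≠ 0) (h : wt a + wt (a * r) < 14) : Good r := by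
  intro hm
  have := hm.2 (Sum.elim (co a) (co (a * r))) ⟨a, rfl⟩ ?_
  · rw [hammingNorm_D] at this; omega
  · intro h0
    apply ha; apply co_ext; intro k
    have := congrFun h0 (.inl k)
    rw [co_zero]; simpa using this

end Ring

/-! ## Automorphism criterion -/
section Aut
open Classical

abbrev V := Z ⊕ Z

noncomputable instance : Fintype A := Fintype.ofInjective co fun _ _ h => co_ext fun k => congrFun h k

/-- the code word of `a` -/
noncomputable def wd (r a : A) : V → ZMod 2 := Sum.elim (co a) (co (a * r))

theorem wd_inj (r : A) {a b : A} (h : wd r a = wd r b) : a = b :=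
  co_ext fun k => congrFun h (.inl k)

/-- words of weight 14 -/
noncomputable def W14 (r : A) : Finset A := Finset.univ.filter fun a => wt a + wt (a * r) = 14

/-- number of words of weight 14 through two points -/
noncomputable def M2 (r : A) (p q : V) : ℕ := ∑ a ∈ W14 r, (wd r a p).val * (wd r a q).val

theorem M2_symm (r : A) (p q : V) : M2 r p q = M2 r q p := by
  unfold M2; exact Finset.sum_congr rfl fun a _ => mul_comm _ _

def IsA (r : A) (σ : Equiv.Perm V) : Prop := ∀ f, f ∈ D r ↔ f ∘ σ ∈ D r

theorem IsA.inv {r : A} {σ : Equiv.Perm V} (h : IsA r σ) : IsA r σ⁻¹ := by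
  intro f
  rw [h (f ∘ _)]
  have : (f ∘ ⇑σ⁻¹) ∘ ⇑σ = f := by funext i; simp
  rw [this]

theorem IsA.mul {r : A} {σ τ : Equiv.Perm V} (h : IsA r σ) (h' : IsA r τ) : IsA r (σ * τ) := by
  intro f
  rw [h f, h' (f ∘ _)]; rfl

theorem isA_iff (r : A) (σ : Equiv.Perm V) :
    Submodule.map (LinearMap.funLeft (ZMod 2) (ZMod 2) σ) (D r) = D r ↔ IsA r σ := by
  rw [SetLike.ext_iff]
  have h1 : (∀ x, x ∈ Submodule.map (LinearMap.funLeft (ZMod 2) (ZMod 2) σ) (D r) ↔ x ∈ D r) ↔ IsA r σ⁻¹ := by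
    refine forall_congr' fun f => ?_
    rw [mem_map_funLeft]; exact Iff.comm
  rw [h1]
  exact ⟨fun h => by simpa using h.inv, fun h => h.inv⟩

theorem IsA.exists {r : A} {σ : Equiv.Perm V} (h : IsA r σ) (a : A) : ∃ b, wd r b = wd r a ∘ σ := by
  obtain ⟨b, hb⟩ := (h (wd r a)).1 ⟨a, rfl⟩
  exact ⟨b, hb.symm⟩

theorem wd_norm (r a : A) : hammingNorm (wd r a) = wt a + wt (a * r) := hammingNorm_D r a

theorem IsA.sum {r : A} {σ : Equiv.Perm V} (h : IsA r σ) (F : (V → ZMod 2) → ℕ) :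
    ∑ a ∈ W14 r, F (wd r a ∘ σ) = ∑ a ∈ W14 r, F (wd r a) := by
  choose φ hφ using h.exists
  have hw : ∀ (f : V → ZMod 2), hammingNorm (f ∘ σ) = hammingNorm f := by
    intro f
    unfold hammingNorm
    apply Finset.card_bij (fun i _ => σ i)
    · intro i hi; simpa using hi
    · intro i _ j _ hij; exact σ.injective hij
    · intro j hj; exact ⟨σ.symm j, by simpa using hj, by simp⟩
  choose ψ hψ using h.inv.exists
  refine Finset.sum_bij (fun a _ => φ a) ?_ ?_ ?_ ?_
  · intro a ha
    simp only [W14, Finset.mem_filter, Finset.mem_univ, true_and] at ha ⊢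
    rw [← wd_norm, hφ, hw, wd_norm, ha]
  · intro a _ b _ hab
    have h1 : wd r a ∘ σ = wd r b ∘ σ := by rw [← hφ, ← hφ, hab]
    apply wd_inj r
    funext i
    have := congrFun h1 (σ.symm i)
    simpa using this
  · intro b hb
    have h1 : φ (ψ b) = b := by
      apply wd_inj r
      rw [hφ, hψ]; funext i; simp
    refine ⟨ψ b, ?_, h1⟩
    simp only [W14, Finset.mem_filter, Finset.mem_univ, true_and] at hb ⊢
    rw [← wd_norm, ← hw, ← hφ, h1, wd_norm, hb]
  · intro a _; rw [hφ]

theorem M2_aut {r : A} {σ : Equiv.Perm V} (h : IsA r σ) (p q : V) : M2 r (σ p) (σ q) = M2 r p q := by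
  unfold M2
  exact h.sum fun f => (f p).val * (f q).val

/-- the invariant colour of a pair -/
noncomputable def ka (r : A) (K : ℕ) (p q : V) : ℕ :=
  K * (120 * M2 r p q) + ∑ y, (120 * M2 r p y) * (120 * M2 r y q)

theorem ka_aut {r : A} {σ : Equiv.Perm V} (h : IsA r σ) (K : ℕ) (p q : V) :
    ka r K (σ p) (σ q) = ka r K p q := by
  unfold ka
  rw [M2_aut h]
  refine congrArg (fun z => K * (120 * M2 r p q) + z) ?_
  rw [← Equiv.sum_comp σ]
  refine Finset.sum_congr rfl fun y _ => ?_
  rw [M2_aut h, M2_aut h]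

/-- shift -/
def sh (k : Z) : Equiv.Perm V := Equiv.sumCongr (Equiv.addRight k) (Equiv.addRight k)

/-- reversal -/
def gg (j : Z) : Equiv.Perm V := (Equiv.sumComm Z Z).trans (Equiv.sumCongr (Equiv.subLeft j) (Equiv.subLeft j))

theorem sh_l (k i : Z) : sh k (.inl i) = .inl (i + k) := rfl
theorem sh_r (k i : Z) : sh k (.inr i) = .inr (i + k) := rfl
theorem gg_l (j i : Z) : gg j (.inl i) = .inr (j - i) := rfl
theorem gg_r (j i : Z) : gg j (.inr i) = .inl (j - i) := rfl

theorem isA_of {r : A} {σ : Equiv.Perm V} (h1 : ∀ a, ∃ b, wd r a ∘ σ = wd r b)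
    (h2 : ∀ a, ∃ b, wd r a ∘ ⇑σ⁻¹ = wd r b) : IsA r σ := by
  intro f
  constructor
  · rintro ⟨a, rfl⟩; exact h1 a
  · rintro ⟨a, ha⟩
    obtain ⟨b, hb⟩ := h2 a
    refine ⟨b, ?_⟩
    have : f = (f ∘ σ) ∘ ⇑σ⁻¹ := by funext i; simp
    rw [this, ha]; exact hb

theorem wd_sh (r a : A) (k : Z) : wd r a ∘ sh k = wd r (X (-k) * a) := by
  funext j; rcases j with j | j
  · simp [wd, sh_l, co_X_mul]
  · simp [wd, sh_r, mul_assoc, co_X_mul]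

theorem isA_sh (r : A) (k : Z) : IsA r (sh k) := by
  refine isA_of (fun a => ⟨_, wd_sh r a k⟩) fun a => ⟨X k * a, ?_⟩
  have := wd_sh r (X k * a) k
  rw [← mul_assoc, ← X_add, neg_add_cancel, X_zero, one_mul] at this
  rw [← this]; funext i; simp

theorem wd_gg (r a : A) (hr : r * st r = 1) (j : Z) : wd r a ∘ gg j = wd r (X j * st (a * r)) := by
  funext i; rcases i with i | i
  · simp only [wd, gg_l, Function.comp, Sum.elim_inl, Sum.elim_inr, co_X_mul, co_st, neg_sub]
  · have : X j * st (a * r) * r = X j * st a := by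
      rw [map_mul, mul_assoc, mul_assoc, mul_comm (st r), hr, mul_one]
    simp only [wd, gg_r, Function.comp, Sum.elim_inl, Sum.elim_inr, this, co_X_mul, co_st, neg_sub]

theorem gg_gg (j : Z) : gg j * gg j = 1 := by
  ext i; rcases i with i | i <;> simp [gg_l, gg_r]

theorem isA_gg (r : A) (hr : r * st r = 1) (j : Z) : IsA r (gg j) := by
  have h : (gg j)⁻¹ = gg j := by rw [inv_eq_iff_mul_eq_one, gg_gg]
  refine isA_of (fun a => ⟨_, wd_gg r a hr j⟩) fun a => ⟨X j * st (a * r), ?_⟩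
  rw [h]; exact wd_gg r a hr j

theorem aut_criterion (r : A) (hr : r * st r = 1) (K : ℕ) (j1 j2 : Z)
    (h1 : ∀ q, ka r K (.inl 0) q = ka r K (.inl 0) (.inr j1) → q = .inr j1)
    (h2 : ∀ q, ka r K (.inl 0) q = ka r K (.inl 0) (.inr j2) → q = .inr j2)
    (u : Z) (hu : u * (j1 - j2) = 1) : autGroupOrder (D r) = 90 := by
  -- fixed points of the stabilizer
  let F : V → Prop := fun q => ∀ φ, IsA r φ → φ (.inl 0) = .inl 0 → φ q = q
  have hF1 : F (.inr j1) := fun φ hφ h0 => h1 _ (by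
    have := ka_aut hφ K (.inl 0) (.inr j1); rwa [h0] at this)
  have hF2 : F (.inr j2) := fun φ hφ h0 => h2 _ (by
    have := ka_aut hφ K (.inl 0) (.inr j2); rwa [h0] at this)
  have hcl : ∀ g, IsA r g → F (g (.inl 0)) → ∀ q, F q → F (g q) := by
    intro g hg hg0 q hq φ hφ h0
    have := hq (g⁻¹ * φ * g) ((hg.inv.mul hφ).mul hg) (by
      rw [Equiv.Perm.mul_apply, Equiv.Perm.mul_apply, hg0 φ hφ h0]; simp)
    rw [Equiv.Perm.mul_apply, Equiv.Perm.mul_apply, Equiv.Perm.inv_eq_iff_eq] at this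
    exact this
  have hu1 : F (.inl (j1 - j2)) := by
    have := hcl (gg j1) (isA_gg r hr j1) (by rw [gg_l, sub_zero]; exact hF1) _ hF2
    rwa [gg_r] at this
  have hn : ∀ n : ℕ, F (.inl (n * (j1 - j2))) := by
    intro n
    induction n with
    | zero => intro φ hφ h0; simpa using h0
    | succ n ih =>
      have := hcl (sh (j1 - j2)) (isA_sh r _) (by rw [sh_l, zero_add]; exact hu1) _ ih
      rw [sh_l] at this
      rw [Nat.cast_succ, add_one_mul]; exact this
  have hl : ∀ k, F (.inl k) := by
    intro k
    have := hn (k * u).val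
    rwa [ZMod.natCast_zmod_val, mul_assoc, hu, mul_one] at this
  have hrr : ∀ k, F (.inr k) := by
    intro k
    have := hcl (sh (k - j1)) (isA_sh r _) (hl _) _ hF1
    rwa [sh_r, add_sub_cancel] at this
  have hall : ∀ φ, IsA r φ → φ (.inl 0) = .inl 0 → φ = 1 := by
    intro φ hφ h0
    ext1 q
    rcases q with q | q
    · exact hl q φ hφ h0
    · exact hrr q φ hφ h0
  unfold autGroupOrder
  have hbij : Function.Bijective (fun σ : {σ : Equiv.Perm V //
      Submodule.map (LinearMap.funLeft (ZMod 2) (ZMod 2) ⇑σ) (D r) = D r} => σ.1 (.inl 0)) := by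
    constructor
    · rintro ⟨σ, hσ⟩ ⟨τ, hτ⟩ hst
      rw [isA_iff] at hσ hτ
      have := hall (τ⁻¹ * σ) (hτ.inv.mul hσ) (by
        rw [Equiv.Perm.mul_apply, Equiv.Perm.inv_eq_iff_eq]; exact hst)
      rw [inv_mul_eq_one] at this
      exact Subtype.ext this.symm
    · rintro (q | q)
      · exact ⟨⟨sh q, (isA_iff _ _).2 (isA_sh r q)⟩, by simp [sh_l]⟩
      · exact ⟨⟨gg q, (isA_iff _ _).2 (isA_gg r hr q)⟩, by simp [gg_l]⟩
  rw [Nat.card_eq_of_bijective _ hbij]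
  simp [ZMod.card]

/-! counting -/
noncomputable def cL (r : A) (i : Z) : ℕ := M2 r (.inl 0) (.inl i)
noncomputable def cR (r : A) (i : Z) : ℕ := M2 r (.inl 0) (.inr i)

theorem M2_ll (r : A) (i j : Z) : M2 r (.inl i) (.inl j) = cL r (j - i) := by
  have := M2_aut (isA_sh r i) (.inl 0) (.inl (j - i))
  rwa [sh_l, sh_l, zero_add, sub_add_cancel] at this

theorem M2_lr (r : A) (i j : Z) : M2 r (.inl i) (.inr j) = cR r (j - i) := by
  have := M2_aut (isA_sh r i) (.inl 0) (.inr (j - i))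
  rwa [sh_l, sh_r, zero_add, sub_add_cancel] at this

theorem M2_rl (r : A) (i j : Z) : M2 r (.inr i) (.inl j) = cR r (i - j) := by
  rw [M2_symm, M2_lr]

theorem M2_rr (r : A) (hr : r * st r = 1) (i j : Z) : M2 r (.inr i) (.inr j) = cL r (j - i) := by
  have := M2_aut (isA_gg r hr 0) (.inl (-i)) (.inl (-j))
  rw [gg_l, gg_l, M2_ll] at this
  simp only [sub_neg_eq_add, zero_add] at this
  rw [this, neg_add_eq_sub, ← M2_ll r j i, M2_symm, M2_ll]

theorem ka_l (r : A) (K : ℕ) (i : Z) : ka r K (.inl 0) (.inl i) =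
    K * (120 * cL r i) + (cv (fun k => 120 * cL r k) (fun k => 120 * cL r k) i
      + cv (fun k => 120 * cR r k) (fun k => 120 * cR r (-k)) i) := by
  unfold ka cv
  rw [Fintype.sum_sum_type]
  simp only [M2_ll, M2_lr, M2_rl, sub_zero, neg_sub]

theorem ka_r (r : A) (hr : r * st r = 1) (K : ℕ) (i : Z) : ka r K (.inl 0) (.inr i) =
    K * (120 * cR r i) + 2 * cv (fun k => 120 * cL r k) (fun k => 120 * cR r k) i := by
  unfold ka cv
  rw [Fintype.sum_sum_type]
  simp only [M2_ll, M2_lr, M2_rr r hr, sub_zero]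
  rw [two_mul]
  have : ∑ x : Z, 120 * cR r x * (120 * cL r (i - x)) = ∑ x : Z, 120 * cL r x * (120 * cR r (i - x)) := by
    refine Fintype.sum_equiv (Equiv.subLeft i) _ _ fun k => ?_
    rw [Equiv.subLeft_apply, sub_sub_cancel, mul_comm]
  rw [this]

/-- autocorrelations -/
noncomputable def FL (r a : A) (i : Z) : ℕ := ∑ k, ((co a k).val * (co a (k + i)).val + (co (a * r) k).val * (co (a * r) (k + i)).val)
noncomputable def FR (r a : A) (i : Z) : ℕ := ∑ k, ((co a k).val * (co (a * r) (k + i)).val)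

theorem sum_FL (r : A) (hr : r * st r = 1) (i : Z) : ∑ a ∈ W14 r, FL r a i = 90 * cL r i := by
  unfold FL
  rw [Finset.sum_comm]
  have : ∀ k ∈ (Finset.univ : Finset Z), ∑ a ∈ W14 r, ((co a k).val * (co a (k + i)).val + (co (a * r) k).val * (co (a * r) (k + i)).val)
      = 2 * cL r i := by
    intro k _
    rw [Finset.sum_add_distrib, two_mul]
    congr 1
    · have := M2_ll r k (k + i)
      rw [add_sub_cancel_left] at this
      exact this
    · have := M2_rr r hr k (k + i)
      rw [add_sub_cancel_left] at this
      exact this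
  rw [Finset.sum_congr rfl this, Finset.sum_const, Finset.card_univ, ZMod.card, smul_eq_mul]
  ring

theorem sum_FR (r : A) (i : Z) : ∑ a ∈ W14 r, FR r a i = 45 * cR r i := by
  unfold FR
  rw [Finset.sum_comm]
  have : ∀ k ∈ (Finset.univ : Finset Z), ∑ a ∈ W14 r, ((co a k).val * (co (a * r) (k + i)).val)
      = cR r i := by
    intro k _
    have := M2_lr r k (k + i)
    rw [add_sub_cancel_left] at this
    exact this
  rw [Finset.sum_congr rfl this, Finset.sum_const, Finset.card_univ, ZMod.card, smul_eq_mul]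

theorem wt_X_mul (k : Z) (a : A) : wt (X k * a) = wt a := by
  unfold wt
  refine Fintype.sum_equiv (Equiv.subRight k) _ _ fun i => ?_
  rw [co_X_mul]; rfl

theorem wt_st (a : A) : wt (st a) = wt a := by
  unfold wt
  refine Fintype.sum_equiv (Equiv.neg Z) _ _ fun i => ?_
  rw [co_st]; rfl

theorem FL_X (r a : A) (k i : Z) : FL r (X k * a) i = FL r a i := by
  unfold FL
  refine Fintype.sum_equiv (Equiv.subRight k) _ _ fun j => ?_
  simp only [mul_assoc, co_X_mul, Equiv.subRight_apply]
  have : j + i - k = j - k + i := by ring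
  rw [this]

theorem FR_X (r a : A) (k i : Z) : FR r (X k * a) i = FR r a i := by
  unfold FR
  refine Fintype.sum_equiv (Equiv.subRight k) _ _ fun j => ?_
  simp only [mul_assoc, co_X_mul, Equiv.subRight_apply]
  have : j + i - k = j - k + i := by ring
  rw [this]

theorem tau_mul (r : A) (hr : r * st r = 1) (a : A) : st (a * r) * r = st a := by
  rw [map_mul, mul_assoc, mul_comm (st r), hr, mul_one]

theorem FL_tau (r : A) (hr : r * st r = 1) (a : A) (i : Z) : FL r (st (a * r)) i = FL r a i := by
  unfold FL
  rw [tau_mul r hr]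
  refine Fintype.sum_equiv (Equiv.subLeft (-i)) _ _ fun j => ?_
  simp only [co_st, Equiv.subLeft_apply]
  have h1 : -i - j = -(j + i) := by ring
  have h2 : -(j + i) + i = -j := by ring
  rw [h1, h2]; ring

theorem FR_tau (r : A) (hr : r * st r = 1) (a : A) (i : Z) : FR r (st (a * r)) i = FR r a i := by
  unfold FR
  rw [tau_mul r hr]
  refine Fintype.sum_equiv (Equiv.subLeft (-i)) _ _ fun j => ?_
  simp only [co_st, Equiv.subLeft_apply]
  have h1 : -i - j = -(j + i) := by ring
  have h2 : -(j + i) + i = -j := by ring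
  rw [h1, h2]; ring

/-- words with small left half -/
noncomputable def T14 (r : A) : Finset A := (W14 r).filter fun a => wt a ≤ 7

def mu (a : A) : ℕ := if wt a < 7 then 2 else 1

theorem sum_tau (r : A) (hr : r * st r = 1) (F : A → ℕ) (hF : ∀ a, F (st (a * r)) = F a) :
    ∑ a ∈ W14 r, F a = ∑ a ∈ T14 r, mu a * F a := by
  have e1 : ∑ a ∈ W14 r, F a = ∑ a ∈ (W14 r).filter (fun a => wt a < 7), F a
      + (∑ a ∈ (W14 r).filter (fun a => wt a = 7), F a + ∑ a ∈ (W14 r).filter (fun a => 7 < wt a), F a) := by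
    simp only [Finset.sum_filter, ← Finset.sum_add_distrib]
    refine Finset.sum_congr rfl fun a _ => ?_
    rcases lt_trichotomy (wt a) 7 with h | h | h
    · simp [h, h.ne, h.not_gt]
    · simp [h]
    · simp [h, h.ne', h.not_gt]
  have e2 : ∑ a ∈ T14 r, mu a * F a = 2 * ∑ a ∈ (W14 r).filter (fun a => wt a < 7), F a
      + ∑ a ∈ (W14 r).filter (fun a => wt a = 7), F a := by
    unfold T14 mu
    simp only [Finset.sum_filter, Finset.mul_sum, ← Finset.sum_add_distrib]
    refine Finset.sum_congr rfl fun a _ => ?_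
    rcases lt_trichotomy (wt a) 7 with h | h | h
    · simp [h, h.ne, h.le]
    · simp [h]
    · simp [h.not_ge, h.ne', h.not_gt]
  have htt : ∀ a, st (st (a * r) * r) = a := fun a => by rw [tau_mul r hr, st_st]
  have e3 : ∑ a ∈ (W14 r).filter (fun a => 7 < wt a), F a = ∑ a ∈ (W14 r).filter (fun a => wt a < 7), F a := by
    refine Finset.sum_nbij' (fun a => st (a * r)) (fun a => st (a * r)) ?_ ?_ ?_ ?_ ?_
    · intro a ha
      simp only [W14, Finset.mem_filter, Finset.mem_univ, true_and, tau_mul r hr, wt_st] at ha ⊢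
      omega
    · intro a ha
      simp only [W14, Finset.mem_filter, Finset.mem_univ, true_and, tau_mul r hr, wt_st] at ha ⊢
      omega
    · intro a _; exact htt a
    · intro a _; exact htt a
    · intro a _; exact (hF a).symm
  rw [e1, e2, e3]; ring

/-- number of pointings -/
noncomputable def gp (P : A → Prop) (a : A) : ℕ := (Finset.univ.filter fun k : Z => P (X (-k) * a)).card

theorem gp_X (P : A → Prop) (a : A) (k : Z) : gp P (X k * a) = gp P a := by
  unfold gp
  refine Finset.card_bij (fun i _ => i - k) ?_ ?_ ?_
  · intro i hi
    simp only [Finset.mem_filter, Finset.mem_univ, true_and] at hi ⊢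
    rw [← mul_assoc, ← X_add] at hi
    have : -(i - k) = -i + k := by ring
    rwa [this]
  · intro i _ j _ h; simpa using h
  · intro j hj
    simp only [Finset.mem_filter, Finset.mem_univ, true_and] at hj ⊢
    refine ⟨j + k, ?_, by ring⟩
    rw [← mul_assoc, ← X_add]
    have : -(j + k) + k = -j := by ring
    rwa [this]

theorem mem_T14_X (r a : A) (k : Z) : X k * a ∈ T14 r ↔ a ∈ T14 r := by
  simp only [T14, W14, Finset.mem_filter, Finset.mem_univ, true_and, mul_assoc, wt_X_mul]

/-- multiplicity -/
noncomputable def mm (P : A → Prop) (a : A) : ℕ := mu a * (60 / gp P a)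

theorem sum_point (r : A) (P : A → Prop) (hex : ∀ a ∈ T14 r, ∃ k, P (X k * a))
    (hdvd : ∀ a ∈ T14 r, P a → gp P a ∣ 60) (F : A → ℕ) (hF : ∀ k a, F (X k * a) = F a) :
    60 * ∑ a ∈ T14 r, mu a * F a = 45 * ∑ a ∈ (T14 r).filter P, mm P a * F a := by
  have hmu : ∀ k a, mu (X k * a) = mu a := fun k a => by unfold mu; rw [wt_X_mul]
  have h1 : ∀ a ∈ T14 r, gp P a * (60 / gp P a) = 60 := by
    intro a ha
    obtain ⟨k, hk⟩ := hex a ha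
    have := hdvd _ ((mem_T14_X r a k).2 ha) hk
    rw [gp_X] at this
    exact Nat.mul_div_cancel' this
  have h2 : 60 * ∑ a ∈ T14 r, mu a * F a = ∑ a ∈ T14 r, ∑ k : Z, if P (X (-k) * a) then mm P a * F a else 0 := by
    rw [Finset.mul_sum]
    refine Finset.sum_congr rfl fun a ha => ?_
    rw [← Finset.sum_filter, Finset.sum_const, smul_eq_mul]
    change _ = gp P a * _
    unfold mm
    calc 60 * (mu a * F a) = (gp P a * (60 / gp P a)) * (mu a * F a) := by rw [h1 a ha]
      _ = _ := by ring
  rw [h2, Finset.sum_comm]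
  have h3 : ∀ k ∈ (Finset.univ : Finset Z), (∑ a ∈ T14 r, if P (X (-k) * a) then mm P a * F a else 0)
      = ∑ a ∈ (T14 r).filter P, mm P a * F a := by
    intro k _
    rw [Finset.sum_filter]
    refine Finset.sum_nbij' (fun a => X (-k) * a) (fun a => X k * a) ?_ ?_ ?_ ?_ ?_
    · intro a ha; exact (mem_T14_X _ _ _).2 ha
    · intro a ha; exact (mem_T14_X _ _ _).2 ha
    · intro a _; rw [← mul_assoc, ← X_add, add_neg_cancel, X_zero, one_mul]
    · intro a _; rw [← mul_assoc, ← X_add, neg_add_cancel, X_zero, one_mul]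
    · intro a _
      simp only [mm, hF, hmu, gp_X]
  rw [Finset.sum_congr rfl h3, Finset.sum_const, Finset.card_univ, ZMod.card, smul_eq_mul]

theorem cL_formula (r : A) (hr : r * st r = 1) (P : A → Prop) (hex : ∀ a ∈ T14 r, ∃ k, P (X k * a))
    (hdvd : ∀ a ∈ T14 r, P a → gp P a ∣ 60) (i : Z) :
    120 * cL r i = ∑ a ∈ (T14 r).filter P, mm P a * FL r a i := by
  have h1 := sum_FL r hr i
  rw [sum_tau r hr (fun a => FL r a i) (fun a => FL_tau r hr a i)] at h1
  have h2 := sum_point r P hex hdvd (fun a => FL r a i) (fun k a => FL_X r a k i)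
  rw [h1] at h2
  generalize (∑ a ∈ (T14 r).filter P, mm P a * FL r a i) = s at *
  omega

theorem cR_formula (r : A) (hr : r * st r = 1) (P : A → Prop) (hex : ∀ a ∈ T14 r, ∃ k, P (X k * a))
    (hdvd : ∀ a ∈ T14 r, P a → gp P a ∣ 60) (i : Z) :
    120 * cR r i = ∑ a ∈ (T14 r).filter P, 2 * mm P a * FR r a i := by
  have h1 := sum_FR r i
  rw [sum_tau r hr (fun a => FR r a i) (fun a => FR_tau r hr a i)] at h1
  have h2 := sum_point r P hex hdvd (fun a => FR r a i) (fun k a => FR_X r a k i)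
  rw [h1] at h2
  simp only [mul_assoc]
  rw [← Finset.mul_sum]
  generalize (∑ a ∈ (T14 r).filter P, mm P a * FR r a i) = s at *
  omega

end Aut

/-! ## Enumeration trees and bit slices -/
section Simd

inductive Tr where
  | nil : Tr
  | leaf : Tr
  | node : (s p : Nat) → Tr → Tr → Tr
  | cat : (s : Nat) → Tr → Tr → Tr

structure Sl where
  tr : Tr
  sz : Nat
  sl : List Nat

noncomputable def zipCat (s : Nat) (hi : List Nat) : List Nat → List Nat :=
  List.rec (motive := fun _ => List Nat → List Nat) (fun _ => [])
    (fun h _ ih lo => List.rec (motive := fun _ => List Nat) []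
      (fun l lo' _ => Nat.lor l (Nat.shiftLeft h s) :: ih lo') lo) hi

noncomputable def comb (p : Nat) (hi lo : Sl) : Sl :=
  Sl.mk (Tr.node lo.sz p lo.tr hi.tr) (Nat.add lo.sz hi.sz)
    (Nat.shiftLeft (Nat.sub (Nat.pow 2 hi.sz) 1) lo.sz :: zipCat lo.sz hi.sl lo.sl)

noncomputable def skp (lo : Sl) : Sl := Sl.mk lo.tr lo.sz (0 :: lo.sl)

noncomputable def stepGo (p : Nat) (row : List Sl) : Sl → List Sl :=
  List.rec (motive := fun _ => Sl → List Sl) (fun _ => [])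
    (fun q _ ih a => comb p a q :: ih q) row

noncomputable def stepRow (p : Nat) (row : List Sl) : List Sl :=
  List.rec (motive := fun _ => List Sl) []
    (fun q l _ => skp q :: stepGo p l q) row

/-- subsets of `1..n` of sizes `0..6` -/
noncomputable def row (n : Nat) : List Sl :=
  Nat.rec (motive := fun _ => List Sl)
    [⟨.leaf, 1, []⟩, ⟨.nil, 0, []⟩, ⟨.nil, 0, []⟩, ⟨.nil, 0, []⟩, ⟨.nil, 0, []⟩, ⟨.nil, 0, []⟩, ⟨.nil, 0, []⟩]
    (fun k ih => stepRow (Nat.succ k) ih) n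

noncomputable def catSl (p q : Sl) : Sl := Sl.mk (Tr.cat q.sz q.tr p.tr) (Nat.add q.sz p.sz) (zipCat q.sz p.sl q.sl)

def Tr.elems : Tr → List (Finset ℕ)
  | .nil => []
  | .leaf => [∅]
  | .node _ p l r => l.elems ++ r.elems.map (insert p)
  | .cat _ l r => l.elems ++ r.elems

def Tr.WF : Tr → Prop
  | .nil => True
  | .leaf => True
  | .node s p l r => s = l.elems.length ∧ (∀ x ∈ r.elems, p ∉ x) ∧ l.WF ∧ r.WF
  | .cat s l r => s = l.elems.length ∧ l.WF ∧ r.WF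

/-- pack a list of bits -/
def pk : List Bool → ℕ
  | [] => 0
  | b :: l => 2 * pk l + b.toNat

theorem pk_testBit (l : List Bool) (k : ℕ) : (pk l).testBit k = l.getD k false := by
  induction l generalizing k with
  | nil => simp [pk]
  | cons b l ih =>
    cases k with
    | zero => cases b <;> simp [pk, Nat.testBit_zero] <;> omega
    | succ k =>
      rw [Nat.testBit_succ]
      have : (2 * pk l + b.toNat) / 2 = pk l := by have := Bool.toNat_lt b; omega
      rw [pk, this, ih]; simp

theorem pk_append (l m : List Bool) : pk (l ++ m) = Nat.lor (pk l) (Nat.shiftLeft (pk m) l.length) := by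
  apply Nat.eq_of_testBit_eq
  intro k
  change _ = (pk l ||| (pk m <<< l.length)).testBit k
  rw [Nat.testBit_or, Nat.testBit_shiftLeft, pk_testBit, pk_testBit, pk_testBit]
  by_cases h : k < l.length
  · simp [List.getD, h, List.getElem?_append]
  · simp [List.getD, h, List.getElem?_append, List.getElem?_eq_none (not_lt.1 h)]
    simp [not_lt.1 h]

theorem pk_ones (n : ℕ) : pk (List.replicate n true) = 2 ^ n - 1 := by
  induction n with
  | zero => rfl
  | succ n ih =>
    rw [List.replicate_succ, pk, ih]
    have : 0 < 2 ^ n := Nat.two_pow_pos n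
    simp [pow_succ]; omega

theorem pk_zeros (n : ℕ) : pk (List.replicate n false) = 0 := by
  induction n with
  | zero => rfl
  | succ n ih => rw [List.replicate_succ, pk, ih]; rfl

/-- slice of position `i` -/
def slc (E : List (Finset ℕ)) (i : ℕ) : ℕ := pk (E.map fun s => decide (i ∈ s))

theorem slc_append (E F : List (Finset ℕ)) (i : ℕ) :
    slc (E ++ F) i = Nat.lor (slc E i) (Nat.shiftLeft (slc F i) E.length) := by
  unfold slc; rw [List.map_append, pk_append, List.length_map]

/-- positions `n, …, 1` -/
def dsc : ℕ → List ℕ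
  | 0 => []
  | n + 1 => (n + 1) :: dsc n

structure Sl.Gen (n : ℕ) (a : Sl) : Prop where
  wf : a.tr.WF
  sz : a.sz = a.tr.elems.length
  sl : a.sl = (dsc n).map (slc a.tr.elems)
  bd : ∀ x ∈ a.tr.elems, ∀ i ∈ x, 1 ≤ i ∧ i ≤ n

theorem zipCat_map (s : ℕ) (l : List ℕ) (f g : ℕ → ℕ) :
    zipCat s (l.map f) (l.map g) = l.map fun i => Nat.lor (g i) (Nat.shiftLeft (f i) s) := by
  induction l with
  | nil => rfl
  | cons i l ih =>
    rw [List.map_cons, List.map_cons, List.map_cons, ← ih]; rfl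

theorem dsc_le {n i : ℕ} (h : i ∈ dsc n) : i ≤ n := by
  induction n with
  | zero => simp [dsc] at h
  | succ n ih =>
    rw [dsc, List.mem_cons] at h
    rcases h with h | h
    · omega
    · have := ih h; omega

theorem slc_zero (E : List (Finset ℕ)) (i : ℕ) (h : ∀ x ∈ E, i ∉ x) : slc E i = 0 := by
  unfold slc
  have : (E.map fun s => decide (i ∈ s)) = List.replicate E.length false := by
    rw [List.eq_replicate_iff]
    refine ⟨by simp, ?_⟩
    intro b hb
    obtain ⟨s, hs, rfl⟩ := List.mem_map.1 hb
    simp [h s hs]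
  rw [this, pk_zeros]

theorem slc_one (E : List (Finset ℕ)) (i : ℕ) (h : ∀ x ∈ E, i ∈ x) : slc E i = 2 ^ E.length - 1 := by
  unfold slc
  have : (E.map fun s => decide (i ∈ s)) = List.replicate E.length true := by
    rw [List.eq_replicate_iff]
    refine ⟨by simp, ?_⟩
    intro b hb
    obtain ⟨s, hs, rfl⟩ := List.mem_map.1 hb
    simp [h s hs]
  rw [this, pk_ones]

theorem gen_comb {n : ℕ} {hi lo : Sl} (hh : hi.Gen n) (hl : lo.Gen n) : (comb (n + 1) hi lo).Gen (n + 1) := by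
  refine ⟨⟨hl.sz, ?_, hl.wf, hh.wf⟩, ?_, ?_, ?_⟩
  · intro x hx hn
    have := hh.bd x hx _ hn; omega
  · change lo.sz + hi.sz = (lo.tr.elems ++ hi.tr.elems.map (insert (n + 1))).length
    rw [List.length_append, List.length_map, hl.sz, hh.sz]
  · change Nat.shiftLeft (Nat.sub (Nat.pow 2 hi.sz) 1) lo.sz :: zipCat lo.sz hi.sl lo.sl =
      (dsc (n + 1)).map (slc (lo.tr.elems ++ hi.tr.elems.map (insert (n + 1))))
    rw [dsc, List.map_cons]
    congr 1
    · rw [slc_append, slc_zero lo.tr.elems, slc_one, List.length_map, ← hl.sz, ← hh.sz]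
      · exact (Nat.zero_or _).symm
      · intro x hx
        obtain ⟨y, _, rfl⟩ := List.mem_map.1 hx
        exact Finset.mem_insert_self _ _
      · intro x hx hn
        have := hl.bd x hx _ hn; omega
    · rw [hl.sl, hh.sl, zipCat_map]
      refine List.map_congr_left fun i hi' => ?_
      rw [slc_append, hl.sz]
      congr 2
      unfold slc
      rw [List.map_map]
      congr 1
      refine List.map_congr_left fun x _ => ?_
      have : i ≠ n + 1 := by have := dsc_le hi'; omega
      simp [this]
  · intro x hx i hix
    change x ∈ lo.tr.elems ++ hi.tr.elems.map (insert (n + 1)) at hx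
    rw [List.mem_append, List.mem_map] at hx
    rcases hx with hx | ⟨y, hy, rfl⟩
    · have := hl.bd x hx i hix; omega
    · rw [Finset.mem_insert] at hix
      rcases hix with h | h
      · omega
      · have := hh.bd y hy i h; omega

theorem gen_skp {n : ℕ} {lo : Sl} (hl : lo.Gen n) : (skp lo).Gen (n + 1) := by
  refine ⟨hl.wf, hl.sz, ?_, ?_⟩
  · change 0 :: lo.sl = (dsc (n + 1)).map (slc lo.tr.elems)
    rw [dsc, List.map_cons, slc_zero, hl.sl]
    intro x hx hn
    have := hl.bd x hx _ hn; omega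
  · intro x hx i hix
    have := hl.bd x hx i hix; omega

theorem gen_cat {n : ℕ} {p q : Sl} (hp : p.Gen n) (hq : q.Gen n) : (catSl p q).Gen n := by
  refine ⟨⟨hq.sz, hq.wf, hp.wf⟩, ?_, ?_, ?_⟩
  · change q.sz + p.sz = (q.tr.elems ++ p.tr.elems).length
    rw [List.length_append, hq.sz, hp.sz]
  · change zipCat q.sz p.sl q.sl = (dsc n).map (slc (q.tr.elems ++ p.tr.elems))
    rw [hp.sl, hq.sl, zipCat_map]
    refine List.map_congr_left fun i _ => ?_
    rw [slc_append, hq.sz]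
  · intro x hx i hix
    change x ∈ q.tr.elems ++ p.tr.elems at hx
    rw [List.mem_append] at hx
    rcases hx with hx | hx
    · exact hq.bd x hx i hix
    · exact hp.bd x hx i hix

/-- enumerates all `w`-subsets of `1..n` -/
structure Sl.Ok (n w : ℕ) (a : Sl) : Prop where
  gen : a.Gen n
  mem : ∀ x, x ∈ a.tr.elems ↔ x ∈ Finset.powersetCard w (Finset.Icc 1 n)
  nd : a.tr.elems.Nodup

theorem ok_comb {n w : ℕ} {hi lo : Sl} (hh : hi.Ok n w) (hl : lo.Ok n (w + 1)) :
    (comb (n + 1) hi lo).Ok (n + 1) (w + 1) := by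
  have hI : Finset.Icc 1 (n + 1) = insert (n + 1) (Finset.Icc 1 n) := by
    ext i; simp; omega
  have hn : n + 1 ∉ Finset.Icc 1 n := by simp
  have hnh : ∀ x ∈ hi.tr.elems, n + 1 ∉ x := by
    intro x hx h; have := hh.gen.bd x hx _ h; omega
  refine ⟨gen_comb hh.gen hl.gen, ?_, ?_⟩
  · intro x
    change x ∈ lo.tr.elems ++ hi.tr.elems.map (insert (n + 1)) ↔ _
    rw [hI, Finset.powersetCard_succ_insert hn, List.mem_append, Finset.mem_union, hl.mem, List.mem_map,
      Finset.mem_image]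
    simp only [hh.mem]
  · change (lo.tr.elems ++ hi.tr.elems.map (insert (n + 1))).Nodup
    rw [List.nodup_append]
    refine ⟨hl.nd, ?_, ?_⟩
    · refine List.Nodup.map_on ?_ hh.nd
      intro x hx y hy hxy
      rw [← Finset.erase_insert (hnh x hx), hxy, Finset.erase_insert (hnh y hy)]
    · intro x hx y hy hxy
      obtain ⟨z, _, rfl⟩ := List.mem_map.1 hy
      have := hl.gen.bd x hx (n + 1) (by rw [hxy]; exact Finset.mem_insert_self _ _)
      omega

theorem ok_skp {n : ℕ} {lo : Sl} (hl : lo.Ok n 0) : (skp lo).Ok (n + 1) 0 := by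
  refine ⟨gen_skp hl.gen, ?_, hl.nd⟩
  intro x
  change x ∈ lo.tr.elems ↔ _
  rw [hl.mem]; simp

def OkL (n : ℕ) : ℕ → List Sl → Prop
  | _, [] => True
  | w, q :: l => q.Ok n w ∧ OkL n (w + 1) l

theorem okL_stepGo {n : ℕ} (l : List Sl) (w : ℕ) (p : Sl) (hp : p.Ok n w) (hl : OkL n (w + 1) l) :
    OkL (n + 1) (w + 1) (stepGo (n + 1) l p) := by
  induction l generalizing w p with
  | nil => trivial
  | cons q l ih => exact ⟨ok_comb hp hl.1, ih (w + 1) q hl.1 hl.2⟩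

theorem stepGo_length (n : ℕ) (l : List Sl) (p : Sl) : (stepGo n l p).length = l.length := by
  induction l generalizing p with
  | nil => rfl
  | cons q l ih =>
    change (stepGo n l q).length + 1 = _
    rw [ih]; rfl

theorem okL_stepRow {n : ℕ} (l : List Sl) (hl : OkL n 0 l) : OkL (n + 1) 0 (stepRow (n + 1) l) := by
  cases l with
  | nil => trivial
  | cons q l => exact ⟨ok_skp hl.1, okL_stepGo l 0 q hl.1 hl.2⟩

theorem stepRow_length (n : ℕ) (l : List Sl) : (stepRow n l).length = l.length := by
  cases l with
  | nil => rfl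
  | cons q l =>
    change (stepGo n l q).length + 1 = _
    rw [stepGo_length]; rfl

theorem okL_row (n : ℕ) : OkL n 0 (row n) := by
  induction n with
  | zero =>
    have h : ∀ w, (⟨.nil, 0, []⟩ : Sl).Ok 0 (w + 1) := by
      intro w
      refine ⟨⟨trivial, rfl, rfl, ?_⟩, ?_, List.nodup_nil⟩
      · intro x hx; cases hx
      · intro x
        simp [Tr.elems, Finset.mem_powersetCard]
        rintro rfl; simp
    refine ⟨⟨⟨trivial, rfl, rfl, ?_⟩, ?_, ?_⟩, h _, h _, h _, h _, h _, h _, trivial⟩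
    · intro x hx i hi; simp [Tr.elems] at hx; subst hx; simp at hi
    · intro x; simp [Tr.elems]
    · simp [Tr.elems]
  | succ n ih => exact okL_stepRow _ ih

theorem row_length (n : ℕ) : (row n).length = 7 := by
  induction n with
  | zero => rfl
  | succ n ih => exact (stepRow_length _ _).trans ih

noncomputable def nthSl (l : List Sl) (i : ℕ) : Sl := l.getD i ⟨.nil, 0, []⟩

theorem okL_nth {n : ℕ} (l : List Sl) (w : ℕ) (hl : OkL n w l) (i : ℕ) (hi : i < l.length) :
    (nthSl l i).Ok n (w + i) := by
  induction l generalizing w i with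
  | nil => simp at hi
  | cons q l ih =>
    cases i with
    | zero => exact hl.1
    | succ i =>
      have := ih (w + 1) hl.2 i (by simpa using hi)
      have e : w + (i + 1) = w + 1 + i := by omega
      rw [e]; exact this

theorem ok_row (n w : ℕ) (hw : w < 7) : (nthSl (row n) w).Ok n w := by
  have := okL_nth _ 0 (okL_row n) w (by rw [row_length]; exact hw)
  rwa [zero_add] at this

/-! selection by a bit mask, tree traversal -/
def sel {α : Type*} : List α → ℕ → List α
  | [], _ => []
  | x :: l, v => if v.testBit 0 then x :: sel l (v / 2) else sel l (v / 2)

theorem sel_zero {α : Type*} (l : List α) : sel l 0 = [] := by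
  induction l with
  | nil => rfl
  | cons x l ih => simp [sel, ih]

theorem sel_append {α : Type*} (l m : List α) (v : ℕ) :
    sel (l ++ m) v = sel l (v % 2 ^ l.length) ++ sel m (v >>> l.length) := by
  induction l generalizing v with
  | nil => simp [sel]
  | cons x l ih =>
    rw [List.cons_append, sel, sel, ih]
    have h1 : (v % 2 ^ (x :: l).length).testBit 0 = v.testBit 0 := by
      rw [Nat.testBit_mod_two_pow]; simp
    have h2 : v % 2 ^ (x :: l).length / 2 = v / 2 % 2 ^ l.length := by
      apply Nat.eq_of_testBit_eq; intro k
      rw [← Nat.testBit_succ, Nat.testBit_mod_two_pow, Nat.testBit_mod_two_pow, Nat.testBit_succ]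
      simp
    have h3 : v >>> (x :: l).length = (v / 2) >>> l.length := by
      apply Nat.eq_of_testBit_eq; intro k
      rw [Nat.testBit_shiftRight, Nat.testBit_shiftRight, ← Nat.testBit_succ]
      congr 1
      simp; omega
    rw [h1, h2, h3]
    split_ifs <;> simp

theorem sel_map {α β : Type*} (f : α → β) (l : List α) (v : ℕ) : sel (l.map f) v = (sel l v).map f := by
  induction l generalizing v with
  | nil => rfl
  | cons x l ih =>
    rw [List.map_cons, sel, sel, ih]
    split_ifs <;> simp

theorem sel_sublist {α : Type*} (l : List α) (v : ℕ) : (sel l v).Sublist l := by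
  induction l generalizing v with
  | nil => exact List.Sublist.refl _
  | cons x l ih =>
    rw [sel]
    split_ifs
    · exact (ih _).cons_cons x
    · exact (ih _).cons x

theorem mem_sel {α : Type*} (l : List α) (v k : ℕ) (hk : k < l.length) (h : v.testBit k = true) :
    l[k] ∈ sel l v := by
  induction l generalizing v k with
  | nil => simp at hk
  | cons x l ih =>
    rw [sel]
    cases k with
    | zero => simp [h]
    | succ k =>
      have := ih (v / 2) k (by simpa using hk) (by rw [← Nat.testBit_succ]; exact h)
      split_ifs
      · exact List.mem_cons_of_mem _ this
      · exact this

noncomputable def trav (t : Tr) : Nat → Nat → Nat → List (Nat × Nat) → List (Nat × Nat) :=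
  Tr.rec (motive := fun _ => Nat → Nat → Nat → List (Nat × Nat) → List (Nat × Nat))
    (fun _ _ _ acc => acc)
    (fun v a b acc => Bool.rec (motive := fun _ => List (Nat × Nat)) ((a, b) :: acc) acc (Nat.beq v 0))
    (fun s p _ _ il ir v a b acc => Bool.rec (motive := fun _ => List (Nat × Nat))
      (il (Nat.land v (Nat.sub (Nat.pow 2 s) 1)) a b
        (ir (Nat.shiftRight v s) (Nat.add a (Nat.pow 2 (Nat.mul 72 p)))
          (Nat.add b (Nat.pow 2 (Nat.mul 72 (Nat.sub 45 p)))) acc)) acc (Nat.beq v 0))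
    (fun s _ _ il ir v a b acc => Bool.rec (motive := fun _ => List (Nat × Nat))
      (il (Nat.land v (Nat.sub (Nat.pow 2 s) 1)) a b (ir (Nat.shiftRight v s) a b acc)) acc (Nat.beq v 0)) t

def spN (s : Finset ℕ) : ℕ := ∑ p ∈ s, 2 ^ (72 * p)
def rvN (s : Finset ℕ) : ℕ := ∑ p ∈ s, 2 ^ (72 * (45 - p))

theorem bool_rec_beq {α : Type*} (v : ℕ) (x y : α) :
    Bool.rec (motive := fun _ => α) x y (Nat.beq v 0) = if v = 0 then y else x := by
  cases v with
  | zero => rfl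
  | succ v => rfl

theorem trav_spec (t : Tr) (ht : t.WF) (v a b : ℕ) (hv : v < 2 ^ t.elems.length) (acc : List (ℕ × ℕ)) :
    trav t v a b acc = (sel t.elems v).map (fun s => (a + spN s, b + rvN s)) ++ acc := by
  induction t generalizing v a b acc with
  | nil => rfl
  | leaf =>
    change Bool.rec (motive := fun _ => List (Nat × Nat)) ((a, b) :: acc) acc (Nat.beq v 0) = _
    rw [bool_rec_beq]
    have hv : v < 2 := hv
    have : v = 0 ∨ v = 1 := by omega
    rcases this with rfl | rfl
    · simp [sel_zero]
    · simp [Tr.elems, sel, spN, rvN]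
  | node s p l r ihl ihr =>
    obtain ⟨hs, hp, hl, hr⟩ := ht
    change Bool.rec (motive := fun _ => List (Nat × Nat)) (trav l (v &&& (2 ^ s - 1)) a b
      (trav r (v >>> s) (a + 2 ^ (72 * p)) (b + 2 ^ (72 * (45 - p))) acc)) acc (Nat.beq v 0) = _
    rw [bool_rec_beq]
    split_ifs with h0
    · subst h0; simp [sel_zero]
    · have hlen : (Tr.node s p l r).elems.length = l.elems.length + r.elems.length := by
        simp [Tr.elems]
      rw [hlen, pow_add] at hv
      rw [Nat.and_two_pow_sub_one_eq_mod, ihl hl, ihr hr]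
      · rw [Tr.elems, sel_append, sel_map, List.map_append, List.map_map, hs, List.append_assoc]
        congr 2
        refine List.map_congr_left fun x hx => ?_
        have := hp x ((sel_sublist _ _).subset hx)
        simp only [Function.comp, spN, rvN, Finset.sum_insert this, add_assoc]
      · rw [hs, Nat.shiftRight_eq_div_pow]
        exact Nat.div_lt_of_lt_mul hv
      · rw [hs]; exact Nat.mod_lt _ (Nat.two_pow_pos _)
  | cat s l r ihl ihr =>
    obtain ⟨hs, hl, hr⟩ := ht
    change Bool.rec (motive := fun _ => List (Nat × Nat)) (trav l (v &&& (2 ^ s - 1)) a b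
      (trav r (v >>> s) a b acc)) acc (Nat.beq v 0) = _
    rw [bool_rec_beq]
    split_ifs with h0
    · subst h0; simp [sel_zero]
    · have hlen : (Tr.cat s l r).elems.length = l.elems.length + r.elems.length := by
        simp [Tr.elems]
      rw [hlen, pow_add] at hv
      rw [Nat.and_two_pow_sub_one_eq_mod, ihl hl, ihr hr]
      · rw [Tr.elems, sel_append, List.map_append, hs, List.append_assoc]
      · rw [hs, Nat.shiftRight_eq_div_pow]
        exact Nat.div_lt_of_lt_mul hv
      · rw [hs]; exact Nat.mod_lt _ (Nat.two_pow_pos _)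

/-- xor of the selected entries -/
def xsum : List ℕ → List Bool → ℕ
  | x :: l, b :: D => (bif b then x else 0) ^^^ xsum l D
  | _, _ => 0

theorem xsum_append (l m : List ℕ) (D : List Bool) (h : l.length ≤ D.length) :
    xsum (l ++ m) D = xsum l D ^^^ xsum m (D.drop l.length) := by
  induction l generalizing D with
  | nil => cases D <;> simp [xsum]
  | cons x l ih =>
    cases D with
    | nil => simp at h
    | cons d D =>
      rw [List.cons_append, xsum, xsum, ih D (by simpa using h), Nat.xor_assoc]
      rfl

/-! carry save adders -/
def csa : List Nat → Nat → Nat × List Nat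
  | [], s => (s, [])
  | [x], s => (Nat.xor s x, [Nat.land s x])
  | x :: y :: l, s =>
    let t := Nat.xor s x
    let p := csa l (Nat.xor t y)
    (p.1, Nat.lor (Nat.land s x) (Nat.land t y) :: p.2)

def cnt (l : List ℕ) (k : ℕ) : ℕ := (l.map fun x => (x.testBit k).toNat).sum

theorem csa_spec (l : List ℕ) (s k : ℕ) :
    (s.testBit k).toNat + cnt l k = ((csa l s).1.testBit k).toNat + 2 * cnt (csa l s).2 k := by
  fun_induction csa l s with
  | case1 s => simp [cnt]
  | case2 x s =>
    change (s.testBit k).toNat + cnt [x] k = ((s ^^^ x).testBit k).toNat + 2 * cnt [s &&& x] k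
    simp only [cnt, List.map_cons, List.map_nil, List.sum_cons, List.sum_nil, Nat.testBit_xor, Nat.testBit_and]
    cases s.testBit k <;> cases x.testBit k <;> rfl
  | case3 x y l s t p ih =>
    have h1 : cnt (x :: y :: l) k = (x.testBit k).toNat + ((y.testBit k).toNat + cnt l k) := by simp [cnt]
    have h2 : cnt (Nat.lor (Nat.land s x) (Nat.land t y) :: p.2) k =
      (((s &&& x) ||| ((s ^^^ x) &&& y)).testBit k).toNat + cnt p.2 k := by unfold cnt; rw [List.map_cons, List.sum_cons]; rfl
    have h3 : (Nat.xor t y).testBit k = ((s ^^^ x) ^^^ y).testBit k := rfl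
    rw [h3] at ih
    change _ = (p.1.testBit k).toNat + 2 * cnt (Nat.lor (Nat.land s x) (Nat.land t y) :: p.2) k
    rw [h1, h2]
    change _ = (p.1.testBit k).toNat + 2 * cnt p.2 k at ih
    simp only [Nat.testBit_xor, Nat.testBit_and, Nat.testBit_or] at ih ⊢
    revert ih
    cases s.testBit k <;> cases x.testBit k <;> cases y.testBit k <;> simp <;> omega

end Simd

/-! ## Soundness of the enumeration -/
section Words
open Classical

theorem val_add_two (x y : ZMod 2) : (x + y).val + 2 * (x.val * y.val) = x.val + y.val := by
  decide +revert

theorem val_mul_two (x y : ZMod 2) : x.val * y.val = (x * y).val := by decide +revert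

theorem val_eq_one (c : ZMod 2) : c.val = if c = 1 then 1 else 0 := by decide +revert

noncomputable def inn (x y : A) : ℕ := ∑ k, (co x k).val * (co y k).val

theorem wt_add (x y : A) : wt (x + y) + 2 * inn x y = wt x + wt y := by
  unfold wt inn
  rw [Finset.mul_sum, ← Finset.sum_add_distrib, ← Finset.sum_add_distrib]
  exact Finset.sum_congr rfl fun k _ => by rw [co_add]; exact val_add_two _ _

theorem inn_cast (x y : A) : ((inn x y : ℕ) : ZMod 2) = co (x * st y) 0 := by
  rw [co_mul]; unfold inn
  push_cast
  refine Finset.sum_congr rfl fun k _ => ?_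
  rw [co_st, zero_sub, neg_neg, ZMod.natCast_zmod_val, ZMod.natCast_zmod_val]

theorem inn_even (r : A) (hr : r * st r = 1) (x y : A) : 2 ∣ inn x y + inn (x * r) (y * r) := by
  rw [← ZMod.natCast_eq_zero_iff]
  push_cast
  rw [inn_cast, inn_cast, map_mul]
  have : x * r * (st y * st r) = x * st y := by
    calc x * r * (st y * st r) = x * st y * (r * st r) := by ring
      _ = _ := by rw [hr, mul_one]
  rw [this]
  exact CharTwo.add_self_eq_zero _

theorem wt_mod4 (r : A) (hr : r * st r = 1) (hw : wt r % 4 = 1) (s : Finset Z) :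
    (wt (∑ i ∈ s, X i) + wt ((∑ i ∈ s, X i) * r)) % 4 = (2 * s.card) % 4 := by
  induction s using Finset.induction_on with
  | empty => simp [wt, co_zero]
  | insert i s hi ih =>
    rw [Finset.sum_insert hi, Finset.card_insert_of_notMem hi, add_mul]
    have h1 := wt_add (X i) (∑ i ∈ s, X i)
    have h2 := wt_add (X i * r) ((∑ i ∈ s, X i) * r)
    have h3 := inn_even r hr (X i) (∑ i ∈ s, X i)
    have h4 : wt (X i) = 1 := by
      have := wt_X_mul i 1
      rw [mul_one] at this
      rw [this]; unfold wt; simp only [co_one, val_eq_one]; simp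
    rw [wt_X_mul] at h2
    omega

theorem sum_supp (a : A) : ∑ i ∈ Finset.univ.filter (fun k => co a k = 1), X i = a := by
  conv_rhs => rw [eq_sum_X a]
  rw [Finset.sum_filter]
  refine Finset.sum_congr rfl fun i _ => ?_
  generalize co a i = c
  rcases (by decide +revert : c = 0 ∨ c = 1) with rfl | rfl <;> simp

theorem wt_supp (a : A) : wt a = (Finset.univ.filter (fun k => co a k = 1)).card := by
  rw [Finset.card_filter]
  exact Finset.sum_congr rfl fun i _ => val_eq_one _

theorem wt_odd (r : A) (hr : r * st r = 1) (hw : wt r % 4 = 1) (a : A) (h : wt a + wt (a * r) = 14) : wt a % 2 = 1 := by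
  have := wt_mod4 r hr hw (Finset.univ.filter (fun k => co a k = 1))
  rw [sum_supp, ← wt_supp, h] at this
  omega

/-- the pointing predicate -/
def wn (a : A) (k : Z) : ℕ := ∑ d : Fin 6, (co a (k - ((d.val + 1 : ℕ) : Z))).val

def Po (a : A) : Prop := co a 0 = 1 ∧ wn a 0 = 0

theorem wn_X (a : A) (k j : Z) : wn (X (-k) * a) j = wn a (j + k) := by
  unfold wn
  refine Finset.sum_congr rfl fun d _ => ?_
  rw [co_X_mul]; congr 2; ring

theorem Po_X (a : A) (k : Z) : Po (X (-k) * a) ↔ co a k = 1 ∧ wn a k = 0 := by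
  unfold Po
  rw [wn_X, co_X_mul, zero_add, zero_sub, neg_neg]

theorem exists_Po (r a : A) (ha : a ∈ T14 r) : ∃ k, Po (X k * a) := by
  simp only [T14, W14, Finset.mem_filter, Finset.mem_univ, true_and] at ha
  by_contra hcon
  push Not at hcon
  have h1 : ∀ k, co a k = 1 → 1 ≤ wn a k := by
    intro k hk
    have := hcon (-k)
    rw [Po_X] at this
    by_contra h; exact this ⟨hk, by omega⟩
  -- every window of seven positions meets the support
  have h0 : 0 < wt a := by
    by_contra h
    have : a = 0 := co_ext fun k => by
      have h2 : wt a = 0 := by omega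
      have := (Finset.sum_eq_zero_iff.1 h2) k (Finset.mem_univ _)
      rw [co_zero]; exact (ZMod.val_eq_zero _).1 this
    subst this
    rw [zero_mul] at ha
    simp [wt, co_zero] at ha
  obtain ⟨k0, hk0⟩ : ∃ k, co a k = 1 := by
    rw [wt_supp, Finset.card_pos] at h0
    obtain ⟨k, hk⟩ := h0
    exact ⟨k, (Finset.mem_filter.1 hk).2⟩
  have step : ∀ k, 1 ≤ wn a (k + 1) → 1 ≤ wn a k := by
    intro k hk
    by_cases hc : co a k = 1
    · exact h1 k hc
    · have hc0 : (co a k).val = 0 := by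
        rw [val_eq_one, if_neg hc]
      have e : ∀ d : ℕ, k + 1 - ((d + 1 + 1 : ℕ) : Z) = k - ((d + 1 : ℕ) : Z) := fun d => by push_cast; ring
      have e0 : k + 1 - ((0 + 1 : ℕ) : Z) = k := by simp
      unfold wn at hk ⊢
      rw [Fin.sum_univ_succ] at hk
      rw [Fin.sum_univ_castSucc]
      simp only [Fin.val_zero, Fin.val_succ, Fin.val_castSucc, e, e0, hc0] at hk ⊢
      omega
  have h2 : ∀ n : ℕ, 1 ≤ wn a (k0 - (n : Z)) := by
    intro n
    induction n with
    | zero => rw [Nat.cast_zero, sub_zero]; exact h1 _ hk0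
    | succ n ih =>
      apply step
      convert ih using 2
      push_cast; ring
  have h3 : ∀ k, 1 ≤ wn a k := by
    intro k
    have := h2 (k0 - k).val
    rwa [ZMod.natCast_zmod_val, sub_sub_cancel] at this
  have h4 : ∑ k, wn a k = 6 * wt a := by
    unfold wn
    rw [Finset.sum_comm]
    have : ∀ d ∈ (Finset.univ : Finset (Fin 6)), ∑ k, (co a (k - ((d.val + 1 : ℕ) : Z))).val = wt a := by
      intro d _
      unfold wt
      exact Fintype.sum_equiv (Equiv.subRight _) _ _ fun i => rfl
    rw [Finset.sum_congr rfl this]; simp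
  have h5 : ∑ k : Z, 1 ≤ ∑ k, wn a k := Finset.sum_le_sum fun k _ => h3 k
  rw [Finset.sum_const, Finset.card_univ, ZMod.card, h4] at h5
  simp at h5
  omega

/-! cycle lemma -/
noncomputable def pre (a : A) (q : Z) : ℕ := ∑ j : Z, if j.val ≤ q.val then (co a j).val else 0
noncomputable def psi (a : A) (q : Z) : ℤ := 45 * (pre a q : ℤ) - 7 * (q.val : ℤ)
def Pc (a : A) : Prop := ∀ q, psi a q ≤ psi a 0

theorem pre_zero (a : A) : pre a 0 = (co a 0).val := by
  unfold pre
  rw [Finset.sum_eq_single 0]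
  · simp
  · intro j _ hj
    rw [if_neg]
    rw [ZMod.val_zero]
    intro h
    exact hj ((ZMod.val_eq_zero j).1 (by omega))
  · simp

theorem pre_last (a : A) (q : Z) (hq : q.val = 44) : pre a q = wt a := by
  unfold pre wt
  refine Finset.sum_congr rfl fun j _ => ?_
  rw [if_pos]; have := ZMod.val_lt j; omega

theorem pre_succ (a : A) (q : Z) (hq : q.val ≠ 44) : pre a (q + 1) = pre a q + (co a (q + 1)).val := by
  have hv : (q + 1).val = q.val + 1 := by
    have := ZMod.val_lt q
    rw [ZMod.val_add]
    have : (1 : Z).val = 1 := by decide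
    rw [this]; exact Nat.mod_eq_of_lt (by omega)
  unfold pre
  have h : ∀ j : Z, (if j.val ≤ (q + 1).val then (co a j).val else 0) =
      (if j.val ≤ q.val then (co a j).val else 0) + (if j = q + 1 then (co a (q + 1)).val else 0) := by
    intro j
    by_cases h1 : j = q + 1
    · subst h1
      rw [if_pos le_rfl, if_pos rfl, if_neg (by omega), zero_add]
    · have : j.val ≠ q.val + 1 := fun h => h1 (ZMod.val_injective 45 (h.trans hv.symm))
      rw [if_neg h1, add_zero, hv]
      by_cases h2 : j.val ≤ q.val
      · rw [if_pos h2, if_pos (by omega)]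
      · rw [if_neg h2, if_neg (by omega)]
  rw [Finset.sum_congr rfl fun j _ => h j, Finset.sum_add_distrib, Finset.sum_ite_eq' Finset.univ]
  simp

theorem psi_succ (a : A) (hw : wt a = 7) (q : Z) : psi a (q + 1) = psi a q + 45 * ((co a (q + 1)).val : ℤ) - 7 := by
  unfold psi
  by_cases hq : q.val = 44
  · have h0 : q + 1 = 0 := by revert hq; revert q; decide
    rw [h0, pre_zero, pre_last a q hq, hw, hq, ZMod.val_zero]
    push_cast; ring
  · have hv : (q + 1).val = q.val + 1 := by
      have := ZMod.val_lt q
      rw [ZMod.val_add]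
      have : (1 : Z).val = 1 := by decide
      rw [this]; exact Nat.mod_eq_of_lt (by omega)
    rw [pre_succ a q hq, hv]
    push_cast; ring

theorem psi_X (a : A) (hw : wt a = 7) (k q : Z) :
    psi (X (-k) * a) q = psi a (q + k) + (psi (X (-k) * a) 0 - psi a k) := by
  have h : ∀ n : ℕ, psi (X (-k) * a) (n : Z) = psi a ((n : Z) + k) + (psi (X (-k) * a) 0 - psi a k) := by
    intro n
    induction n with
    | zero => simp
    | succ n ih =>
      have e : (((n + 1 : ℕ) : Z) + k) = ((n : Z) + k) + 1 := by push_cast; ring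
      rw [e, psi_succ a hw, Nat.cast_succ, psi_succ _ (by rw [wt_X_mul]; exact hw), ih, co_X_mul]
      have e2 : (n : Z) + 1 - -k = (n : Z) + k + 1 := by ring
      rw [e2]; ring
  have := h q.val
  rwa [ZMod.natCast_zmod_val] at this

theorem Pc_X (a : A) (hw : wt a = 7) (k : Z) : Pc (X (-k) * a) ↔ ∀ q, psi a q ≤ psi a k := by
  unfold Pc
  constructor
  · intro h q
    have := h (q - k)
    rw [psi_X a hw, sub_add_cancel] at this
    linarith
  · intro h q
    rw [psi_X a hw]
    linarith [h (q + k)]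

theorem psi_inj (a : A) (p q : Z) (h : psi a p = psi a q) : p = q := by
  unfold psi at h
  have := ZMod.val_lt p
  have := ZMod.val_lt q
  exact ZMod.val_injective 45 (by omega)

theorem Pc_zero (a : A) (hw : wt a = 7) (h : Pc a) : co a 0 = 1 := by
  have h1 := h (44 : Z)
  have h2 : (44 : Z).val = 44 := by decide
  unfold psi at h1
  rw [pre_last a _ h2, pre_zero, hw, h2, ZMod.val_zero] at h1
  generalize co a 0 = c at *
  rcases (by decide +revert : c = 0 ∨ c = 1) with rfl | rfl
  · simp at h1
  · rfl

/-- the pointing predicate -/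
def Pt (a : A) : Prop := (wt a = 7 ∧ Pc a) ∨ (wt a ≠ 7 ∧ Po a)

theorem Pt_zero (a : A) (h : Pt a) : co a 0 = 1 := by
  rcases h with h | h
  · exact Pc_zero a h.1 h.2
  · exact h.2.1

theorem exists_Pt (r a : A) (ha : a ∈ T14 r) : ∃ k, Pt (X k * a) := by
  by_cases hw : wt a = 7
  · obtain ⟨k, hk⟩ := Finite.exists_max (psi a)
    exact ⟨-k, Or.inl ⟨by rw [wt_X_mul]; exact hw, (Pc_X a hw k).2 hk⟩⟩
  · obtain ⟨k, hk⟩ := exists_Po r a ha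
    exact ⟨k, Or.inr ⟨by rw [wt_X_mul]; exact hw, hk⟩⟩

theorem gp_seven (a : A) (hw : wt a = 7) : gp Pt a = 1 := by
  have hP : ∀ k, Pt (X (-k) * a) ↔ ∀ q, psi a q ≤ psi a k := by
    intro k
    unfold Pt
    rw [wt_X_mul, Pc_X a hw]
    simp [hw]
  unfold gp
  simp only [hP]
  rw [Finset.card_eq_one]
  obtain ⟨k, hk⟩ := Finite.exists_max (psi a)
  refine ⟨k, ?_⟩
  ext j
  simp only [Finset.mem_filter, Finset.mem_univ, true_and, Finset.mem_singleton]
  constructor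
  · intro h; exact psi_inj a _ _ (le_antisymm (hk j) (h k))
  · rintro rfl; exact hk

theorem gp_other (a : A) (hw : wt a ≠ 7) : gp Pt a = gp Po a := by
  unfold gp
  congr 1
  refine Finset.filter_congr fun k _ => ?_
  unfold Pt
  rw [wt_X_mul]
  simp [hw]

end Words

section Words2
open Classical

noncomputable def toA (s : Finset ℕ) : A := 1 + ∑ p ∈ s, X (p : Z)

theorem sum_val {M : Type*} [AddCommMonoid M] (F : ℕ → M) : ∑ q : Z, F q.val = ∑ i ∈ Finset.range 45, F i := by
  rw [Finset.sum_range]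
  exact Finset.sum_congr rfl fun j _ => rfl

theorem co_toA (s : Finset ℕ) (hs : s ⊆ Finset.Icc 1 44) (q : Z) :
    co (toA s) q = if q.val ∈ insert 0 s then 1 else 0 := by
  have h0 : 0 ∉ s := fun h => by have := Finset.mem_Icc.1 (hs h); omega
  have hv : ∀ p ∈ s, (q = (p : Z)) ↔ q.val = p := by
    intro p hp
    have := Finset.mem_Icc.1 (hs hp)
    constructor
    · rintro rfl; exact ZMod.val_cast_of_lt (by omega)
    · rintro rfl; exact (ZMod.natCast_zmod_val q).symm
  unfold toA
  rw [co_add, co_one, co_sum]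
  have h1 : ∑ p ∈ s, co (X (p : Z)) q = if q.val ∈ s then 1 else 0 := by
    rw [← Finset.sum_ite_eq s q.val (fun _ => (1 : ZMod 2))]
    refine Finset.sum_congr rfl fun p hp => ?_
    rw [co_X]
    simp only [hv p hp]
  rw [h1]
  by_cases hq : q = 0
  · subst hq
    rw [ZMod.val_zero]
    simp [h0]
  · have : q.val ≠ 0 := fun h => hq ((ZMod.val_eq_zero q).1 h)
    simp [hq, this]

theorem sum_toA {M : Type*} [AddCommMonoid M] (s : Finset ℕ) (hs : s ⊆ Finset.Icc 1 44) (F : ℕ → M) :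
    ∑ q : Z, (if q.val ∈ insert 0 s then F q.val else 0) = F 0 + ∑ p ∈ s, F p := by
  have h0 : 0 ∉ s := fun h => by have := Finset.mem_Icc.1 (hs h); omega
  rw [sum_val (fun i => if i ∈ insert 0 s then F i else 0), Finset.sum_ite_mem, Finset.inter_eq_right.2, Finset.sum_insert h0]
  intro x hx
  rw [Finset.mem_range]
  rcases Finset.mem_insert.1 hx with rfl | h
  · norm_num
  · have := Finset.mem_Icc.1 (hs h); omega

theorem S_toA (s : Finset ℕ) (hs : s ⊆ Finset.Icc 1 44) : S (toA s) = 1 + spN s := by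
  have h := sum_toA s hs (fun i => 2 ^ (lw * i))
  rw [mul_zero, pow_zero] at h
  refine Eq.trans ?_ h
  unfold S ev
  refine Finset.sum_congr rfl fun q _ => ?_
  beta_reduce
  rw [co_toA s hs]
  split_ifs
  · rw [ZMod.val_one, one_mul]
  · rw [ZMod.val_zero, zero_mul]

theorem S_st_toA (s : Finset ℕ) (hs : s ⊆ Finset.Icc 1 44) : S (st (toA s)) = 1 + rvN s := by
  have h := sum_toA s hs (fun i => if i = 0 then 1 else 2 ^ (lw * (45 - i)))
  have e : ∑ p ∈ s, (if p = 0 then 1 else 2 ^ (lw * (45 - p))) = rvN s := by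
    refine Finset.sum_congr rfl fun p hp => ?_
    have := Finset.mem_Icc.1 (hs hp)
    rw [if_neg (by omega)]; rfl
  rw [e, if_pos rfl] at h
  refine Eq.trans ?_ h
  unfold S ev
  refine Fintype.sum_equiv (Equiv.neg Z) _ _ fun q => ?_
  beta_reduce
  rw [co_st, Equiv.neg_apply, co_toA s hs]
  by_cases h1 : (-q).val ∈ insert 0 s
  · rw [if_pos h1, if_pos h1, ZMod.val_one, one_mul]
    by_cases h2 : q = 0
    · subst h2; rw [neg_zero, ZMod.val_zero, mul_zero, pow_zero, if_pos rfl]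
    · have : NeZero q := ⟨h2⟩
      rw [ZMod.val_neg_of_ne_zero]
      have := ZMod.val_lt q
      have h3 : q.val ≠ 0 := fun h => h2 ((ZMod.val_eq_zero q).1 h)
      rw [if_neg (by omega)]
      exact congrArg (fun i => 2 ^ (lw * i)) (by omega)
  · rw [if_neg h1, if_neg h1, ZMod.val_zero, zero_mul]

theorem wt_toA (s : Finset ℕ) (hs : s ⊆ Finset.Icc 1 44) : wt (toA s) = 1 + s.card := by
  have h := sum_toA s hs (fun _ => (1 : ℕ))
  rw [Finset.sum_const, smul_eq_mul, mul_one] at h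
  refine Eq.trans ?_ h
  unfold wt
  refine Finset.sum_congr rfl fun q _ => ?_
  rw [co_toA s hs]
  split_ifs
  · rfl
  · rfl

/-- the cycle condition on subsets -/
def Cy (n : ℕ) (s : Finset ℕ) : Prop := ∀ m, m ≤ n → 45 * (s ∩ Finset.Icc 1 m).card ≤ 7 * m

theorem pre_toA (s : Finset ℕ) (hs : s ⊆ Finset.Icc 1 44) (q : Z) : pre (toA s) q = 1 + (s ∩ Finset.Icc 1 q.val).card := by
  have h := sum_toA s hs (fun i => if i ≤ q.val then 1 else 0)
  rw [if_pos (Nat.zero_le _), ← Finset.card_filter] at h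
  have e : s.filter (fun p => p ≤ q.val) = s ∩ Finset.Icc 1 q.val := by
    ext p
    rw [Finset.mem_filter, Finset.mem_inter, Finset.mem_Icc]
    constructor
    · rintro ⟨h1, h2⟩; exact ⟨h1, (Finset.mem_Icc.1 (hs h1)).1, h2⟩
    · rintro ⟨h1, h2⟩; exact ⟨h1, h2.2⟩
  rw [e] at h
  refine Eq.trans ?_ h
  unfold pre
  refine Finset.sum_congr rfl fun j _ => ?_
  rw [co_toA s hs]
  by_cases h1 : j.val ∈ insert 0 s
  · rw [if_pos h1, if_pos h1, ZMod.val_one]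
  · rw [if_neg h1, if_neg h1, ZMod.val_zero]; simp

theorem Pc_toA (s : Finset ℕ) (hs : s ⊆ Finset.Icc 1 44) : Pc (toA s) ↔ Cy 44 s := by
  unfold Pc Cy psi
  simp only [pre_toA s hs]
  constructor
  · intro h m hm
    have := h (m : Z)
    rw [ZMod.val_cast_of_lt (by omega), ZMod.val_zero] at this
    simp at this
    omega
  · intro h q
    have := ZMod.val_lt q
    have := h q.val (by omega)
    rw [ZMod.val_zero, Finset.Icc_eq_empty (by norm_num : ¬ 1 ≤ 0), Finset.inter_empty, Finset.card_empty]
    omega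

theorem Po_toA (s : Finset ℕ) (hs : s ⊆ Finset.Icc 1 44) : Po (toA s) ↔ s ⊆ Finset.Icc 1 38 := by
  have hv : ∀ d : Fin 6, (0 - ((d.val + 1 : ℕ) : Z)).val = 44 - d.val := by decide
  constructor
  · intro h p hp
    have h1 := Finset.mem_Icc.1 (hs hp)
    rw [Finset.mem_Icc]
    refine ⟨h1.1, ?_⟩
    by_contra hc
    have hz := (Finset.sum_eq_zero_iff.1 h.2) ⟨44 - p, by omega⟩ (Finset.mem_univ _)
    rw [co_toA s hs, hv, if_pos] at hz
    · exact absurd hz (by decide)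
    · rw [Finset.mem_insert]
      right
      have : 44 - (44 - p) = p := by omega
      simp only [this]; exact hp
  · intro h'
    constructor
    · rw [co_toA s hs, ZMod.val_zero]; simp
    · unfold wn
      refine Finset.sum_eq_zero fun d _ => ?_
      rw [co_toA s hs, if_neg]
      · rfl
      · rw [hv, Finset.mem_insert]
        rintro (h | h)
        · omega
        · have := Finset.mem_Icc.1 (h' h); omega

theorem Pt_toA (s : Finset ℕ) (hs : s ⊆ Finset.Icc 1 44) :
    Pt (toA s) ↔ (s.card = 6 ∧ Cy 44 s) ∨ (s.card ≠ 6 ∧ s ⊆ Finset.Icc 1 38) := by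
  unfold Pt
  rw [Pc_toA s hs, Po_toA s hs, wt_toA s hs]
  have : 1 + s.card = 7 ↔ s.card = 6 := by omega
  simp only [ne_eq, this]

theorem toA_inj {s t : Finset ℕ} (hs : s ⊆ Finset.Icc 1 44) (ht : t ⊆ Finset.Icc 1 44) (h : toA s = toA t) : s = t := by
  ext p
  by_cases hp : 1 ≤ p ∧ p ≤ 44
  · have h1 := co_toA s hs (p : Z)
    have h2 := co_toA t ht (p : Z)
    rw [h, h2, ZMod.val_cast_of_lt (by omega)] at h1
    have hp0 : p ≠ 0 := by omega
    simp only [Finset.mem_insert, hp0, false_or] at h1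
    by_cases a : p ∈ s <;> by_cases b : p ∈ t <;> simp [a, b] at h1 ⊢
  · constructor
    · intro h; exact absurd (Finset.mem_Icc.1 (hs h)) hp
    · intro h; exact absurd (Finset.mem_Icc.1 (ht h)) hp

theorem exists_toA (a : A) (ha : Pt a) : ∃ s : Finset ℕ, s ⊆ Finset.Icc 1 44 ∧ a = toA s := by
  refine ⟨(Finset.Icc 1 44).filter fun p => co a (p : Z) = 1, Finset.filter_subset _ _, ?_⟩
  apply co_ext
  intro q
  rw [co_toA _ (Finset.filter_subset _ _)]
  simp only [Finset.mem_insert, Finset.mem_filter, Finset.mem_Icc, ZMod.natCast_zmod_val]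
  have h0 := Pt_zero a ha
  by_cases hq : q.val = 0
  · have := (ZMod.val_eq_zero q).1 hq
    subst this
    rw [h0]; simp
  · have h38 := ZMod.val_lt q
    have e : co a q = if co a q = 1 then 1 else 0 := by
      generalize co a q = c
      decide +revert
    have : (q.val = 0 ∨ (1 ≤ q.val ∧ q.val ≤ 44) ∧ co a q = 1) ↔ co a q = 1 := by
      constructor
      · rintro (h | h)
        · exact absurd h hq
        · exact h.2
      · intro h; exact Or.inr ⟨⟨by omega, by omega⟩, h⟩
    simp only [this]; exact e

end Words2

section WordFn
open Classical

def m72 : ℕ := Nat.sub (Nat.pow 2 72) 1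
def LO : ℕ := Nat.div lM m72
def WIN : ℕ := 2 ^ 72 + 2 ^ 144 + 2 ^ 216 + 2 ^ 288 + 2 ^ 360 + 2 ^ 432

def mulS (a b : ℕ) : ℕ := Nat.land (Nat.mod (Nat.mul a b) lM) LO

theorem div_raw (a b : ℕ) : Nat.div a b = a / b := rfl
theorem mulS_raw (a b M O : ℕ) : Nat.land (Nat.mod (Nat.mul a b) M) O = (a * b % M) &&& O := rfl

def gC (sp : ℕ) : ℕ :=
  Nat.sub (Nat.mod sp m72) (Nat.div (Nat.mod (Nat.land (Nat.mul 8 sp) (Nat.add (Nat.mod (Nat.mul sp WIN) lM) (Nat.mul 7 LO))) m72) 8)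

theorem gC_raw (sp m W M O : ℕ) :
    Nat.sub (Nat.mod sp m) (Nat.div (Nat.mod (Nat.land (Nat.mul 8 sp) (Nat.add (Nat.mod (Nat.mul sp W) M) (Nat.mul 7 O))) m) 8)
      = sp % m - (((8 * sp) &&& (sp * W % M + 7 * O)) % m) / 8 := rfl

def wM (sp b : ℕ) : ℕ :=
  bif Nat.beq (Nat.add (Nat.mod sp m72) (Nat.mod b m72)) 14 then
    bif Nat.beq (Nat.mod sp m72) 7 then 60 else
    bif Nat.beq (Nat.mod 60 (gC sp)) 0 then
      Nat.mul (bif Nat.blt (Nat.mod sp m72) 7 then 2 else 1) (Nat.div 60 (gC sp))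
    else 1073741824
  else 0

theorem m72_eq : m72 = 2 ^ lw - 1 := rfl

theorem LO_eq : LO = lO := by
  have h : lO * (2 ^ lw - 1) = lM := by
    unfold lO lM
    rw [ev_eq]
    unfold evN
    have := Nat.geomSum_eq (m := 2 ^ lw) (by norm_num [lw]) 45
    have h2 : (∑ i ∈ Finset.range 45, 1 * 2 ^ (lw * i)) = (∑ i ∈ Finset.range 45, (2 ^ lw) ^ i) :=
      Finset.sum_congr rfl fun i _ => by rw [one_mul, pow_mul]
    rw [h2, mul_comm, Nat.mul_comm]
    have h3 := Nat.pred_mul_geom_sum_le (2 ^ lw) 1 45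
    rw [pow_mul]
    have h4 : ∀ x : ℕ, 1 ≤ x → (∑ i ∈ Finset.range 45, x ^ i) * (x - 1) = x ^ 45 - 1 := by
      intro x hx
      have := geom_sum_mul_of_one_le hx 45
      exact this
    exact h4 _ Nat.one_le_two_pow
  unfold LO
  rw [div_raw, m72_eq]
  apply Nat.div_eq_of_eq_mul_left _ h.symm
  norm_num [lw]

theorem mulS_eq (x y : A) : mulS (S x) (S y) = S (x * y) := by
  unfold mulS; rw [S_mul, ← LO_eq, mulS_raw]

def wf (k : Z) : ℕ := if 1 ≤ k.val ∧ k.val ≤ 6 then 1 else 0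

theorem WIN_eq : WIN = ev wf := by
  unfold ev
  have h := sum_val (fun i => (if 1 ≤ i ∧ i ≤ 6 then 1 else 0) * 2 ^ (lw * i))
  refine Eq.trans ?_ h.symm
  have h2 : ∀ i ∈ Finset.range 45, (if 1 ≤ i ∧ i ≤ 6 then 1 else 0) * 2 ^ (lw * i) = if i ∈ Finset.Icc 1 6 then 2 ^ (72 * i) else 0 := by
    intro i _
    rw [ite_mul, one_mul, zero_mul]
    simp only [Finset.mem_Icc]; rfl
  rw [Finset.sum_congr rfl h2, Finset.sum_ite_mem]
  have h3 : Finset.range 45 ∩ Finset.Icc 1 6 = {1, 2, 3, 4, 5, 6} := by decide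
  rw [h3]
  unfold WIN
  rw [Finset.sum_insert (by decide), Finset.sum_insert (by decide), Finset.sum_insert (by decide), Finset.sum_insert (by decide),
    Finset.sum_insert (by decide), Finset.sum_singleton]
  simp only [add_assoc, Nat.reduceMul, mul_one]

theorem cv_wf (a : A) (k : Z) : cv (fun k => (co a k).val) wf k = wn a k := by
  unfold cv wn
  rw [← Fintype.sum_equiv (Equiv.subLeft k) (fun j => (co a (k - j)).val * wf j) _ (fun j => by
    rw [Equiv.subLeft_apply, sub_sub_cancel])]
  have h : ∀ j : Z, (co a (k - j)).val * wf j = ∑ d : Fin 6, if j = ((d.val + 1 : ℕ) : Z) then (co a (k - ((d.val + 1 : ℕ) : Z))).val else 0 := by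
    intro j
    have e : wf j = ∑ d : Fin 6, if j = ((d.val + 1 : ℕ) : Z) then 1 else 0 := by
      revert j; decide
    rw [e, Finset.mul_sum]
    refine Finset.sum_congr rfl fun d _ => ?_
    split_ifs with h
    · rw [h, mul_one]
    · rw [mul_zero]
  rw [Finset.sum_congr rfl fun j _ => h j, Finset.sum_comm]
  refine Finset.sum_congr rfl fun d _ => ?_
  rw [Finset.sum_ite_eq' Finset.univ]
  simp

theorem wn_le (a : A) (k : Z) : wn a k ≤ 6 := by
  unfold wn
  refine (Finset.sum_le_sum fun d _ => val_le_one _).trans ?_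
  simp

theorem gp_Po (a : A) : gp Po a + (Finset.univ.filter fun k => co a k = 1 ∧ wn a k ≠ 0).card = wt a := by
  rw [wt_supp]
  unfold gp
  simp only [Po_X]
  rw [← Finset.card_filter_add_card_filter_not (s := Finset.univ.filter fun k => co a k = 1) (fun k => wn a k = 0), Finset.filter_filter, Finset.filter_filter]

theorem gC_S (a : A) : gC (S a) = gp Po a := by
  have hl : (400 : ℕ) < 2 ^ lw - 1 := by norm_num [lw]
  have h1 : S a * WIN % lM = ev (wn a) := by
    rw [WIN_eq]; unfold S
    rw [ev_mul_mod]
    · exact congrArg ev (funext fun k => cv_wf a k)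
    · intro k; rw [cv_wf]; have := wn_le a k; omega
  have h2 : S a * WIN % lM + 7 * LO = ev (fun k => wn a k + 7) := by
    rw [h1, LO_eq, lO, ← ev_smul, ← ev_add]
  have h3 : 8 * S a = ev (fun k => 8 * (co a k).val) := by
    unfold S; rw [← ev_smul]
  have h4 : (8 * S a) &&& (S a * WIN % lM + 7 * LO) = ev (fun k => if co a k = 1 ∧ wn a k ≠ 0 then 8 else 0) := by
    rw [h2, h3, ev_land]
    · refine congrArg ev (funext fun k => ?_)
      have hw := wn_le a k
      generalize wn a k = w at *
      generalize co a k = c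
      rcases (by decide +revert : c = 0 ∨ c = 1) with rfl | rfl
      · simp
      · interval_cases w <;> simp [val_eq_one]
    · intro k; have := val_le_one (co a k); omega
    · intro k; have := wn_le a k; omega
  have h5 : ∑ k, (if co a k = 1 ∧ wn a k ≠ 0 then 8 else 0) = 8 * (Finset.univ.filter fun k => co a k = 1 ∧ wn a k ≠ 0).card := by
    rw [← Finset.sum_filter, Finset.sum_const, smul_eq_mul, mul_comm]
  have h6 := gp_Po a
  have h7 := wt_le a
  unfold gC
  rw [gC_raw, m72_eq, h4, S_wt, ev_wt]
  · rw [h5, Nat.mul_div_cancel_left _ (by norm_num)]; omega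
  · rw [h5]
    have : (Finset.univ.filter fun k => co a k = 1 ∧ wn a k ≠ 0).card ≤ 45 := by omega
    omega

theorem wM_S (a b : A) : wM (S a) (S b) =
    if wt a + wt b = 14 then (if 60 % gp Pt a = 0 then mm Pt a else 1073741824) else 0 := by
  unfold wM
  rw [gC_S]
  have h1 : Nat.mod (S a) m72 = wt a := S_wt a
  have h2 : Nat.mod (S b) m72 = wt b := S_wt b
  rw [h1, h2]
  have e : ∀ m n : ℕ, Nat.beq m n = decide (m = n) := fun m n => by
    by_cases h : m = n
    · subst h; simp
    · rw [decide_eq_false h]; exact Bool.eq_false_iff.2 fun h' => h (Nat.eq_of_beq_eq_true h')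
  have e2 : Nat.blt (wt a) 7 = decide (wt a < 7) := by
    unfold Nat.blt
    by_cases h : wt a < 7
    · rw [decide_eq_true h]; exact Nat.ble_eq_true_of_le h
    · rw [decide_eq_false h]; exact Bool.eq_false_iff.2 fun h' => h (Nat.le_of_ble_eq_true h')
  rw [e, e, e, e2]
  simp only [cond_eq_ite, decide_eq_true_eq]
  by_cases hw : wt a = 7
  · unfold mm mu
    rw [gp_seven a hw]
    simp [hw]
  · unfold mm
    rw [gp_other a hw, if_neg hw]
    rfl

end WordFn

section Chk
open Classical

noncomputable def lsum (f : ℕ × ℕ → ℕ) (l : List (ℕ × ℕ)) : ℕ :=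
  List.rec (motive := fun _ => ℕ) 0 (fun x _ ih => Nat.add (f x) ih) l

theorem lsum_eq (f : ℕ × ℕ → ℕ) (l : List (ℕ × ℕ)) : lsum f l = (l.map f).sum := by
  induction l with
  | nil => rfl
  | cons x l ih =>
    rw [List.map_cons, List.sum_cons, ← ih]; rfl

def fT (sr : ℕ) (x : ℕ × ℕ) : ℕ := wM x.1 (mulS x.1 sr)
def fL (sr srs : ℕ) (x : ℕ × ℕ) : ℕ :=
  Nat.mul (fT sr x) (Nat.add (Nat.mul x.1 x.2) (Nat.mul (mulS x.1 sr) (mulS x.2 srs)))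
def fR (sr : ℕ) (x : ℕ × ℕ) : ℕ := Nat.mul (Nat.mul 2 (fT sr x)) (Nat.mul (mulS x.1 sr) x.2)
def fRs (sr srs : ℕ) (x : ℕ × ℕ) : ℕ := Nat.mul (Nat.mul 2 (fT sr x)) (Nat.mul x.1 (mulS x.2 srs))

def pr (s : Finset ℕ) : ℕ × ℕ := (1 + spN s, 1 + rvN s)

structure WCompl (r : A) (E : List (Finset ℕ)) : Prop where
  nd : E.Nodup
  bd : ∀ s ∈ E, s ⊆ Finset.Icc 1 44
  pt : ∀ s ∈ E, Pt (toA s)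
  cd : ∀ s ∈ E, s.card ≤ 6
  all : ∀ a ∈ T14 r, Pt a → ∃ s ∈ E, a = toA s

theorem pr_eq {r : A} {E : List (Finset ℕ)} (h : WCompl r E) {s : Finset ℕ} (hs : s ∈ E) :
    pr s = (S (toA s), S (st (toA s))) := by
  rw [S_toA s (h.bd s hs), S_st_toA s (h.bd s hs)]; rfl

theorem fT_pr {r : A} {E : List (Finset ℕ)} (h : WCompl r E) {s : Finset ℕ} (hs : s ∈ E) :
    fT (S r) (pr s) = if wt (toA s) + wt (toA s * r) = 14 then (if 60 % gp Pt (toA s) = 0 then mm Pt (toA s) else 1073741824) else 0 := by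
  unfold fT
  rw [pr_eq h hs]
  simp only
  rw [mulS_eq, wM_S]

theorem lsum_pr (f : ℕ × ℕ → ℕ) {r : A} {E : List (Finset ℕ)} (h : WCompl r E) :
    lsum f (E.map pr) = ∑ s ∈ E.toFinset, f (pr s) := by
  rw [lsum_eq, List.map_map, List.sum_toFinset _ h.nd]; rfl

theorem dvd_of_tot {r : A} {E : List (Finset ℕ)} (h : WCompl r E) (ht : lsum (fT (S r)) (E.map pr) * 28 < 2 ^ 20) :
    ∀ a ∈ T14 r, Pt a → gp Pt a ∣ 60 := by
  intro a ha hp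
  obtain ⟨s, hs, rfl⟩ := h.all a ha hp
  rw [lsum_pr _ h] at ht
  have h1 : fT (S r) (pr s) ≤ ∑ s ∈ E.toFinset, fT (S r) (pr s) :=
    Finset.single_le_sum (f := fun s => fT (S r) (pr s)) (fun _ _ => Nat.zero_le _) (List.mem_toFinset.2 hs)
  rw [fT_pr h hs] at h1
  simp only [T14, W14, Finset.mem_filter, Finset.mem_univ, true_and] at ha
  rw [if_pos ha.1] at h1
  by_contra hc
  rw [if_neg (fun h => hc (Nat.dvd_of_mod_eq_zero h))] at h1
  omega

theorem sum_words {r : A} {E : List (Finset ℕ)} (h : WCompl r E) (hd : ∀ a ∈ T14 r, Pt a → gp Pt a ∣ 60)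
    (F : A → ℕ) :
    ∑ s ∈ E.toFinset, fT (S r) (pr s) * F (toA s) = ∑ a ∈ (T14 r).filter Pt, mm Pt a * F a := by
  have h1 : ∑ s ∈ E.toFinset, fT (S r) (pr s) * F (toA s) =
      ∑ s ∈ E.toFinset.filter (fun s => wt (toA s) + wt (toA s * r) = 14), mm Pt (toA s) * F (toA s) := by
    rw [Finset.sum_filter]
    refine Finset.sum_congr rfl fun s hs => ?_
    have hs := List.mem_toFinset.1 hs
    rw [fT_pr h hs]
    split_ifs with h1 h2
    · rfl
    · exfalso
      apply h2
      refine Nat.mod_eq_zero_of_dvd (hd _ ?_ (h.pt s hs))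
      simp only [T14, W14, Finset.mem_filter, Finset.mem_univ, true_and]
      refine ⟨h1, ?_⟩
      have := h.cd s hs
      rw [wt_toA s (h.bd s hs)]; omega
    · rw [zero_mul]
  rw [h1]
  refine Finset.sum_bij (fun s _ => toA s) ?_ ?_ ?_ ?_
  · intro s hs
    rw [Finset.mem_filter, List.mem_toFinset] at hs
    simp only [T14, W14, Finset.mem_filter, Finset.mem_univ, true_and]
    refine ⟨⟨hs.2, ?_⟩, h.pt s hs.1⟩
    have := h.cd s hs.1
    rw [wt_toA s (h.bd s hs.1)]; omega
  · intro s hs t ht hst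
    rw [Finset.mem_filter, List.mem_toFinset] at hs ht
    exact toA_inj (h.bd s hs.1) (h.bd t ht.1) hst
  · intro a ha
    rw [Finset.mem_filter] at ha
    obtain ⟨s, hs, rfl⟩ := h.all a ha.1 ha.2
    refine ⟨s, ?_, rfl⟩
    rw [Finset.mem_filter, List.mem_toFinset]
    have := ha.1
    simp only [T14, W14, Finset.mem_filter, Finset.mem_univ, true_and] at this
    exact ⟨hs, this.1⟩
  · intro s _; rfl

theorem corr (a b : A) : S b * S (st a) ≡ ev (fun i => ∑ k, (co a k).val * (co b (k + i)).val) [MOD lM] := by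
  unfold S
  refine (ev_mul _ _).trans ?_
  have : cv (fun k => (co b k).val) (fun k => (co (st a) k).val) = fun i => ∑ k, (co a k).val * (co b (k + i)).val := by
    funext i
    unfold cv
    refine Fintype.sum_equiv (Equiv.subRight i) _ _ fun j => ?_
    beta_reduce
    rw [Equiv.subRight_apply, co_st, neg_sub, sub_add_cancel, mul_comm]
  rw [this]

theorem modEq_lin (M : ℕ) (s : Finset A) (m G H : A → ℕ) (h : ∀ a ∈ s, G a ≡ H a [MOD M]) :
    ∑ a ∈ s, m a * G a ≡ ∑ a ∈ s, m a * H a [MOD M] := by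
  revert h
  induction s using Finset.induction_on with
  | empty => intro _; exact Nat.ModEq.rfl
  | insert x s hx ih =>
    intro h
    rw [Finset.sum_insert hx, Finset.sum_insert hx]
    exact Nat.ModEq.add (Nat.ModEq.mul_left _ (h x (Finset.mem_insert_self _ _)))
      (ih fun a ha => h a (Finset.mem_insert_of_mem ha))

theorem ev_lin (s : Finset A) (m : A → ℕ) (G : A → ℕ) (F : A → Z → ℕ) (h : ∀ a ∈ s, G a ≡ ev (F a) [MOD lM]) :
    ∑ a ∈ s, m a * G a ≡ ev (fun i => ∑ a ∈ s, m a * F a i) [MOD lM] := by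
  rw [ev_sum]
  have : ∀ a ∈ s, ev (fun i => m a * F a i) = m a * ev (F a) := fun a _ => ev_smul _ _
  rw [Finset.sum_congr rfl this]
  exact modEq_lin lM s m G (fun a => ev (F a)) h

theorem raw2 (t x y : ℕ) : Nat.mul (Nat.mul 2 t) (Nat.mul x y) = t * (2 * (x * y)) := by
  change 2 * t * (x * y) = _
  ring

variable {r : A} {E : List (Finset ℕ)}

theorem CL_eq (hr : r * st r = 1) (h : WCompl r E) (hd : ∀ a ∈ T14 r, Pt a → gp Pt a ∣ 60) :
    lsum (fL (S r) (S (st r))) (E.map pr) ≡ ev (fun i => 120 * cL r i) [MOD lM] := by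
  have h1 : lsum (fL (S r) (S (st r))) (E.map pr) =
      ∑ s ∈ E.toFinset, fT (S r) (pr s) * (fun a => S a * S (st a) + S (a * r) * S (st (a * r))) (toA s) := by
    rw [lsum_pr _ h]
    refine Finset.sum_congr rfl fun s hs => ?_
    unfold fL
    rw [pr_eq h (List.mem_toFinset.1 hs)]
    simp only
    rw [mulS_eq, mulS_eq, map_mul]; rfl
  have h2 := sum_words h hd (fun a => S a * S (st a) + S (a * r) * S (st (a * r)))
  beta_reduce at h1 h2
  rw [h1, h2]
  simp only [cL_formula r hr Pt (fun a ha => exists_Pt r a ha) hd]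
  refine ev_lin _ _ _ _ fun a _ => ?_
  have := Nat.ModEq.add (corr a a) (corr (a * r) (a * r))
  rw [← ev_add] at this
  refine this.trans ?_
  have e : (FL r a) = fun i => (∑ k, (co a k).val * (co a (k + i)).val) + (∑ k, (co (a * r) k).val * (co (a * r) (k + i)).val) := by
    funext i; unfold FL; rw [Finset.sum_add_distrib]
  rw [e]

theorem CR_eq (hr : r * st r = 1) (h : WCompl r E) (hd : ∀ a ∈ T14 r, Pt a → gp Pt a ∣ 60) :
    lsum (fR (S r)) (E.map pr) ≡ ev (fun i => 120 * cR r i) [MOD lM] := by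
  have h1 : lsum (fR (S r)) (E.map pr) =
      ∑ s ∈ E.toFinset, fT (S r) (pr s) * (fun a => 2 * (S (a * r) * S (st a))) (toA s) := by
    rw [lsum_pr _ h]
    refine Finset.sum_congr rfl fun s hs => ?_
    unfold fR
    rw [pr_eq h (List.mem_toFinset.1 hs)]
    simp only
    rw [mulS_eq]
    beta_reduce
    rw [raw2]
  have h2 := sum_words h hd (fun a => 2 * (S (a * r) * S (st a)))
  beta_reduce at h1 h2
  rw [h1, h2]
  simp only [cR_formula r hr Pt (fun a ha => exists_Pt r a ha) hd]
  have e : ∀ i a, 2 * mm Pt a * FR r a i = mm Pt a * (2 * FR r a i) := fun i a => by ring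
  simp only [e]
  refine ev_lin _ _ _ _ fun a _ => ?_
  have := Nat.ModEq.mul_left 2 (corr a (a * r))
  rw [← ev_smul] at this
  exact this

theorem FR_neg (r a : A) (i : Z) : FR r a (-i) = ∑ k, (co (a * r) k).val * (co a (k + i)).val := by
  unfold FR
  refine (Fintype.sum_equiv (Equiv.addRight i) _ _ fun k => ?_).symm
  rw [Equiv.coe_addRight, add_neg_cancel_right, mul_comm]

theorem CRs_eq (hr : r * st r = 1) (h : WCompl r E) (hd : ∀ a ∈ T14 r, Pt a → gp Pt a ∣ 60) :
    lsum (fRs (S r) (S (st r))) (E.map pr) ≡ ev (fun i => 120 * cR r (-i)) [MOD lM] := by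
  have h1 : lsum (fRs (S r) (S (st r))) (E.map pr) =
      ∑ s ∈ E.toFinset, fT (S r) (pr s) * (fun a => 2 * (S a * S (st (a * r)))) (toA s) := by
    rw [lsum_pr _ h]
    refine Finset.sum_congr rfl fun s hs => ?_
    unfold fRs
    rw [pr_eq h (List.mem_toFinset.1 hs)]
    simp only
    rw [mulS_eq, map_mul]
    beta_reduce
    rw [raw2]
  have h2 := sum_words h hd (fun a => 2 * (S a * S (st (a * r))))
  beta_reduce at h1 h2
  rw [h1, h2]
  simp only [cR_formula r hr Pt (fun a ha => exists_Pt r a ha) hd]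
  have e : ∀ i a, 2 * mm Pt a * FR r a i = mm Pt a * (2 * FR r a i) := fun i a => by ring
  simp only [e]
  refine ev_lin _ _ _ (fun a i => 2 * FR r a (-i)) fun a _ => ?_
  have := Nat.ModEq.mul_left 2 (corr (a * r) a)
  rw [← ev_smul] at this
  refine this.trans ?_
  have e : (fun i => 2 * ∑ k, (co (a * r) k).val * (co a (k + i)).val) = fun i => 2 * FR r a (-i) := by
    funext i
    rw [FR_neg]
  rw [e]

theorem FL_le (r a : A) (i : Z) : FL r a i ≤ wt a + wt (a * r) := by
  unfold FL wt
  rw [← Finset.sum_add_distrib]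
  refine Finset.sum_le_sum fun k _ => Nat.add_le_add ?_ ?_
  · exact (Nat.mul_le_mul_left _ (val_le_one _)).trans (by rw [mul_one])
  · exact (Nat.mul_le_mul_left _ (val_le_one _)).trans (by rw [mul_one])

theorem FR_le (r a : A) (i : Z) : FR r a i ≤ wt a := by
  unfold FR wt
  refine Finset.sum_le_sum fun k _ => ?_
  exact (Nat.mul_le_mul_left _ (val_le_one _)).trans (by rw [mul_one])

theorem cL_lt (hr : r * st r = 1) (h : WCompl r E) (hd : ∀ a ∈ T14 r, Pt a → gp Pt a ∣ 60)
    (ht : lsum (fT (S r)) (E.map pr) * 28 < 2 ^ 20) (i : Z) : 120 * cL r i ≤ 2 ^ 20 ∧ 120 * cR r i ≤ 2 ^ 20 := by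
  have h0 : lsum (fT (S r)) (E.map pr) = ∑ a ∈ (T14 r).filter Pt, mm Pt a := by
    rw [lsum_pr _ h]
    have := sum_words h hd (fun _ => 1)
    simpa using this
  rw [h0] at ht
  rw [cL_formula r hr Pt (fun a ha => exists_Pt r a ha) hd, cR_formula r hr Pt (fun a ha => exists_Pt r a ha) hd]
  have hw : ∀ a ∈ (T14 r).filter Pt, wt a + wt (a * r) = 14 := by
    intro a ha
    simp only [T14, W14, Finset.mem_filter, Finset.mem_univ, true_and] at ha
    exact ha.1.1
  constructor
  · have : ∑ a ∈ (T14 r).filter Pt, mm Pt a * FL r a i ≤ ∑ a ∈ (T14 r).filter Pt, mm Pt a * 14 :=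
      Finset.sum_le_sum fun a ha => Nat.mul_le_mul_left _ ((FL_le r a i).trans (hw a ha).le)
    rw [← Finset.sum_mul] at this
    omega
  · have : ∑ a ∈ (T14 r).filter Pt, 2 * mm Pt a * FR r a i ≤ ∑ a ∈ (T14 r).filter Pt, mm Pt a * 28 := by
      refine Finset.sum_le_sum fun a ha => ?_
      have h1 := FR_le r a i
      have h2 := hw a ha
      have h3 : FR r a i ≤ 14 := by omega
      calc 2 * mm Pt a * FR r a i ≤ 2 * mm Pt a * 14 := Nat.mul_le_mul_left _ h3
        _ = _ := by ring
    rw [← Finset.sum_mul] at this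
    omega

end Chk

section Fin
open Classical

def dg (c i : ℕ) : ℕ := Nat.land (Nat.shiftRight c (Nat.mul 72 i)) m72

theorem dg_raw (c i m : ℕ) : Nat.land (Nat.shiftRight c (Nat.mul 72 i)) m = (c >>> (72 * i)) &&& m := rfl

theorem dg_ev (f : Z → ℕ) (hf : ∀ i, f i < 2 ^ lw) (q : Z) : dg (ev f) q.val = f q := by
  have h := ev_digit f hf q
  unfold dg
  rw [dg_raw, m72_eq, Nat.and_two_pow_sub_one_eq_mod, Nat.shiftRight_eq_div_pow]
  exact h

noncomputable def uq (c x j n : ℕ) : Bool :=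
  Nat.rec (motive := fun _ => Bool) true
    (fun i ih => Bool.rec (motive := fun _ => Bool)
      (Bool.rec (motive := fun _ => Bool) ih false (Nat.beq (dg c i) x)) ih (Nat.beq i j)) n

theorem beq_dec (m n : ℕ) : Nat.beq m n = decide (m = n) := by
  by_cases h : m = n
  · subst h; simp
  · rw [decide_eq_false h]; exact Bool.eq_false_iff.2 fun h' => h (Nat.eq_of_beq_eq_true h')

theorem uq_spec (c x j n : ℕ) (h : uq c x j n = true) : ∀ i < n, dg c i = x → i = j := by
  induction n with
  | zero => intro i hi; omega
  | succ n ih =>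
    change Bool.rec (motive := fun _ => Bool)
      (Bool.rec (motive := fun _ => Bool) (uq c x j n) false (Nat.beq (dg c n) x)) (uq c x j n) (Nat.beq n j) = true at h
    rw [beq_dec, beq_dec] at h
    intro i hi hx
    by_cases h1 : n = j
    · rw [decide_eq_true h1] at h
      have h : uq c x j n = true := h
      by_cases hin : i = n
      · omega
      · exact ih h i (by omega) hx
    · rw [decide_eq_false h1] at h
      by_cases h2 : dg c n = x
      · rw [decide_eq_true h2] at h
        exact absurd h (by simp)
      · rw [decide_eq_false h2] at h
        have h : uq c x j n = true := h
        by_cases hin : i = n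
        · rw [hin] at hx; exact absurd hx h2
        · exact ih h i (by omega) hx

def colL (l c d : ℕ) : ℕ := Nat.mod (Nat.add (Nat.mul 281474976710656 l) (Nat.add (Nat.mul l l) (Nat.mul c d))) lM
def colR (l c : ℕ) : ℕ := Nat.mod (Nat.add (Nat.mul 281474976710656 c) (Nat.mul 2 (Nat.mul l c))) lM

theorem colL_raw (l c d M K : ℕ) : Nat.mod (Nat.add (Nat.mul K l) (Nat.add (Nat.mul l l) (Nat.mul c d))) M
  = (K * l + (l * l + c * d)) % M := rfl
theorem colR_raw (l c M K : ℕ) : Nat.mod (Nat.add (Nat.mul K c) (Nat.mul 2 (Nat.mul l c))) M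
  = (K * c + 2 * (l * c)) % M := rfl

theorem modEq_colL (M K l c d a b e : ℕ) (h1 : l ≡ a [MOD M]) (h2 : c ≡ b [MOD M]) (h3 : d ≡ e [MOD M]) :
    K * l + (l * l + c * d) ≡ K * a + (a * a + b * e) [MOD M] :=
  (h1.mul_left K).add ((h1.mul h1).add (h2.mul h3))

theorem modEq_colR (M K l c a b : ℕ) (h1 : l ≡ a [MOD M]) (h2 : c ≡ b [MOD M]) :
    K * c + 2 * (l * c) ≡ K * b + 2 * (a * b) [MOD M] :=
  (h2.mul_left K).add ((h1.mul h2).mul_left 2)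

theorem modEq_fin (M x y : ℕ) (h : x ≡ y [MOD M]) (hy : y < M) : x % M = y := by
  rw [h, Nat.mod_eq_of_lt hy]

theorem modEq_add3 (M K a x y x' y' : ℕ) (h1 : x ≡ x' [MOD M]) (h2 : y ≡ y' [MOD M]) :
    K * a + (x + y) ≡ K * a + (x' + y') [MOD M] := (h1.add h2).add_left _
theorem modEq_add2 (M K a x x' : ℕ) (h1 : x ≡ x' [MOD M]) :
    K * a + 2 * x ≡ K * a + 2 * x' [MOD M] := (h1.mul_left 2).add_left _

theorem colL_ev (l c d : ℕ) (f g h : Z → ℕ) (hf : ∀ i, f i ≤ 2 ^ 20) (hg : ∀ i, g i ≤ 2 ^ 20) (hh : ∀ i, h i ≤ 2 ^ 20)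
    (h1 : l ≡ ev f [MOD lM]) (h2 : c ≡ ev g [MOD lM]) (h3 : d ≡ ev h [MOD lM]) :
    colL l c d = ev (fun i => 281474976710656 * f i + (cv f f i + cv g h i)) := by
  unfold colL
  rw [colL_raw]
  refine modEq_fin _ _ _ ?_ ?_
  · refine (modEq_colL _ _ _ _ _ _ _ _ h1 h2 h3).trans ?_
    rw [ev_add, ev_add, ev_smul]
    exact modEq_add3 _ _ _ _ _ _ _ (ev_mul f f) (ev_mul g h)
  · refine ev_lt_lM _ fun i => ?_
    have a1 := hf i
    have a2 := cv_le f f _ _ hf hf i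
    have a3 := cv_le g h _ _ hg hh i
    have : (2 : ℕ) ^ lw = 2 ^ 72 := rfl
    rw [this]
    omega

theorem colR_ev (l c : ℕ) (f g : Z → ℕ) (hf : ∀ i, f i ≤ 2 ^ 20) (hg : ∀ i, g i ≤ 2 ^ 20)
    (h1 : l ≡ ev f [MOD lM]) (h2 : c ≡ ev g [MOD lM]) :
    colR l c = ev (fun i => 281474976710656 * g i + 2 * cv f g i) := by
  unfold colR
  rw [colR_raw]
  refine modEq_fin _ _ _ ?_ ?_
  · refine (modEq_colR _ _ _ _ _ _ h1 h2).trans ?_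
    rw [ev_add, ev_smul, ev_smul]
    exact modEq_add2 _ _ _ _ _ (ev_mul f g)
  · refine ev_lt_lM _ fun i => ?_
    have a1 := hg i
    have a2 := cv_le f g _ _ hf hg i
    have : (2 : ℕ) ^ lw = 2 ^ 72 := rfl
    rw [this]
    omega

noncomputable def an (a b : Bool) : Bool := Bool.rec (motive := fun _ => Bool) false b a
theorem an_spec {a b : Bool} (h : an a b = true) : a = true ∧ b = true := by
  cases a <;> cases b <;> simp_all [an]

/-- forced evaluation -/
noncomputable def fo (n : Nat) (k : Nat → Bool) : Bool :=
  Nat.rec (motive := fun _ => Bool) (k 0) (fun n _ => k (Nat.succ n)) n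
theorem fo_eq (n : ℕ) (k : ℕ → Bool) : fo n k = k n := by cases n <;> rfl

/-- column checks -/
noncomputable def colChk (cl cr j1 j2 : ℕ) : Bool :=
  fo cl fun cl => fo cr fun cr => fo (dg cr j1) fun x1 => fo (dg cr j2) fun x2 =>
  an (an (uq cr x1 j1 45) (uq cr x2 j2 45))
    (an (uq cl x1 45 45) (uq cl x2 45 45))

noncomputable def finChk (sr srs j1 j2 : ℕ) (l : List (ℕ × ℕ)) : Bool :=
  an (an (Nat.ble (Nat.mul (lsum (fT sr) l) 28) 1048575)
      (an (Nat.beq (Nat.gcd 45 (Nat.sub (Nat.add j1 45) j2)) 1) (an (Nat.ble j1 44) (Nat.ble j2 44))))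
    (fo (lsum (fL sr srs) l) fun cl => fo (lsum (fR sr) l) fun cr => fo (lsum (fRs sr srs) l) fun cs =>
     colChk (colL cl cr cs) (colR cl cr) j1 j2)

theorem finChk_spec (r : A) (hr : r * st r = 1) (E : List (Finset ℕ)) (hE : WCompl r E) (j1 j2 : ℕ)
    (h : finChk (S r) (S (st r)) j1 j2 (E.map pr) = true) : autGroupOrder (D r) = 90 := by
  unfold finChk at h
  rw [fo_eq, fo_eq, fo_eq] at h
  obtain ⟨h1, h2⟩ := an_spec h
  obtain ⟨h1, h3⟩ := an_spec h1
  obtain ⟨h3, h4⟩ := an_spec h3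
  obtain ⟨h4, h5⟩ := an_spec h4
  have h4 := Nat.le_of_ble_eq_true h4
  have h5 := Nat.le_of_ble_eq_true h5
  have h3 := Nat.eq_of_beq_eq_true h3
  have h1 := Nat.le_of_ble_eq_true h1
  have ht : lsum (fT (S r)) (E.map pr) * 28 < 2 ^ 20 := by
    change lsum (fT (S r)) (E.map pr) * 28 ≤ _ at h1
    omega
  have hd := dvd_of_tot hE ht
  have hb := cL_lt hr hE hd ht
  rw [colL_ev _ _ _ _ _ _ (fun i => (hb i).1) (fun i => (hb i).2) (fun i => (hb (-i)).2)
    (CL_eq hr hE hd) (CR_eq hr hE hd) (CRs_eq hr hE hd),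
    colR_ev _ _ _ _ (fun i => (hb i).1) (fun i => (hb i).2) (CL_eq hr hE hd) (CR_eq hr hE hd)] at h2
  have eL : (fun i => 281474976710656 * (120 * cL r i) + (cv (fun i => 120 * cL r i) (fun i => 120 * cL r i) i +
      cv (fun i => 120 * cR r i) (fun i => 120 * cR r (-i)) i)) = fun i => ka r 281474976710656 (.inl 0) (.inl i) := by
    funext i; rw [ka_l]
  have eR : (fun i => 281474976710656 * (120 * cR r i) + 2 * cv (fun i => 120 * cL r i) (fun i => 120 * cR r i) i) =
      fun i => ka r 281474976710656 (.inl 0) (.inr i) := by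
    funext i; rw [ka_r r hr]
  have e72 : (2 : ℕ) ^ lw = 2 ^ 72 := rfl
  have bL : ∀ i, ka r 281474976710656 (.inl 0) (.inl i) < 2 ^ lw := by
    intro i
    rw [ka_l, e72]
    have a1 := (hb i).1
    have a2 := cv_le (fun i => 120 * cL r i) (fun i => 120 * cL r i) _ _ (fun i => (hb i).1) (fun i => (hb i).1) i
    have a3 := cv_le (fun i => 120 * cR r i) (fun i => 120 * cR r (-i)) _ _ (fun i => (hb i).2) (fun i => (hb (-i)).2) i
    omega
  have bR : ∀ i, ka r 281474976710656 (.inl 0) (.inr i) < 2 ^ lw := by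
    intro i
    rw [ka_r r hr, e72]
    have a1 := (hb i).2
    have a2 := cv_le (fun i => 120 * cL r i) (fun i => 120 * cR r i) _ _ (fun i => (hb i).1) (fun i => (hb i).2) i
    omega
  rw [eL, eR] at h2
  unfold colChk at h2
  rw [fo_eq, fo_eq, fo_eq, fo_eq] at h2
  obtain ⟨h6, h7⟩ := an_spec h2
  obtain ⟨h6, h8⟩ := an_spec h6
  obtain ⟨h7, h9⟩ := an_spec h7
  have v1 : ((j1 : Z)).val = j1 := ZMod.val_cast_of_lt (by omega)
  have v2 : ((j2 : Z)).val = j2 := ZMod.val_cast_of_lt (by omega)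
  have d1 := dg_ev _ bR (j1 : Z)
  have d2 := dg_ev _ bR (j2 : Z)
  rw [v1] at d1
  rw [v2] at d2
  rw [d1] at h6 h7
  rw [d2] at h8 h9
  have key : ∀ j : ℕ, j < 45 →
      uq (ev fun i => ka r 281474976710656 (.inl 0) (.inr i)) (ka r 281474976710656 (.inl 0) (.inr (j : Z))) j 45 = true →
      uq (ev fun i => ka r 281474976710656 (.inl 0) (.inl i)) (ka r 281474976710656 (.inl 0) (.inr (j : Z))) 45 45 = true →
      ∀ q, ka r 281474976710656 (.inl 0) q = ka r 281474976710656 (.inl 0) (.inr (j : Z)) → q = .inr (j : Z) := by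
    intro j hj u1 u2 q hq
    rcases q with q | q
    · have := uq_spec _ _ _ _ u2 q.val (ZMod.val_lt q) (by rw [dg_ev _ bL q]; exact hq)
      have h := ZMod.val_lt q
      omega
    · have := uq_spec _ _ _ _ u1 q.val (ZMod.val_lt q) (by rw [dg_ev _ bR q]; exact hq)
      rw [← this, ZMod.natCast_zmod_val]
  have hcop : Nat.Coprime (j1 + 45 - j2) 45 := by
    rw [Nat.coprime_comm]; exact h3
  refine aut_criterion r hr 281474976710656 j1 j2 (key j1 (by omega) h6 h7) (key j2 (by omega) h8 h9)
    (((j1 + 45 - j2 : ℕ) : Z)⁻¹) ?_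
  have := ZMod.coe_mul_inv_eq_one (n := 45) (j1 + 45 - j2) hcop
  rw [mul_comm]
  have e : ((j1 + 45 - j2 : ℕ) : Z) = (j1 : Z) - (j2 : Z) := by
    rw [Nat.cast_sub (by omega), Nat.cast_add]
    have : ((45 : ℕ) : Z) = 0 := ZMod.natCast_self 45
    rw [this, add_zero]
  rw [← e]
  exact this

end Fin

section Conn
open Classical

noncomputable def stepGoC (p : Nat) (row : List Sl) : Nat → Sl → List Sl :=
  List.rec (motive := fun _ => Nat → Sl → List Sl) (fun _ _ => [])
    (fun q _ ih w a => Bool.rec (motive := fun _ => Sl) (skp q) (comb p a q) (Nat.ble (Nat.mul 45 w) (Nat.mul 7 p)) :: ih (Nat.succ w) q) row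

noncomputable def stepRowC (p : Nat) (row : List Sl) : List Sl :=
  List.rec (motive := fun _ => List Sl) []
    (fun q l _ => skp q :: stepGoC p l 1 q) row

noncomputable def rowC (n : Nat) : List Sl :=
  Nat.rec (motive := fun _ => List Sl)
    [⟨.leaf, 1, []⟩, ⟨.nil, 0, []⟩, ⟨.nil, 0, []⟩, ⟨.nil, 0, []⟩, ⟨.nil, 0, []⟩, ⟨.nil, 0, []⟩, ⟨.nil, 0, []⟩]
    (fun k ih => stepRowC (Nat.succ k) ih) n

noncomputable def fam : Sl :=
  catSl (nthSl (rowC 44) 6) (skp (skp (skp (skp (skp (skp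
    (catSl (nthSl (row 38) 4) (catSl (nthSl (row 38) 2) (nthSl (row 38) 0)))))))))

noncomputable def bt (sr k : ℕ) : Bool := Nat.beq (Nat.mod (Nat.shiftRight sr (Nat.mul 72 k)) 2) 1

noncomputable def bitsD (sr n : Nat) : Nat → List Bool → List Bool :=
  Nat.rec (motive := fun _ => Nat → List Bool → List Bool) (fun _ acc => acc)
    (fun _ ih k acc => Bool.rec (motive := fun _ => List Bool)
       (ih (Nat.succ k) (false :: acc)) (ih (Nat.succ k) (true :: acc)) (bt sr k)) n

noncomputable def posL (G : Sl) : List Nat := Nat.sub (Nat.pow 2 G.sz) 1 :: G.sl.reverse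

inductive Tq where
  | leaf : Nat → Nat → Nat → Nat → Nat → Tq
  | node : Tq → Tq → Tq

noncomputable def Tq.xr (t : Tq) (a b c d e : Nat) : Tq :=
  Tq.rec (motive := fun _ => Tq) (fun a' b' c' d' e' => .leaf (Nat.xor a' a) (Nat.xor b' b) (Nat.xor c' c) (Nat.xor d' d) (Nat.xor e' e))
    (fun _ _ l r => .node l r) t

noncomputable def hdl (l : List Nat) : Nat := List.rec (motive := fun _ => Nat) 0 (fun x _ _ => x) l
noncomputable def tll {α : Type} (l : List α) : List α := List.rec (motive := fun _ => List α) [] (fun _ l _ => l) l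

noncomputable def nd2 (x a b c d : Nat) (t : Tq) : Tq := .node t (t.xr x a b c d)

noncomputable def mkTq (l : List Nat) : List Nat → List Nat → List Nat → List Nat → Tq :=
  List.rec (motive := fun _ => List Nat → List Nat → List Nat → List Nat → Tq) (fun _ _ _ _ => .leaf 0 0 0 0 0)
    (fun x _ ih a b c d => nd2 x (hdl a) (hdl b) (hdl c) (hdl d) (ih (tll a) (tll b) (tll c) (tll d))) l

noncomputable def lk (t : Tq) : List Bool → (Nat → Nat → Nat → Nat → Nat → Nat) → Nat :=
  Tq.rec (motive := fun _ => List Bool → (Nat → Nat → Nat → Nat → Nat → Nat) → Nat)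
    (fun a b c d e _ k => k a b c d e)
    (fun _ _ il ir D => List.rec (motive := fun _ => (Nat → Nat → Nat → Nat → Nat → Nat) → Nat) (fun _ => 0)
      (fun b D' _ => Bool.rec (motive := fun _ => (Nat → Nat → Nat → Nat → Nat → Nat) → Nat) (il D') (ir D') b) D) t

def x5 (a b c d e : Nat) : Nat := Nat.xor (Nat.xor (Nat.xor (Nat.xor a b) c) d) e

def fa (x y z : Nat) (k : Nat → Nat → Nat) : Nat :=
  (fun u => k (Nat.xor u z) (Nat.lor (Nat.land x y) (Nat.land u z))) (Nat.xor x y)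
def ha (x y : Nat) (k : Nat → Nat → Nat) : Nat := k (Nat.xor x y) (Nat.land x y)

def acc5 (a b c d e : Nat) (o t f h g : Nat) (k : Nat → Nat → Nat → Nat → Nat → Nat) : Nat :=
  fa o a b fun o c1 => fa o c d fun o c2 => ha o e fun o c3 =>
  fa t c1 c2 fun t d1 => ha t c3 fun t d2 => fa f d1 d2 fun f e1 =>
  k o t f (Nat.lor h e1) (Nat.lor g (Nat.land h e1))

noncomputable def run (T : Tq) (n : Nat) : List Bool → List Bool → List Bool → List Bool → List Bool →
    Nat → Nat → Nat → Nat → Nat → Nat :=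
  Nat.rec (motive := fun _ => List Bool → List Bool → List Bool → List Bool → List Bool →
    Nat → Nat → Nat → Nat → Nat → Nat) (fun _ _ _ _ _ _ _ _ _ g => g)
   (fun _ ih A B C D E o t f h g =>
     lk T A fun a0 a1 a2 a3 a4 => lk T B fun b0 b1 b2 b3 b4 => lk T C fun c0 c1 c2 c3 c4 =>
     lk T D fun d0 d1 d2 d3 d4 => lk T E fun e0 e1 e2 e3 e4 =>
     acc5 (x5 a0 b1 c2 d3 e4) (x5 b0 c1 d2 e3 a4) (x5 c0 d1 e2 a3 b4) (x5 d0 e1 a2 b3 c4) (x5 e0 a1 b2 c3 d4) o t f h g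
       (ih (tll A) (tll B) (tll C) (tll D) (tll E))) n

noncomputable def tk (n : Nat) : List Nat → List Nat :=
  Nat.rec (motive := fun _ => List Nat → List Nat) (fun _ => [])
    (fun _ ih l => List.rec (motive := fun _ => List Nat) [] (fun x l _ => x :: ih l) l) n
noncomputable def dp {α : Type} (n : Nat) : List α → List α :=
  Nat.rec (motive := fun _ => List α → List α) (fun l => l)
    (fun _ ih l => ih (tll l)) n

structure Sv where
  tr : Tr
  one : Nat
  q0 : Nat
  q1 : Nat
  q2 : Nat
  ts : Tq

noncomputable def mkSv (G : Sl) : Sv :=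
  ⟨G.tr, Nat.sub (Nat.pow 2 G.sz) 1, (csa (posL G) 0).1, (csa (csa (posL G) 0).2 0).1,
    (csa (csa (csa (posL G) 0).2 0).2 0).1, mkTq (tk 9 (posL G)) (tk 9 (dp 9 (posL G))) (tk 9 (dp 18 (posL G)))
      (tk 9 (dp 27 (posL G))) (tk 9 (dp 36 (posL G)))⟩

noncomputable def codeW' (U : Sv) (D : List Bool) : Nat :=
  Nat.land (Nat.xor U.one (run U.ts 9 D (dp 9 D) (dp 18 D) (dp 27 D) (dp 36 D) U.q0 U.q1 U.q2 0 0)) U.one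
noncomputable def codeW (U : Sv) (sr : Nat) : Nat := codeW' U (bitsD sr 45 0 (bitsD sr 45 0 []))

theorem ble_rec {α : Type*} (m n : ℕ) (x y : α) :
    Bool.rec (motive := fun _ => α) x y (Nat.ble m n) = if m ≤ n then y else x := by
  by_cases h : m ≤ n
  · rw [if_pos h, Nat.ble_eq_true_of_le h]
  · rw [if_neg h, Bool.eq_false_iff.2 fun h' => h (Nat.le_of_ble_eq_true h')]

/-- enumerates the `w`-subsets of `1..n` with `Cy` -/
structure Sl.OkC (n w : ℕ) (a : Sl) : Prop where
  gen : a.Gen n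
  mem : ∀ x, x ∈ a.tr.elems ↔ x ∈ Finset.powersetCard w (Finset.Icc 1 n) ∧ Cy n x
  nd : a.tr.elems.Nodup

theorem Cy_succ {n w : ℕ} {x : Finset ℕ} (hx : x ∈ Finset.powersetCard w (Finset.Icc 1 (n + 1))) :
    Cy (n + 1) x ↔ Cy n x ∧ 45 * w ≤ 7 * (n + 1) := by
  rw [Finset.mem_powersetCard] at hx
  constructor
  · intro h
    refine ⟨fun m hm => h m (by omega), ?_⟩
    have := h (n + 1) le_rfl
    rwa [Finset.inter_eq_left.2 hx.1, hx.2] at this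
  · rintro ⟨h1, h2⟩ m hm
    by_cases h : m ≤ n
    · exact h1 m h
    · have : m = n + 1 := by omega
      rw [this, Finset.inter_eq_left.2 hx.1, hx.2]; exact h2

theorem Cy_insert (n : ℕ) (x : Finset ℕ) : Cy n (insert (n + 1) x) ↔ Cy n x := by
  unfold Cy
  refine forall_congr' fun m => forall_congr' fun hm => ?_
  rw [Finset.insert_inter_of_notMem]
  simp; omega

theorem okC_comb {n w : ℕ} {hi lo : Sl} (hw : 45 * (w + 1) ≤ 7 * (n + 1)) (hh : hi.OkC n w) (hl : lo.OkC n (w + 1)) :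
    (comb (n + 1) hi lo).OkC (n + 1) (w + 1) := by
  have hI : Finset.Icc 1 (n + 1) = insert (n + 1) (Finset.Icc 1 n) := by
    ext i; simp; omega
  have hn : n + 1 ∉ Finset.Icc 1 n := by simp
  have hnh : ∀ x ∈ hi.tr.elems, n + 1 ∉ x := by
    intro x hx h; have := hh.gen.bd x hx _ h; omega
  refine ⟨gen_comb hh.gen hl.gen, ?_, ?_⟩
  · intro x
    change x ∈ lo.tr.elems ++ hi.tr.elems.map (insert (n + 1)) ↔ _
    have e : x ∈ Finset.powersetCard (w + 1) (Finset.Icc 1 (n + 1)) ∧ Cy (n + 1) x ↔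
        x ∈ Finset.powersetCard (w + 1) (Finset.Icc 1 (n + 1)) ∧ Cy n x :=
      and_congr_right fun h => by rw [Cy_succ h]; exact and_iff_left hw
    rw [e, hI, Finset.powersetCard_succ_insert hn, List.mem_append, Finset.mem_union, hl.mem, List.mem_map,
      Finset.mem_image, or_and_right]
    simp only [hh.mem]
    refine or_congr Iff.rfl ⟨?_, ?_⟩
    · rintro ⟨a, ⟨h1, h2⟩, rfl⟩
      exact ⟨⟨a, h1, rfl⟩, (Cy_insert n a).2 h2⟩
    · rintro ⟨⟨a, h1, rfl⟩, h2⟩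
      exact ⟨a, ⟨h1, (Cy_insert n a).1 h2⟩, rfl⟩
  · change (lo.tr.elems ++ hi.tr.elems.map (insert (n + 1))).Nodup
    rw [List.nodup_append]
    refine ⟨hl.nd, ?_, ?_⟩
    · refine List.Nodup.map_on ?_ hh.nd
      intro x hx y hy hxy
      rw [← Finset.erase_insert (hnh x hx), hxy, Finset.erase_insert (hnh y hy)]
    · intro x hx y hy hxy
      obtain ⟨z, _, rfl⟩ := List.mem_map.1 hy
      have := hl.gen.bd x hx (n + 1) (by rw [hxy]; exact Finset.mem_insert_self _ _)
      omega

theorem Cy_card {n w : ℕ} {x : Finset ℕ} (hx : x ∈ Finset.powersetCard w (Finset.Icc 1 n)) (h : Cy n x) : 45 * w ≤ 7 * n := by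
  rw [Finset.mem_powersetCard] at hx
  have := h n le_rfl
  rwa [Finset.inter_eq_left.2 hx.1, hx.2] at this

theorem okC_skp {n w : ℕ} {lo : Sl} (hw : w = 0 ∨ ¬ 45 * w ≤ 7 * (n + 1)) (hl : lo.OkC n w) : (skp lo).OkC (n + 1) w := by
  refine ⟨gen_skp hl.gen, ?_, hl.nd⟩
  intro x
  change x ∈ lo.tr.elems ↔ _
  rw [hl.mem]
  rcases hw with rfl | hw
  · simp only [Finset.powersetCard_zero, Finset.mem_singleton]
    refine and_congr_right ?_
    rintro rfl
    simp [Cy]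
  · constructor
    · rintro ⟨h1, h2⟩
      have := Cy_card h1 h2; omega
    · rintro ⟨h1, h2⟩
      have := Cy_card h1 h2; omega

def OkCL (n : ℕ) : ℕ → List Sl → Prop
  | _, [] => True
  | w, q :: l => q.OkC n w ∧ OkCL n (w + 1) l

theorem okCL_stepGo {n : ℕ} (l : List Sl) (w : ℕ) (p : Sl) (hp : p.OkC n w) (hl : OkCL n (w + 1) l) :
    OkCL (n + 1) (w + 1) (stepGoC (n + 1) l (w + 1) p) := by
  induction l generalizing w p with
  | nil => trivial
  | cons q l ih =>
    refine ⟨?_, ih (w + 1) q hl.1 hl.2⟩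
    rw [ble_rec]
    change Sl.OkC _ _ (if 45 * (w + 1) ≤ 7 * (n + 1) then _ else _)
    split_ifs with h
    · exact okC_comb h hp hl.1
    · exact okC_skp (.inr h) hl.1

theorem stepGoC_length (n : ℕ) (l : List Sl) (w : ℕ) (p : Sl) : (stepGoC n l w p).length = l.length := by
  induction l generalizing w p with
  | nil => rfl
  | cons q l ih =>
    change (stepGoC n l (w + 1) q).length + 1 = _
    rw [ih]; rfl

theorem rowC_ok (n : ℕ) : OkCL n 0 (rowC n) ∧ (rowC n).length = 7 := by
  induction n with
  | zero =>
    refine ⟨?_, rfl⟩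
    have h : ∀ w, (⟨.nil, 0, []⟩ : Sl).OkC 0 (w + 1) := by
      intro w
      refine ⟨⟨trivial, rfl, rfl, ?_⟩, ?_, List.nodup_nil⟩
      · intro x hx; cases hx
      · intro x
        constructor
        · intro h; cases h
        · rintro ⟨h1, h2⟩
          have := Cy_card h1 h2; omega
    refine ⟨⟨⟨trivial, rfl, rfl, ?_⟩, ?_, ?_⟩, h _, h _, h _, h _, h _, h _, trivial⟩
    · intro x hx i hi; simp [Tr.elems] at hx; subst hx; simp at hi
    · intro x
      simp only [Tr.elems, Finset.powersetCard_zero, Finset.mem_singleton, List.mem_singleton]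
      refine ⟨?_, fun h => h.1⟩
      rintro rfl; simp [Cy]
    · simp [Tr.elems]
  | succ n ih =>
    change OkCL (n + 1) 0 (stepRowC (n + 1) (rowC n)) ∧ (stepRowC (n + 1) (rowC n)).length = 7
    generalize rowC n = l at ih
    obtain ⟨ih, hl⟩ := ih
    cases l with
    | nil => exact ⟨trivial, hl⟩
    | cons q l =>
      refine ⟨⟨okC_skp (.inl rfl) ih.1, okCL_stepGo l 0 q ih.1 ih.2⟩, ?_⟩
      change (stepGoC (n + 1) l 1 q).length + 1 = 7
      rw [stepGoC_length]; exact hl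

theorem okCL_nth {n : ℕ} (l : List Sl) (w : ℕ) (hl : OkCL n w l) (i : ℕ) (hi : i < l.length) :
    (nthSl l i).OkC n (w + i) := by
  induction l generalizing w i with
  | nil => simp at hi
  | cons q l ih =>
    cases i with
    | zero => exact hl.1
    | succ i =>
      have := ih (w + 1) hl.2 i (by simpa using hi)
      have e : w + (i + 1) = w + 1 + i := by omega
      rw [e]; exact this

theorem ok_rowC : (nthSl (rowC 44) 6).OkC 44 6 := by
  have := okCL_nth _ 0 (rowC_ok 44).1 6 (by rw [(rowC_ok 44).2]; norm_num)
  rwa [zero_add] at this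

/-! tables -/
theorem lk_xr (t : Tq) (a b c d e : ℕ) (D : List Bool) (k : ℕ → ℕ → ℕ → ℕ → ℕ → ℕ) :
    lk (t.xr a b c d e) D k = lk t D fun a' b' c' d' e' => k (a' ^^^ a) (b' ^^^ b) (c' ^^^ c) (d' ^^^ d) (e' ^^^ e) := by
  induction t generalizing D with
  | leaf a' b' c' d' e' => rfl
  | node l r ihl ihr =>
    cases D with
    | nil => rfl
    | cons x D =>
      cases x
      · exact ihl D
      · exact ihr D

theorem lk_mk (l a b c d : List ℕ) (ha : a.length = l.length) (hb : b.length = l.length) (hc : c.length = l.length)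
    (hd : d.length = l.length) (D : List Bool) (h : l.length ≤ D.length) (k : ℕ → ℕ → ℕ → ℕ → ℕ → ℕ) :
    lk (mkTq l a b c d) D k = k (xsum l D) (xsum a D) (xsum b D) (xsum c D) (xsum d D) := by
  induction l generalizing a b c d D k with
  | nil =>
    rw [List.eq_nil_of_length_eq_zero ha, List.eq_nil_of_length_eq_zero hb, List.eq_nil_of_length_eq_zero hc,
      List.eq_nil_of_length_eq_zero hd]
    cases D <;> rfl
  | cons x l ih =>
    cases D with
    | nil => simp at h
    | cons y D =>
      cases a with
      | nil => simp at ha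
      | cons a0 a =>
      cases b with
      | nil => simp at hb
      | cons b0 b =>
      cases c with
      | nil => simp at hc
      | cons c0 c =>
      cases d with
      | nil => simp at hd
      | cons d0 d =>
      simp only [List.length_cons, Nat.add_right_cancel_iff, Nat.add_le_add_iff_right] at ha hb hc hd h
      cases y
      · change lk (mkTq l a b c d) D k = _
        rw [ih a b c d ha hb hc hd D h]
        simp [xsum]
      · change lk ((mkTq l a b c d).xr x a0 b0 c0 d0) D k = _
        rw [lk_xr, ih a b c d ha hb hc hd D h]
        simp [xsum, Nat.xor_comm]

theorem xsum_congr (l : List ℕ) (D E : List Bool) (h1 : l.length ≤ D.length) (h2 : l.length ≤ E.length)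
    (h : ∀ i < l.length, D.getD i false = E.getD i false) : xsum l D = xsum l E := by
  induction l generalizing D E with
  | nil => cases D <;> cases E <;> rfl
  | cons x l ih =>
    cases D with
    | nil => simp at h1
    | cons d D =>
    cases E with
    | nil => simp at h2
    | cons e E =>
      have h0 := h 0 (by simp)
      simp only [List.getD_cons_zero] at h0
      subst h0
      rw [xsum, xsum, ih D E (by simpa using h1) (by simpa using h2)]
      intro i hi
      have := h (i + 1) (by simpa using hi)
      simpa using this

theorem bit_acc : ∀ a b c d e o t f h g : Bool,
    let c1 := (o && a) || ((o ^^ a) && b)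
    let o1 := (o ^^ a) ^^ b
    let c2 := (o1 && c) || ((o1 ^^ c) && d)
    let o2 := (o1 ^^ c) ^^ d
    let c3 := o2 && e
    let o3 := o2 ^^ e
    let d1 := (t && c1) || ((t ^^ c1) && c2)
    let t1 := (t ^^ c1) ^^ c2
    let d2 := t1 && c3
    let t2 := t1 ^^ c3
    let e1 := (f && d1) || ((f ^^ d1) && d2)
    let f1 := (f ^^ d1) ^^ d2
    o.toNat + 2 * t.toNat + 4 * f.toNat + 8 * h.toNat + (a.toNat + b.toNat + c.toNat + d.toNat + e.toNat) < 16 → g = false →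
    (o.toNat + 2 * t.toNat + 4 * f.toNat + 8 * h.toNat + (a.toNat + b.toNat + c.toNat + d.toNat + e.toNat) =
      o3.toNat + 2 * t2.toNat + 4 * f1.toNat + 8 * (h || e1).toNat) ∧ (g || (h && e1)) = false := by decide

def vl (k o t f h : ℕ) : ℕ := (o.testBit k).toNat + 2 * (t.testBit k).toNat + 4 * (f.testBit k).toNat + 8 * (h.testBit k).toNat

theorem acc5_spec (k a b c d e o t f h g : ℕ) (K : ℕ → ℕ → ℕ → ℕ → ℕ → ℕ) :
    ∃ o' t' f' h' g', acc5 a b c d e o t f h g K = K o' t' f' h' g' ∧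
      (vl k o t f h + ((a.testBit k).toNat + (b.testBit k).toNat + (c.testBit k).toNat + (d.testBit k).toNat + (e.testBit k).toNat) < 16 →
        g.testBit k = false →
        vl k o t f h + ((a.testBit k).toNat + (b.testBit k).toNat + (c.testBit k).toNat + (d.testBit k).toNat + (e.testBit k).toNat) =
          vl k o' t' f' h' ∧ g'.testBit k = false) := by
  refine ⟨_, _, _, _, _, rfl, ?_⟩
  have := bit_acc (a.testBit k) (b.testBit k) (c.testBit k) (d.testBit k) (e.testBit k) (o.testBit k) (t.testBit k) (f.testBit k)
    (h.testBit k) (g.testBit k)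
  have x_raw : ∀ m n, Nat.xor m n = m ^^^ n := fun _ _ => rfl
  have a_raw : ∀ m n, Nat.land m n = m &&& n := fun _ _ => rfl
  have o_raw : ∀ m n, Nat.lor m n = m ||| n := fun _ _ => rfl
  unfold vl
  simp only [x_raw, a_raw, o_raw, Nat.testBit_xor, Nat.testBit_and, Nat.testBit_or]
  exact this

theorem dp_drop {α : Type} (n : ℕ) (l : List α) : dp n l = l.drop n := by
  induction n generalizing l with
  | zero => rfl
  | succ n ih =>
    change dp n (tll l) = _
    rw [ih]; cases l <;> simp [tll]

theorem tk_take (n : ℕ) (l : List ℕ) : tk n l = l.take n := by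
  induction n generalizing l with
  | zero => rfl
  | succ n ih =>
    cases l with
    | nil => rfl
    | cons x l =>
      change x :: tk n l = _
      rw [ih]; rfl

theorem tll_drop {α : Type} (l : List α) (n : ℕ) : tll (l.drop n) = l.drop (n + 1) := by
  rw [← List.drop_drop]; cases l.drop n <;> rfl

noncomputable def mkP (P : List ℕ) : Tq := mkTq (P.take 9) ((P.drop 9).take 9) ((P.drop 18).take 9) ((P.drop 27).take 9) ((P.drop 36).take 9)

/-- chunk contribution -/
def ch (P : List ℕ) (D : List Bool) (i t : ℕ) : ℕ := xsum ((P.drop (9 * i)).take 9) (D.drop t)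

theorem lk_P (P : List ℕ) (hP : P.length = 45) (D : List Bool) (hD : D.length = 90) (t : ℕ) (ht : t < 45) (K : ℕ → ℕ → ℕ → ℕ → ℕ → ℕ) :
    lk (mkP P) (D.drop t) K = K (ch P D 0 t) (ch P D 1 t) (ch P D 2 t) (ch P D 3 t) (ch P D 4 t) := by
  unfold mkP
  rw [lk_mk]
  · rfl
  all_goals simp [hP, hD]
  omega

theorem ch_per (P : List ℕ) (D : List Bool) (hD : D.length = 90) (hp : ∀ m < 45, D.getD (m + 45) false = D.getD m false)
    (i t : ℕ) (ht : t + 9 ≤ 45) : ch P D i t = ch P D i (t + 45) := by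
  have hl : ((P.drop (9 * i)).take 9).length ≤ 9 := by rw [List.length_take]; omega
  refine xsum_congr _ _ _ (by rw [List.length_drop]; omega) (by rw [List.length_drop]; omega) ?_
  intro j hj
  have e : ∀ t, (D.drop t).getD j false = D.getD (t + j) false := fun t => by simp [List.getD, List.getElem?_drop]
  rw [e, e, ← hp (t + j) (by omega)]
  congr 1; omega

theorem ch_col (P : List ℕ) (hP : P.length = 45) (D : List Bool) (hD : D.length = 90) (t : ℕ) (ht : t < 45) :
    xsum P (D.drop t) = x5 (ch P D 0 t) (ch P D 1 (t + 9)) (ch P D 2 (t + 18)) (ch P D 3 (t + 27)) (ch P D 4 (t + 36)) := by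
  have st : ∀ i m, 9 * i + 9 + m = 45 → xsum (P.drop (9 * i)) (D.drop (t + 9 * i)) =
      ch P D i (t + 9 * i) ^^^ xsum (P.drop (9 * (i + 1))) (D.drop (t + 9 * (i + 1))) := by
    intro i m hm
    conv_lhs => rw [← List.take_append_drop 9 (P.drop (9 * i))]
    have hl : ((P.drop (9 * i)).take 9).length = 9 := by rw [List.length_take, List.length_drop]; omega
    rw [xsum_append _ _ _ (by rw [hl, List.length_drop]; omega), hl, List.drop_drop, List.drop_drop]
    rfl
  have h0 := st 0 36 rfl
  have h1 := st 1 27 rfl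
  have h2 := st 2 18 rfl
  have h3 := st 3 9 rfl
  have h4 := st 4 0 rfl
  have h5 : xsum (P.drop (9 * (4 + 1))) (D.drop (t + 9 * (4 + 1))) = 0 := by
    rw [List.drop_of_length_le (by omega)]
    cases D.drop (t + 9 * (4 + 1)) <;> rfl
  simp only [mul_zero, add_zero, List.drop_zero] at h0
  rw [h0, h1, h2, h3, h4, h5, Nat.xor_zero]
  have x5_raw : ∀ a b c d e : ℕ, x5 a b c d e = a ^^^ b ^^^ c ^^^ d ^^^ e := fun _ _ _ _ _ => rfl
  rw [x5_raw]
  simp only [Nat.xor_assoc]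

theorem run_spec (P : List ℕ) (hP : P.length = 45) (D : List Bool) (hD : D.length = 90)
    (hp : ∀ m < 45, D.getD (m + 45) false = D.getD m false) (k n s : ℕ) (hs : s + n = 9) (o t f h g : ℕ)
    (hv : vl k o t f h + ∑ j ∈ Finset.range n, (((xsum P (D.drop (s + j))).testBit k).toNat +
      ((xsum P (D.drop (s + j + 9))).testBit k).toNat + ((xsum P (D.drop (s + j + 18))).testBit k).toNat +
      ((xsum P (D.drop (s + j + 27))).testBit k).toNat + ((xsum P (D.drop (s + j + 36))).testBit k).toNat) < 16)
    (hg : g.testBit k = false) :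
    (run (mkP P) n (D.drop s) (D.drop (s + 9)) (D.drop (s + 18)) (D.drop (s + 27)) (D.drop (s + 36)) o t f h g).testBit k = false := by
  induction n generalizing s o t f h g with
  | zero => exact hg
  | succ n ih =>
    change (lk (mkP P) _ fun a0 a1 a2 a3 a4 => lk (mkP P) _ fun b0 b1 b2 b3 b4 => lk (mkP P) _ fun c0 c1 c2 c3 c4 =>
     lk (mkP P) _ fun d0 d1 d2 d3 d4 => lk (mkP P) _ fun e0 e1 e2 e3 e4 =>
     acc5 (x5 a0 b1 c2 d3 e4) (x5 b0 c1 d2 e3 a4) (x5 c0 d1 e2 a3 b4) (x5 d0 e1 a2 b3 c4) (x5 e0 a1 b2 c3 d4) o t f h g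
       (run (mkP P) n (tll (D.drop s)) (tll (D.drop (s + 9))) (tll (D.drop (s + 18))) (tll (D.drop (s + 27)))
         (tll (D.drop (s + 36))))).testBit k = false
    rw [lk_P P hP D hD _ (by omega), lk_P P hP D hD _ (by omega), lk_P P hP D hD _ (by omega), lk_P P hP D hD _ (by omega),
      lk_P P hP D hD _ (by omega)]
    rw [tll_drop, tll_drop, tll_drop, tll_drop, tll_drop]
    have c0 := ch_col P hP D hD s (by omega)
    have c1 := ch_col P hP D hD (s + 9) (by omega)
    have c2 := ch_col P hP D hD (s + 18) (by omega)
    have c3 := ch_col P hP D hD (s + 27) (by omega)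
    have c4 := ch_col P hP D hD (s + 36) (by omega)
    simp only [add_assoc, Nat.reduceAdd] at c0 c1 c2 c3 c4
    rw [← c0]
    rw [ch_per P D hD hp 4 s (by omega), ← c1, ch_per P D hD hp 3 s (by omega), ch_per P D hD hp 4 (s + 9) (by omega),
      add_assoc s 9 45, ← c2, ch_per P D hD hp 2 s (by omega), ch_per P D hD hp 3 (s + 9) (by omega),
      ch_per P D hD hp 4 (s + 18) (by omega), add_assoc s 9 45, add_assoc s 18 45, ← c3,
      ch_per P D hD hp 1 s (by omega), ch_per P D hD hp 2 (s + 9) (by omega), ch_per P D hD hp 3 (s + 18) (by omega),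
      ch_per P D hD hp 4 (s + 27) (by omega), add_assoc s 9 45, add_assoc s 18 45, add_assoc s 27 45, ← c4]
    obtain ⟨o', t', f', h', g', he, hb⟩ := acc5_spec k (xsum P (D.drop s)) (xsum P (D.drop (s + 9))) (xsum P (D.drop (s + 18)))
      (xsum P (D.drop (s + 27))) (xsum P (D.drop (s + 36))) o t f h g (run (mkP P) n (D.drop (s + 1)) (D.drop (s + 9 + 1))
        (D.drop (s + 18 + 1)) (D.drop (s + 27 + 1)) (D.drop (s + 36 + 1)))
    rw [he]
    rw [Finset.sum_range_succ'] at hv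
    simp only [add_zero] at hv
    obtain ⟨hb1, hb2⟩ := hb (by omega) hg
    have e : ∀ m, s + m + 1 = (s + 1) + m := fun m => by omega
    rw [e, e, e, e]
    refine ih (s + 1) (by omega) _ _ _ _ _ ?_ hb2
    rw [← hb1]
    have e2 : ∀ j, s + 1 + j = s + (j + 1) := fun j => by omega
    simp only [e2]
    omega

theorem bitsD_spec (sr n k : ℕ) (acc : List Bool) :
    bitsD sr n k acc = ((List.range n).map fun i => bt sr (k + i)).reverse ++ acc := by
  induction n generalizing k acc with
  | zero => rfl
  | succ n ih =>
    have h : bitsD sr (n + 1) k acc = bitsD sr n (k + 1) (bt sr k :: acc) := by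
      change Bool.rec (motive := fun _ => List Bool)
       (bitsD sr n (k + 1) (false :: acc)) (bitsD sr n (k + 1) (true :: acc)) (bt sr k) = _
      cases bt sr k <;> rfl
    rw [h, ih, List.range_succ_eq_map, List.map_cons, List.reverse_cons, List.map_map, List.append_assoc]
    congr 2
    refine List.map_congr_left fun i _ => ?_
    change bt sr (k + 1 + i) = bt sr (k + (i + 1))
    rw [add_assoc, add_comm 1 i]

theorem bt_raw (sr k : ℕ) : bt sr k = decide (sr / 2 ^ (72 * k) % 2 = 1) := by
  unfold bt
  rw [beq_dec]
  change decide ((sr >>> (72 * k)) % 2 = 1) = _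
  rw [Nat.shiftRight_eq_div_pow]

theorem bt_S (r : A) (q : Z) : bt (S r) q.val = decide (co r q = 1) := by
  rw [bt_raw]
  have h := ev_digit (fun k => (co r k).val) (fun i => val_lt_lw _) q
  have h2 : (S r / 2 ^ (72 * q.val)) % 2 = (co r q).val := by
    have e : (S r / 2 ^ (72 * q.val)) % 2 ^ lw = (co r q).val := h
    generalize S r / 2 ^ (72 * q.val) = x at *
    have h3 : x % 2 = x % 2 ^ lw % 2 := (Nat.mod_mod_of_dvd x ⟨2 ^ 71, by norm_num [lw]⟩).symm
    rw [h3, e]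
    exact Nat.mod_eq_of_lt (by have := val_le_one (co r q); omega)
  rw [h2, val_eq_one]
  by_cases hc : co r q = 1 <;> simp [hc]

/-- xsum as a sum over ZMod 2 -/
theorem xsum_bit (l : List ℕ) (D : List Bool) (k : ℕ) (h : l.length ≤ D.length) :
    (if (xsum l D).testBit k then (1 : ZMod 2) else 0) =
      ∑ i ∈ Finset.range l.length, (if (l.getD i 0).testBit k then 1 else 0) * (if D.getD i false then 1 else 0) := by
  induction l generalizing D with
  | nil => cases D <;> simp [xsum]
  | cons x l ih =>
    cases D with
    | nil => simp at h
    | cons d D =>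
      have h' : l.length ≤ D.length := by simpa using h
      rw [xsum, Nat.testBit_xor, List.length_cons, Finset.sum_range_succ']
      simp only [List.getD_cons_succ, List.getD_cons_zero]
      rw [← ih D h']
      cases d <;> cases hx : x.testBit k <;> cases (xsum l D).testBit k <;> simp [hx] <;> decide

theorem dsc_rev (n : ℕ) : (dsc n).reverse = (List.range n).map (· + 1) := by
  induction n with
  | zero => rfl
  | succ n ih => rw [dsc, List.reverse_cons, ih, List.range_succ, List.map_append]; rfl

theorem posL_eq {G : Sl} (hG : G.Gen 44) : posL G = (List.range 45).map fun i =>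
    if i = 0 then 2 ^ G.tr.elems.length - 1 else slc G.tr.elems i := by
  unfold posL
  rw [hG.sl, ← List.map_reverse, dsc_rev, hG.sz, List.map_map, List.range_succ_eq_map (n := 44), List.map_cons, List.map_map]
  rfl

theorem slc_bit (E : List (Finset ℕ)) (i k : ℕ) (hk : k < E.length) : (slc E i).testBit k = decide (i ∈ E[k]) := by
  unfold slc
  rw [pk_testBit]
  simp [List.getD, hk]

theorem pos_bit {G : Sl} (hG : G.Gen 44) (k : ℕ) (hk : k < G.tr.elems.length) (i : ℕ) (hi : i < 45) :
    ((posL G).getD i 0).testBit k = decide (i ∈ insert 0 G.tr.elems[k]) := by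
  rw [posL_eq hG]
  have : (((List.range 45).map fun i => if i = 0 then 2 ^ G.tr.elems.length - 1 else slc G.tr.elems i).getD i 0) =
      if i = 0 then 2 ^ G.tr.elems.length - 1 else slc G.tr.elems i := by
    rw [List.getD_eq_getElem _ _ (by rw [List.length_map, List.length_range]; exact hi), List.getElem_map, List.getElem_range]
  rw [this]
  split_ifs with h0
  · rw [Nat.testBit_two_pow_sub_one]; simp [hk, h0]
  · rw [slc_bit _ _ _ hk]; simp [h0]

theorem posL_length {G : Sl} (hG : G.Gen 44) : (posL G).length = 45 := by
  rw [posL_eq hG, List.length_map, List.length_range]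

theorem sub_of_bd {G : Sl} (hG : G.Gen 44) (k : ℕ) (hk : k < G.tr.elems.length) :
    G.tr.elems[k] ⊆ Finset.Icc 1 44 := by
  intro i hi
  exact Finset.mem_Icc.2 (hG.bd _ (List.getElem_mem hk) i hi)

theorem bb_get (sr m : ℕ) (h : m < 45) : (bitsD sr 45 0 []).getD m false = bt sr (44 - m) := by
  rw [bitsD_spec, List.append_nil, List.getD_eq_getElem _ _ (by simpa using h), List.getElem_reverse, List.getElem_map,
    List.getElem_range]
  simp

theorem bb_length (sr : ℕ) : (bitsD sr 45 0 []).length = 45 := by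
  rw [bitsD_spec]; simp

theorem D_get (sr m : ℕ) (h : m < 90) :
    (bitsD sr 45 0 [] ++ bitsD sr 45 0 []).getD m false = bt sr (44 - m % 45) := by
  by_cases h1 : m < 45
  · rw [List.getD_append _ _ _ _ (by rw [bb_length]; exact h1), bb_get _ _ h1, Nat.mod_eq_of_lt h1]
  · rw [List.getD_append_right _ _ _ _ (by rw [bb_length]; omega), bb_length, bb_get _ _ (by omega)]
    congr 2; omega

theorem out_bit {G : Sl} (hG : G.Gen 44) (r : A) (k : ℕ) (hk : k < G.tr.elems.length) (t : ℕ) (ht : t < 45) :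
    (if (xsum (posL G) ((bitsD (S r) 45 0 [] ++ bitsD (S r) 45 0 []).drop t)).testBit k then (1 : ZMod 2) else 0) =
      co (toA G.tr.elems[k] * r) ((44 - t : ℕ) : Z) := by
  rw [xsum_bit, posL_length hG, co_mul]
  · have e := sum_val (fun i => (if i ∈ insert 0 G.tr.elems[k] then (1 : ZMod 2) else 0) *
      co r (((44 - t : ℕ) : Z) - (i : Z)))
    have e2 : ∑ q : Z, co (toA G.tr.elems[k]) q * co r (((44 - t : ℕ) : Z) - q) =
        ∑ q : Z, (if q.val ∈ insert 0 G.tr.elems[k] then (1 : ZMod 2) else 0) *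
          co r (((44 - t : ℕ) : Z) - (q.val : Z)) := by
      refine Finset.sum_congr rfl fun q _ => ?_
      rw [co_toA _ (sub_of_bd hG k hk), ZMod.natCast_zmod_val]
    rw [e2, e]
    refine Finset.sum_congr rfl fun i hi => ?_
    have hi := Finset.mem_range.1 hi
    rw [pos_bit hG k hk i hi]
    have e4 : ((bitsD (S r) 45 0 [] ++ bitsD (S r) 45 0 []).drop t).getD i false =
        (bitsD (S r) 45 0 [] ++ bitsD (S r) 45 0 []).getD (t + i) false := by
      simp [List.getD, List.getElem?_drop]
    have e5 : (((44 - t : ℕ) : Z) - (i : Z)) = ((44 - (t + i) % 45 : ℕ) : Z) := by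
      by_cases h : t + i < 45
      · rw [Nat.mod_eq_of_lt h, ← Nat.cast_sub (by omega)]
        congr 1; omega
      · have h2 : (t + i) % 45 = t + i - 45 := by omega
        rw [h2, sub_eq_iff_eq_add, ← Nat.cast_add]
        have : 44 - (t + i - 45) + i = (44 - t) + 45 := by omega
        rw [this, Nat.cast_add]
        have : ((45 : ℕ) : Z) = 0 := ZMod.natCast_self 45
        rw [this, add_zero]
    have e6 : (((44 - (t + i) % 45 : ℕ) : Z)).val = 44 - (t + i) % 45 := ZMod.val_cast_of_lt (by omega)
    have e7 := bt_S r ((44 - (t + i) % 45 : ℕ) : Z)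
    rw [e6] at e7
    rw [e4, D_get _ _ (by omega), e5, e7]
    have e8 : ∀ c : ZMod 2, (if decide (c = 1) = true then (1 : ZMod 2) else 0) = c := by decide
    rw [e8]
    by_cases hm : i ∈ insert 0 G.tr.elems[k]
    · rw [decide_eq_true hm, if_pos rfl, if_pos hm]
    · rw [decide_eq_false hm, if_neg Bool.false_ne_true, if_neg hm]
  · rw [posL_length hG, List.length_drop, List.length_append, bb_length]; omega

theorem cnt_pos {G : Sl} (hG : G.Gen 44) (k : ℕ) (hk : k < G.tr.elems.length) :
    cnt (posL G) k = wt (toA G.tr.elems[k]) := by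
  have hsum : ∀ l : List ℕ, cnt l k = ∑ i ∈ Finset.range l.length, ((l.getD i 0).testBit k).toNat := by
    intro l
    induction l with
    | nil => rfl
    | cons x l ih =>
      have h1 : cnt (x :: l) k = (x.testBit k).toNat + cnt l k := by simp [cnt]
      rw [h1, ih, List.length_cons, Finset.sum_range_succ', add_comm]
      simp
  rw [hsum, posL_length hG, wt_toA _ (sub_of_bd hG k hk)]
  have h0 : 0 ∉ G.tr.elems[k] := fun h => by have := Finset.mem_Icc.1 (sub_of_bd hG k hk h); omega
  rw [Finset.sum_congr rfl fun i hi => by rw [pos_bit hG k hk i (Finset.mem_range.1 hi)], add_comm,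
    ← Finset.card_insert_of_notMem h0]
  have : ∀ i, (decide (i ∈ insert 0 G.tr.elems[k])).toNat = if i ∈ insert 0 G.tr.elems[k] then 1 else 0 := by
    intro i; by_cases h : i ∈ insert 0 G.tr.elems[k] <;> simp [h]
  simp only [this]
  rw [Finset.sum_ite_mem, Finset.inter_eq_right.2]
  · simp
  · intro x hx
    rw [Finset.mem_insert] at hx
    rw [Finset.mem_range]
    rcases hx with h | h
    · omega
    · have := Finset.mem_Icc.1 (sub_of_bd hG k hk h); omega

theorem cnt_out {G : Sl} (hG : G.Gen 44) (r : A) (k : ℕ) (hk : k < G.tr.elems.length) :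
    ∑ t ∈ Finset.range 45, ((xsum (posL G) ((bitsD (S r) 45 0 [] ++ bitsD (S r) 45 0 []).drop t)).testBit k).toNat ≤
      wt (toA G.tr.elems[k] * r) := by
  have h1 : ∑ t ∈ Finset.range 45, ((xsum (posL G) ((bitsD (S r) 45 0 [] ++ bitsD (S r) 45 0 []).drop t)).testBit k).toNat =
      ∑ t ∈ Finset.range 45, (co (toA G.tr.elems[k] * r) ((44 - t : ℕ) : Z)).val := by
    refine Finset.sum_congr rfl fun t ht => ?_
    rw [← out_bit hG r k hk t (Finset.mem_range.1 ht)]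
    cases (xsum (posL G) ((bitsD (S r) 45 0 [] ++ bitsD (S r) 45 0 []).drop t)).testBit k <;> rfl
  rw [h1]
  unfold wt
  have h2 : ∑ t ∈ Finset.range 45, (co (toA G.tr.elems[k] * r) ((44 - t : ℕ) : Z)).val =
      ∑ q ∈ (Finset.range 45).image (fun t => ((44 - t : ℕ) : Z)), (co (toA G.tr.elems[k] * r) q).val := by
    rw [Finset.sum_image]
    intro x hx y hy h
    simp only [Finset.coe_range, Set.mem_Iio] at hx hy
    have h := congrArg ZMod.val h
    beta_reduce at h
    rw [ZMod.val_cast_of_lt (by omega), ZMod.val_cast_of_lt (by omega)] at h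
    omega
  rw [h2]
  exact Finset.sum_le_sum_of_subset (Finset.subset_univ _)

theorem gen_skp6 {n : ℕ} {a : Sl} (h : a.Gen n) : (skp (skp (skp (skp (skp (skp a)))))).Gen (n + 6) :=
  gen_skp (gen_skp (gen_skp (gen_skp (gen_skp (gen_skp h)))))

theorem fam_gen : fam.Gen 44 :=
  gen_cat ok_rowC.gen (gen_skp6 (gen_cat (ok_row 38 4 (by norm_num)).gen
    (gen_cat (ok_row 38 2 (by norm_num)).gen (ok_row 38 0 (by norm_num)).gen)))

theorem fam_elems : fam.tr.elems = (((nthSl (row 38) 0).tr.elems ++ (nthSl (row 38) 2).tr.elems) ++ (nthSl (row 38) 4).tr.elems) ++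
    (nthSl (rowC 44) 6).tr.elems := rfl

theorem mem_fam (s : Finset ℕ) : s ∈ fam.tr.elems ↔ (s.card = 6 ∧ s ⊆ Finset.Icc 1 44 ∧ Cy 44 s) ∨
    (s ⊆ Finset.Icc 1 38 ∧ (s.card = 0 ∨ s.card = 2 ∨ s.card = 4)) := by
  rw [fam_elems, List.mem_append, List.mem_append, List.mem_append,
    ok_rowC.mem, (ok_row 38 4 (by norm_num)).mem, (ok_row 38 2 (by norm_num)).mem,
    (ok_row 38 0 (by norm_num)).mem]
  simp only [Finset.mem_powersetCard]
  tauto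

theorem nd_fam : fam.tr.elems.Nodup := by
  rw [fam_elems]
  have h0 : ∀ v, v < 7 → ∀ a ∈ (nthSl (row 38) v).tr.elems, a.card = v := by
    intro v hv a ha
    rw [(ok_row 38 v hv).mem, Finset.mem_powersetCard] at ha
    exact ha.2
  have h6 : ∀ a ∈ (nthSl (rowC 44) 6).tr.elems, a.card = 6 := by
    intro a ha
    rw [ok_rowC.mem, Finset.mem_powersetCard] at ha
    exact ha.1.2
  rw [List.nodup_append, List.nodup_append, List.nodup_append]
  refine ⟨⟨⟨(ok_row 38 0 (by norm_num)).nd, (ok_row 38 2 (by norm_num)).nd, ?_⟩,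
    (ok_row 38 4 (by norm_num)).nd, ?_⟩, ok_rowC.nd, ?_⟩
  · rintro a ha b hb rfl
    have := h0 _ (by norm_num) a ha
    have := h0 _ (by norm_num) a hb
    omega
  · rintro a ha b hb rfl
    have := h0 _ (by norm_num) a hb
    rw [List.mem_append] at ha
    rcases ha with ha | ha
    all_goals have := h0 _ (by norm_num) a ha; omega
  · rintro a ha b hb rfl
    have := h6 a hb
    rw [List.mem_append, List.mem_append] at ha
    rcases ha with (ha | ha) | ha
    all_goals have := h0 _ (by norm_num) a ha; omega

theorem mkSv_ts (G : Sl) : (mkSv G).ts = mkP (posL G) := by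
  change mkTq (tk 9 (posL G)) (tk 9 (dp 9 (posL G))) (tk 9 (dp 18 (posL G))) (tk 9 (dp 27 (posL G))) (tk 9 (dp 36 (posL G))) = _
  simp only [tk_take, dp_drop]
  rfl

theorem bits2 (sr : ℕ) : bitsD sr 45 0 (bitsD sr 45 0 []) = bitsD sr 45 0 [] ++ bitsD sr 45 0 [] := by
  rw [bitsD_spec sr 45 0 (bitsD sr 45 0 []), bitsD_spec sr 45 0 [], List.append_nil]

theorem sum45 (f : ℕ → ℕ) : ∑ j ∈ Finset.range 9, (f j + f (j + 9) + f (j + 18) + f (j + 27) + f (j + 36)) = ∑ t ∈ Finset.range 45, f t := by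
  simp only [Finset.sum_range_succ, Finset.sum_range_zero, Nat.reduceAdd, zero_add]
  omega

theorem codeW_bit {G : Sl} (hG : G.Gen 44) (r : A) (k : ℕ) (hk : k < G.tr.elems.length)
    (h : wt (toA G.tr.elems[k]) + wt (toA G.tr.elems[k] * r) = 14) : (codeW (mkSv G) (S r)).testBit k = true := by
  have h1 : (2 ^ G.sz - 1).testBit k = true := by
    rw [Nat.testBit_two_pow_sub_one, hG.sz]; simp [hk]
  unfold codeW codeW'
  rw [mkSv_ts, bits2, dp_drop, dp_drop, dp_drop, dp_drop]
  have hD : (bitsD (S r) 45 0 [] ++ bitsD (S r) 45 0 []).length = 90 := by rw [List.length_append, bb_length]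
  have hp : ∀ m < 45, (bitsD (S r) 45 0 [] ++ bitsD (S r) 45 0 []).getD (m + 45) false =
      (bitsD (S r) 45 0 [] ++ bitsD (S r) 45 0 []).getD m false := by
    intro m hm
    rw [D_get _ _ (by omega), D_get _ _ (by omega), Nat.add_mod_right]
  have hc := cnt_out hG r k hk
  have hcp := cnt_pos hG k hk
  generalize bitsD (S r) 45 0 [] ++ bitsD (S r) 45 0 [] = D at *
  have a1 := csa_spec (posL G) 0 k
  have a2 := csa_spec (csa (posL G) 0).2 0 k
  have a3 := csa_spec (csa (csa (posL G) 0).2 0).2 0 k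
  have hr := run_spec (posL G) (posL_length hG) D hD hp k 9 0 rfl (csa (posL G) 0).1 (csa (csa (posL G) 0).2 0).1
    (csa (csa (csa (posL G) 0).2 0).2 0).1 0 0 (by
      simp only [zero_add]
      rw [sum45 (fun t => ((xsum (posL G) (D.drop t)).testBit k).toNat)]
      unfold vl
      simp only [Nat.zero_testBit, Bool.toNat_false] at a1 a2 a3 ⊢
      omega) (Nat.zero_testBit k)
  rw [List.drop_zero, zero_add, zero_add, zero_add, zero_add] at hr
  change (((2 ^ G.sz - 1) ^^^ (run (mkP (posL G)) 9 D (D.drop 9) (D.drop 18) (D.drop 27) (D.drop 36) (csa (posL G) 0).1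
    (csa (csa (posL G) 0).2 0).1 (csa (csa (csa (posL G) 0).2 0).2 0).1 0 0)) &&& (2 ^ G.sz - 1)).testBit k = true
  rw [Nat.testBit_and, Nat.testBit_xor, h1, hr]
  rfl

theorem codeW_lt {G : Sl} (hG : G.Gen 44) (sr : ℕ) : codeW (mkSv G) sr < 2 ^ G.tr.elems.length := by
  rw [← hG.sz]
  change _ &&& (2 ^ G.sz - 1) < _
  rw [Nat.and_two_pow_sub_one_eq_mod]
  exact Nat.mod_lt _ (Nat.two_pow_pos _)

theorem compl_fam (r : A) (hr : r * st r = 1) (hw : wt r % 4 = 1) :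
    WCompl r (sel fam.tr.elems (codeW (mkSv fam) (S r))) := by
  refine ⟨nd_fam.sublist (sel_sublist _ _), ?_, ?_, ?_, ?_⟩
  · intro s hs
    rcases (mem_fam s).1 ((sel_sublist _ _).subset hs) with h | h
    · exact h.2.1
    · exact h.1.trans (Finset.Icc_subset_Icc le_rfl (by norm_num))
  · intro s hs
    rcases (mem_fam s).1 ((sel_sublist _ _).subset hs) with h | h
    · rw [Pt_toA s h.2.1]; exact .inl ⟨h.1, h.2.2⟩
    · rw [Pt_toA s (h.1.trans (Finset.Icc_subset_Icc le_rfl (by norm_num)))]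
      exact .inr ⟨by omega, h.1⟩
  · intro s hs
    have := (mem_fam s).1 ((sel_sublist _ _).subset hs)
    omega
  · intro a ha hp
    obtain ⟨s, hs, rfl⟩ := exists_toA a hp
    refine ⟨s, ?_, rfl⟩
    simp only [T14, W14, Finset.mem_filter, Finset.mem_univ, true_and] at ha
    have h1 := wt_odd r hr hw _ ha.1
    have h2 := ha.2
    rw [wt_toA s hs] at h1 h2
    have hm : s ∈ fam.tr.elems := by
      rw [mem_fam]
      rcases (Pt_toA s hs).1 hp with h | h
      · exact .inl ⟨h.1, hs, h.2⟩
      · exact .inr ⟨h.2, by omega⟩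
    obtain ⟨k, hk, rfl⟩ := List.getElem_of_mem hm
    exact mem_sel _ _ _ hk (codeW_bit fam_gen r k hk ha.1)

/-- the automorphism check -/
noncomputable def autChk (U : Sv) (sr srs j1 j2 : ℕ) : Bool :=
  an (Nat.beq (Nat.mod (Nat.mod sr m72) 4) 1) (finChk sr srs j1 j2 (trav U.tr (codeW U sr) 1 1 []))

theorem autChk_spec (r : A) (hr : r * st r = 1) (j1 j2 : ℕ)
    (h : autChk (mkSv fam) (S r) (S (st r)) j1 j2 = true) : Good r := by
  intro _
  obtain ⟨h1, h2⟩ := an_spec h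
  have h1 := Nat.eq_of_beq_eq_true h1
  have e : Nat.mod (S r) m72 = wt r := S_wt r
  rw [e] at h1
  have hc := compl_fam r hr h1
  refine finChk_spec r hr _ hc j1 j2 ?_
  have ht := trav_spec fam.tr fam_gen.wf (codeW (mkSv fam) (S r)) 1 1 (codeW_lt fam_gen _) []
  rw [List.append_nil] at ht
  have e2 : (sel fam.tr.elems (codeW (mkSv fam) (S r))).map (fun s => (1 + spN s, 1 + rvN s)) =
    (sel fam.tr.elems (codeW (mkSv fam) (S r))).map pr := rfl
  rw [← e2, ← ht]
  exact h2

end Conn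

/-! ## Classification of the unitary elements -/
section Cls
open Classical

noncomputable def sP (a b : ℕ) : ℕ := Nat.land (Nat.add a b) LO
theorem sP_raw (a b O : ℕ) : Nat.land (Nat.add a b) O = (a + b) &&& O := rfl
theorem sP_eq (x y : A) : sP (S x) (S y) = S (x + y) := by
  unfold sP; rw [S_add, ← LO_eq, sP_raw]

theorem S_zero : S 0 = 0 := by
  unfold S ev
  simp [co_zero]

theorem S_one : S 1 = 1 := by
  have := S_X 0
  rw [X_zero] at this
  simpa using this

theorem X1 (i : ℕ) : X 1 ^ i = X (i : Z) := by rw [X_pow]; simp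

theorem X1_45 : X 1 ^ 45 = 1 := by rw [X1]; exact X_zero

noncomputable def tz (b : Bool) (n : ℕ) : ℕ := Bool.rec (motive := fun _ => ℕ) 0 n b

/-- element of the ring from a bit mask -/
noncomputable def elF (f : ℕ → ℕ) (m : ℕ) : ℕ → A :=
  Nat.rec (motive := fun _ => A) 0 (fun i x => x + if m.testBit i then X 1 ^ f i else 0)

noncomputable def spF (f : ℕ → ℕ) (m : ℕ) : ℕ → ℕ :=
  Nat.rec (motive := fun _ => ℕ) 0 (fun i x => sP x (tz (Nat.testBit m i) (Nat.pow 2 (Nat.mul 72 (f i)))))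

theorem spF_succ (f : ℕ → ℕ) (m n : ℕ) :
    spF f m (n + 1) = sP (spF f m n) (tz (Nat.testBit m n) (Nat.pow 2 (Nat.mul 72 (f n)))) := rfl
theorem elF_succ (f : ℕ → ℕ) (m n : ℕ) :
    elF f m (n + 1) = elF f m n + if m.testBit n then X 1 ^ f n else 0 := rfl

theorem spF_eq (f : ℕ → ℕ) (hf : ∀ i, f i < 45) (m n : ℕ) : spF f m n = S (elF f m n) := by
  induction n with
  | zero => exact S_zero.symm
  | succ n ih =>
    rw [spF_succ, elF_succ, ih]
    have e : tz (Nat.testBit m n) (Nat.pow 2 (Nat.mul 72 (f n))) = S (if m.testBit n then X 1 ^ f n else 0) := by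
      cases h : m.testBit n
      · rw [if_neg (by simp), S_zero]; rfl
      · rw [if_pos rfl, X1, S_X, ZMod.val_natCast, Nat.mod_eq_of_lt (hf n)]; rfl
    rw [e, sP_eq]

def f0 (i : ℕ) : ℕ := Nat.mod i 45
def f1 (i : ℕ) : ℕ := Nat.mod (Nat.mul 44 i) 45

noncomputable def el (m : ℕ) : A := elF f0 m 45
noncomputable def sp (m : ℕ) : ℕ := spF f0 m 45
noncomputable def sR (m : ℕ) : ℕ := spF f1 m 45

theorem S_el (m : ℕ) : S (el m) = sp m := (spF_eq f0 (fun i => Nat.mod_lt i (by norm_num)) m 45).symm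

theorem st_elF (m n : ℕ) : st (elF f0 m n) = elF f1 m n := by
  induction n with
  | zero => exact map_zero st
  | succ n ih =>
    change st (elF f0 m n + _) = elF f1 m n + _
    rw [map_add, ih]
    congr 1
    split_ifs
    · rw [X1, X1, st_X]
      congr 1
      change -((n % 45 : ℕ) : Z) = ((44 * n % 45 : ℕ) : Z)
      rw [ZMod.natCast_mod, ZMod.natCast_mod]
      push_cast
      have : (44 : Z) = -1 := by decide
      rw [this]; ring
    · exact map_zero st

theorem S_st_el (m : ℕ) : S (st (el m)) = sR m := by
  unfold el; rw [st_elF]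
  exact (spF_eq f1 (fun i => Nat.mod_lt _ (by norm_num)) m 45).symm

/-- powers -/
noncomputable def foN (n : Nat) (k : Nat → Nat) : Nat :=
  Nat.rec (motive := fun _ => Nat) (k 0) (fun n _ => k (Nat.succ n)) n
theorem foN_eq (n : ℕ) (k : ℕ → ℕ) : foN n k = k n := by cases n <;> rfl

noncomputable def pwS : ℕ → ℕ → ℕ → ℕ :=
  Nat.rec (motive := fun _ => ℕ → ℕ → ℕ) (fun _ _ => 1)
    (fun _ ih x n => foN x fun x => mulS (ih (mulS x x) (Nat.div n 2))
      (Bool.rec (motive := fun _ => ℕ) 1 x (Nat.beq (Nat.mod n 2) 1)))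

theorem pwS_succ (f x n : ℕ) : pwS (f + 1) x n = foN x fun x => mulS (pwS f (mulS x x) (Nat.div n 2))
      (Bool.rec (motive := fun _ => ℕ) 1 x (Nat.beq (Nat.mod n 2) 1)) := rfl

theorem mod_raw (a b : ℕ) : Nat.mod a b = a % b := rfl

theorem pwS_eq (f : ℕ) : ∀ (x : A) (n : ℕ), n < 2 ^ f → pwS f (S x) n = S (x ^ n) := by
  induction f with
  | zero =>
    intro x n hn
    have : n = 0 := by simpa using hn
    subst this
    rw [pow_zero, S_one]; rfl
  | succ f ih =>
    intro x n hn
    rw [pwS_succ, foN_eq]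
    beta_reduce
    rw [div_raw, mod_raw]
    rw [mulS_eq, ih _ _ (by rw [pow_succ] at hn; omega)]
    have h2 := Nat.div_add_mod n 2
    rcases Nat.mod_two_eq_zero_or_one n with h | h
    · rw [h]
      have e0 : (Bool.rec (motive := fun _ => ℕ) 1 (S x) (Nat.beq 0 1)) = 1 := rfl
      rw [e0, ← S_one, mulS_eq, mul_one, ← pow_two, ← pow_mul, show 2 * (n / 2) = n by omega]
    · rw [h]
      have e0 : (Bool.rec (motive := fun _ => ℕ) 1 (S x) (Nat.beq 1 1)) = S x := rfl
      rw [e0, mulS_eq, ← pow_two, ← pow_mul, ← pow_succ, show 2 * (n / 2) + 1 = n by omega]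

/-! the counting lemma -/
theorem mem_span_aux (e : A) (d m : ℕ) (hm : m < 2 ^ d) (h : e * X 1 ^ d = e * el m) (n : ℕ) :
    e * X 1 ^ n ∈ Submodule.span (ZMod 2) (Set.range fun i : Fin d => e * X 1 ^ (i : ℕ)) := by
  induction n using Nat.strong_induction_on with
  | _ n ih =>
    rcases lt_or_ge n d with hn | hn
    · exact Submodule.subset_span ⟨⟨n, hn⟩, rfl⟩
    · obtain ⟨k, rfl⟩ := Nat.exists_eq_add_of_le hn
      have e1 : e * X 1 ^ (d + k) = X 1 ^ k * (e * el m) := by rw [← h, pow_add]; ring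
      rw [e1]
      unfold el
      have key : ∀ j, j ≤ 45 → X 1 ^ k * (e * elF f0 m j) ∈
          Submodule.span (ZMod 2) (Set.range fun i : Fin d => e * X 1 ^ (i : ℕ)) := by
        intro j
        induction j with
        | zero => intro _; change X 1 ^ k * (e * 0) ∈ _; simp
        | succ j ihj =>
          intro hj
          change X 1 ^ k * (e * (elF f0 m j + _)) ∈ _
          rw [mul_add, mul_add]
          refine Submodule.add_mem _ (ihj (by omega)) ?_
          split_ifs with hb
          · have hjd : j < d := by
              by_contra hc
              rw [Nat.testBit_lt_two_pow (lt_of_lt_of_le hm (Nat.pow_le_pow_right (by norm_num) (by omega)))] at hb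
              cases hb
            have e2 : X 1 ^ k * (e * X 1 ^ f0 j) = e * X 1 ^ (k + j) := by
              have : f0 j = j := Nat.mod_eq_of_lt (by omega)
              rw [this, pow_add]; ring
            rw [e2]
            exact ih _ (by omega)
          · simp
      exact key 45 le_rfl

theorem mem_span_all (e : A) (d m : ℕ) (hm : m < 2 ^ d) (h : e * X 1 ^ d = e * el m) (y : A) :
    e * y ∈ Submodule.span (ZMod 2) (Set.range fun i : Fin d => e * X 1 ^ (i : ℕ)) := by
  rw [eq_sum_X y, Finset.mul_sum]
  refine Submodule.sum_mem _ fun i _ => ?_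
  rw [mul_smul_comm]
  refine Submodule.smul_mem _ _ ?_
  have := mem_span_aux e d m hm h i.val
  rwa [X1, ZMod.natCast_zmod_val] at this

theorem pow_fix {e h : A} (hf : (1 + e) * h = 1 + e) (n : ℕ) : (1 + e) * h ^ n = 1 + e := by
  induction n with
  | zero => rw [pow_zero, mul_one]
  | succ n ih => rw [pow_succ, ← mul_assoc, ih, hf]

theorem pow_cancel {e h : A} (hf : (1 + e) * h = 1 + e) {i j : ℕ} (hij : e * h ^ i = e * h ^ j) : h ^ i = h ^ j := by
  have h1 := pow_fix hf i
  have h2 := pow_fix hf j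
  have h3 := CharTwo.add_self_eq_zero e
  have key : ∀ t, h ^ t = (1 + e) * h ^ t + e * h ^ t := by
    intro t
    have : (1 + e) * h ^ t + e * h ^ t = h ^ t + (e + e) * h ^ t := by ring
    rw [this, h3, zero_mul, add_zero]
  rw [key i, key j, h1, h2, hij]

theorem all_pow (e h : A) (d m : ℕ) (hm : m < 2 ^ d) (h1 : e * X 1 ^ d = e * el m)
    (hf : (1 + e) * h = 1 + e) (ho : orderOf h = 2 ^ d - 1) (y : A) (hy : e * y ≠ 0) :
    ∃ n, e * y = e * h ^ n := by
  let g : (Fin d → ZMod 2) → A := fun c => ∑ i, c i • (e * X 1 ^ (i : ℕ))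
  let T : Finset A := Finset.univ.image g
  have hT : ∀ z, e * z ∈ T := by
    intro z
    have := mem_span_all e d m hm h1 z
    rw [Submodule.mem_span_range_iff_exists_fun] at this
    obtain ⟨c, hc⟩ := this
    exact Finset.mem_image.2 ⟨c, Finset.mem_univ _, hc⟩
  have hcard : T.card ≤ 2 ^ d := by
    refine Finset.card_image_le.trans ?_
    simp [ZMod.card]
  let P : Finset A := (Finset.range (2 ^ d - 1)).image fun n => e * h ^ n
  have hP : P.card = 2 ^ d - 1 := by
    rw [Finset.card_image_of_injOn, Finset.card_range]
    intro i hi j hj hij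
    have := pow_cancel hf hij
    rw [← ho] at hi hj
    exact pow_injOn_Iio_orderOf (by simpa using hi) (by simpa using hj) this
  have he : e ≠ 0 := by rintro rfl; simp at hy
  have h0 : (0 : A) ∉ P := by
    intro hc
    obtain ⟨n, hn, hz⟩ := Finset.mem_image.1 hc
    have hn := Finset.mem_range.1 hn
    apply he
    have e1 : e * h ^ n * h ^ (2 ^ d - 1 - n) = e := by
      rw [mul_assoc, ← pow_add, show n + (2 ^ d - 1 - n) = orderOf h by omega, pow_orderOf_eq_one, mul_one]
    rw [← e1]
    change e * h ^ n = 0 at hz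
    rw [hz, zero_mul]
  have hsub : insert 0 P ⊆ T := by
    intro z hz
    rcases Finset.mem_insert.1 hz with rfl | hz
    · have := hT 0; rwa [mul_zero] at this
    · obtain ⟨n, _, rfl⟩ := Finset.mem_image.1 hz
      exact hT _
  have heq := Finset.eq_of_subset_of_card_le hsub (by
    rw [Finset.card_insert_of_notMem h0, hP]
    have := Nat.one_le_two_pow (n := d)
    omega)
  have hm := hT y
  rw [← heq] at hm
  rcases Finset.mem_insert.1 hm with hz | hz
  · exact absurd hz hy
  · obtain ⟨n, _, hn⟩ := Finset.mem_image.1 hz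
    exact ⟨n, hn.symm⟩

theorem unit_ne {r e : A} (hr : r * st r = 1) (he : e ≠ 0) : e * r ≠ 0 := by
  intro h
  apply he
  rw [← mul_one e, ← hr, ← mul_assoc, h, zero_mul]

/-- agreeing on `e` implies agreeing on its conjugate -/
theorem star_agree {r u e : A} (hr : r * st r = 1) (hu : u * st u = 1) (h : e * r = e * u) :
    st e * r = st e * u := by
  have h2 := congrArg st h
  rw [map_mul, map_mul] at h2
  calc st e * r = (st e * st u) * u * r := by rw [mul_assoc (st e), mul_comm (st u), hu, mul_one]
    _ = (st e * st r) * u * r := by rw [h2]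
    _ = st e * u * (r * st r) := by ring
    _ = st e * u := by rw [hr, mul_one]

/-- self conjugate component: only powers of `x` are unitary -/
theorem self_comp (e h : A) (k : ℕ) (N : ℕ) (hse : st e = e) (hf : (1 + e) * h = 1 + e) (ho : orderOf h = k * N)
    (hN : 0 < N) (hh : e * (h * st h) = e * h ^ N) (hx : e * h ^ k = e * X 1)
    (r : A) (hr : r * st r = 1) (n : ℕ) (hn : e * r = e * h ^ n) : ∃ i : ℕ, e * r = e * X 1 ^ i := by
  have h2 := congrArg st hn
  rw [map_mul, map_mul, map_pow, hse] at h2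
  have step : ∀ t, e * (h * st h) ^ t = e * h ^ (N * t) := by
    intro t
    induction t with
    | zero => simp
    | succ t ih => rw [pow_succ, ← mul_assoc, ih, mul_add, pow_add, mul_one, mul_right_comm, hh]; ring
  have h3 : e * h ^ (N * n) = e * h ^ 0 := by
    rw [← step, mul_pow, pow_zero, mul_one, ← mul_assoc, ← hn, mul_right_comm, ← h2, mul_assoc,
      mul_comm (st r), hr, mul_one]
  have h4 := pow_cancel hf h3
  rw [pow_zero] at h4
  have h5 := orderOf_dvd_of_pow_eq_one h4
  rw [ho, mul_comm k] at h5
  obtain ⟨t, rfl⟩ := Nat.dvd_of_mul_dvd_mul_left hN h5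
  refine ⟨t, ?_⟩
  rw [hn]
  clear hn h2 h3 h4 h5
  induction t with
  | zero => simp
  | succ t ih => rw [mul_add, pow_add, ← mul_assoc, ih, mul_one, mul_right_comm, hx, pow_succ]; ring

end Cls

section Cls2
open Classical

theorem mE1 (a b c : ℕ) (h : mulS (sp a) (sp b) = sp c) : el a * el b = el c :=
  S_inj (by rw [← mulS_eq, S_el, S_el, S_el, h])
theorem mE2 (a b c d : ℕ) (h : mulS (sp a) (sp b) = mulS (sp c) (sp d)) : el a * el b = el c * el d :=
  S_inj (by rw [← mulS_eq, ← mulS_eq, S_el, S_el, S_el, S_el, h])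
theorem mEu (a : ℕ) (h : mulS (sp a) (sR a) = 1) : el a * st (el a) = 1 :=
  S_inj (by rw [← mulS_eq, S_el, S_st_el, h, S_one])
theorem mEs (a : ℕ) (h : sR a = sp a) : st (el a) = el a :=
  S_inj (by rw [S_el, S_st_el, h])
theorem mEf (a b : ℕ) (h : mulS (sP 1 (sp a)) (sp b) = sP 1 (sp a)) : (1 + el a) * el b = 1 + el a :=
  S_inj (by rw [← mulS_eq, ← sP_eq, S_el, S_el, S_one, h])
theorem mEp (f a b n m : ℕ) (hn : n < 2 ^ f) (h : mulS (sp a) (pwS f (sp b) n) = mulS (sp a) (sp m)) :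
    el a * el b ^ n = el a * el m :=
  S_inj (by rw [← mulS_eq, ← mulS_eq, ← pwS_eq f _ _ hn, S_el, S_el, S_el, h])
theorem mEn (a b n : ℕ) (hn : n < 2 ^ 4) (h : mulS (sp a) (mulS (sp b) (sR b)) = mulS (sp a) (pwS 4 (sp b) n)) :
    el a * (el b * st (el b)) = el a * el b ^ n :=
  S_inj (by rw [← mulS_eq, ← mulS_eq, ← mulS_eq, ← pwS_eq 4 _ _ hn, S_el, S_el, S_st_el, h])

theorem X1_el : X 1 = el 2 := S_inj (by rw [S_X, S_el]; decide +kernel)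
theorem one_el : (1 : A) = el 1 := S_inj (by rw [S_one, S_el]; decide +kernel)
theorem el_ne (a : ℕ) (h : Nat.beq (sp a) 0 = false) : el a ≠ 0 := by
  intro hc
  have := congrArg S hc
  rw [S_el, S_zero] at this
  rw [this] at h
  cases h

theorem ord_el (a N : ℕ) (l : List ℕ) (hN : 0 < N) (hb : N < 2 ^ 12) (h1 : pwS 12 (sp a) N = 1)
    (hp : ∀ p : ℕ, p.Prime → p ∣ N → p ∈ l)
    (h2 : ∀ p ∈ l, pwS 12 (sp a) (N / p) ≠ 1) : orderOf (el a) = N := by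
  apply orderOf_eq_of_pow_and_pow_div_prime hN
  · apply S_inj; rw [← pwS_eq 12 _ _ hb, S_el, h1, S_one]
  · intro p pp pd hc
    apply h2 p (hp p pp pd)
    have := congrArg S hc
    rwa [S_one, ← pwS_eq 12 _ _ (lt_of_le_of_lt (Nat.div_le_self _ _) hb), S_el] at this

theorem pr_of {p q m : ℕ} {l : List ℕ} (pp : p.Prime) (hq : q.Prime) (h : p ∣ m → p ∈ l) (h2 : p ∣ q * m) : p ∈ q :: l := by
  rcases (Nat.Prime.dvd_mul pp).1 h2 with h3 | h3
  · rw [(Nat.prime_dvd_prime_iff_eq pp hq).1 h3]; exact List.mem_cons_self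
  · exact List.mem_cons_of_mem _ (h h3)

theorem pr_one {p : ℕ} {l : List ℕ} (pp : p.Prime) (h : p ∣ 1) : p ∈ l := absurd (Nat.dvd_one.1 h) pp.ne_one

theorem pow_agree {e h g : A} (hh : e * h = e * g) (n : ℕ) : e * h ^ n = e * g ^ n := by
  induction n with
  | zero => simp
  | succ n ih => rw [pow_succ, pow_succ, ← mul_assoc, ih, mul_right_comm, hh]; ring

theorem pow_fixed {e h : A} (hh : e * h = e) (n : ℕ) : e * h ^ n = e := by
  have := pow_agree (e := e) (h := h) (g := 1) (by rw [hh, mul_one]) n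
  rwa [one_pow, mul_one] at this

noncomputable def E1 : A := el 35184372088831
noncomputable def E3 : A := el 30158033218998
noncomputable def E5 : A := el 34049392344030
noncomputable def E9 : A := el 4957484912712
noncomputable def Ef : A := el 5323774432094
noncomputable def Eg : A := el 68870738504
noncomputable def d3 : A := el 15079016609498
noncomputable def df : A := el 16144201005754
noncomputable def dl : A := el 31138145117550

theorem E_sum : E1 + E3 + E5 + E9 + Ef + st Ef + Eg + st Eg = 1 := by
  apply S_inj
  unfold E1 E3 E5 E9 Ef Eg
  rw [← sP_eq, ← sP_eq, ← sP_eq, ← sP_eq, ← sP_eq, ← sP_eq, ← sP_eq]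
  rw [S_el, S_el, S_el, S_el, S_el, S_el, S_st_el, S_st_el, S_one]
  decide +kernel

theorem u3 : d3 * st d3 = 1 := mEu _ (by decide +kernel)
theorem uf : df * st df = 1 := mEu _ (by decide +kernel)
theorem ul : dl * st dl = 1 := mEu _ (by decide +kernel)

theorem d3_3 : d3 ^ 3 = 1 := by
  have : orderOf d3 = 3 := ord_el _ 3 [3] (by norm_num) (by norm_num) (by decide +kernel)
    (fun p pp h => pr_of pp Nat.prime_three (m := 1) (pr_one pp) h) (by decide +kernel)
  rw [← this]; exact pow_orderOf_eq_one _
theorem df_15 : df ^ 15 = 1 := by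
  have : orderOf df = 15 := ord_el _ 15 [3, 5] (by norm_num) (by norm_num) (by decide +kernel)
    (fun p pp h => pr_of pp Nat.prime_three (m := 5) (pr_of pp Nat.prime_five (m := 1) (pr_one pp)) h) (by decide +kernel)
  rw [← this]; exact pow_orderOf_eq_one _
theorem dl_4095 : dl ^ 4095 = 1 := by
  apply S_inj; unfold dl
  rw [← pwS_eq 12 _ _ (by norm_num), S_el, S_one]
  decide +kernel

theorem all1 (r : A) (hr : r * st r = 1) : E1 * r = E1 := by
  obtain ⟨n, hn⟩ := all_pow E1 1 1 1 (by norm_num)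
    (by rw [X1_el, pow_one]; exact mE2 _ _ _ _ (by decide +kernel)) (mul_one _) (by simp) r
    (unit_ne hr (el_ne _ (by decide +kernel)))
  rw [hn, one_pow, mul_one]

theorem all3 (r : A) (hr : r * st r = 1) : ∃ a, E3 * r = E3 * d3 ^ a :=
  all_pow E3 d3 2 3 (by norm_num) (by rw [X1_el]; exact mEp 4 _ _ _ _ (by norm_num) (by decide +kernel))
    (mEf _ _ (by decide +kernel)) (ord_el _ 3 [3] (by norm_num) (by norm_num) (by decide +kernel)
      (fun p pp h => pr_of pp Nat.prime_three (m := 1) (pr_one pp) h) (by decide +kernel)) r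
    (unit_ne hr (el_ne _ (by decide +kernel)))

theorem all5 (r : A) (hr : r * st r = 1) : ∃ i, E5 * r = E5 * X 1 ^ i := by
  have ho : orderOf (el 17024696172014) = 15 := ord_el _ 15 [3, 5] (by norm_num) (by norm_num) (by decide +kernel)
    (fun p pp h => pr_of pp Nat.prime_three (m := 5) (pr_of pp Nat.prime_five (m := 1) (pr_one pp)) h) (by decide +kernel)
  have hf : (1 + E5) * el 17024696172014 = 1 + E5 := mEf _ _ (by decide +kernel)
  obtain ⟨n, hn⟩ := all_pow E5 (el 17024696172014) 4 15 (by norm_num)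
    (by rw [X1_el]; exact mEp 4 _ _ _ _ (by norm_num) (by decide +kernel)) hf ho r
    (unit_ne hr (el_ne _ (by decide +kernel)))
  exact self_comp E5 (el 17024696172014) 3 5 (mEs _ (by decide +kernel)) hf ho (by norm_num)
    (mEn _ _ _ (by norm_num) (by decide +kernel))
    (by rw [X1_el]; exact mEp 4 _ _ _ _ (by norm_num) (by decide +kernel)) r hr n hn

theorem all9 (r : A) (hr : r * st r = 1) : ∃ i, E9 * r = E9 * X 1 ^ i := by
  have ho : orderOf (el 2478742456357) = 63 := ord_el _ 63 [3, 3, 7] (by norm_num) (by norm_num) (by decide +kernel)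
    (fun p pp h => pr_of pp Nat.prime_three (m := 21) (pr_of pp Nat.prime_three (m := 7)
      (pr_of pp Nat.prime_seven (m := 1) (pr_one pp))) h) (by decide +kernel)
  have hf : (1 + E9) * el 2478742456357 = 1 + E9 := mEf _ _ (by decide +kernel)
  obtain ⟨n, hn⟩ := all_pow E9 (el 2478742456357) 6 9 (by norm_num)
    (by rw [X1_el]; exact mEp 4 _ _ _ _ (by norm_num) (by decide +kernel)) hf ho r
    (unit_ne hr (el_ne _ (by decide +kernel)))
  exact self_comp E9 (el 2478742456357) 7 9 (mEs _ (by decide +kernel)) hf ho (by norm_num)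
    (mEn _ _ _ (by norm_num) (by decide +kernel))
    (by rw [X1_el]; exact mEp 4 _ _ _ _ (by norm_num) (by decide +kernel)) r hr n hn

theorem allf (r : A) (hr : r * st r = 1) : ∃ b, Ef * r = Ef * df ^ b := by
  obtain ⟨n, hn⟩ := all_pow Ef (el 14811646735843) 4 3 (by norm_num)
    (by rw [X1_el]; exact mEp 4 _ _ _ _ (by norm_num) (by decide +kernel)) (mEf _ _ (by decide +kernel))
    (ord_el _ 15 [3, 5] (by norm_num) (by norm_num) (by decide +kernel)
    (fun p pp h => pr_of pp Nat.prime_three (m := 5) (pr_of pp Nat.prime_five (m := 1) (pr_one pp)) h) (by decide +kernel)) r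
    (unit_ne hr (el_ne _ (by decide +kernel)))
  refine ⟨n, hn.trans (pow_agree ?_ n)⟩
  exact mE2 _ _ _ _ (by decide +kernel)

theorem allg (r : A) (hr : r * st r = 1) : ∃ b, Eg * r = Eg * dl ^ b := by
  obtain ⟨n, hn⟩ := all_pow Eg (el 137741477009) 12 9 (by norm_num)
    (by rw [X1_el]; exact mEp 4 _ _ _ _ (by norm_num) (by decide +kernel)) (mEf _ _ (by decide +kernel))
    (ord_el _ 4095 [3, 3, 5, 7, 13] (by norm_num) (by norm_num) (by decide +kernel)
    (fun p pp h => pr_of pp Nat.prime_three (m := 1365) (pr_of pp Nat.prime_three (m := 455)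
      (pr_of pp Nat.prime_five (m := 91) (pr_of pp Nat.prime_seven (m := 13)
      (pr_of (q := 13) pp (by norm_num) (m := 1) (pr_one pp))))) h) (by decide +kernel)) r
    (unit_ne hr (el_ne _ (by decide +kernel)))
  refine ⟨n, hn.trans (pow_agree ?_ n)⟩
  exact mE2 _ _ _ _ (by decide +kernel)

theorem unit_mul {x y : A} (hx : x * st x = 1) (hy : y * st y = 1) : (x * y) * st (x * y) = 1 := by
  rw [map_mul, mul_mul_mul_comm, hx, hy, mul_one]
theorem unit_pow {x : A} (hx : x * st x = 1) (n : ℕ) : (x ^ n) * st (x ^ n) = 1 := by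
  rw [map_pow, ← mul_pow, hx, one_pow]
theorem unit_X1 : X 1 * st (X 1) = 1 := by
  rw [st_X, ← X_add, add_neg_cancel, X_zero]

noncomputable def U (a b n : ℕ) : A := d3 ^ a * df ^ b * dl ^ n

theorem U_unit (a b n : ℕ) : U a b n * st (U a b n) = 1 :=
  unit_mul (unit_mul (unit_pow u3 _) (unit_pow uf _)) (unit_pow ul _)

theorem U_fix (e : A) (h1 : e * d3 = e) (h2 : e * df = e) (h3 : e * dl = e) (a b n : ℕ) : e * U a b n = e := by
  unfold U
  rw [← mul_assoc, ← mul_assoc, pow_fixed h1, pow_fixed h2, pow_fixed h3]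

theorem cls (r : A) (hr : r * st r = 1) : ∃ k a b n, r = X k * U a b n := by
  obtain ⟨i, hi⟩ := all5 r hr
  obtain ⟨j, hj⟩ := all9 r hr
  have h5 : E5 * X 1 ^ (36 * i + 10 * j) = E5 * X 1 ^ i := by
    have p1 : E5 * X 1 ^ 36 = E5 * X 1 := by
      rw [X1_el]; exact mEp 6 _ _ _ _ (by norm_num) (by decide +kernel)
    have p2 : E5 * X 1 ^ 10 = E5 := by
      rw [← mul_one E5, one_el, X1_el, mul_assoc, ← one_el, one_mul, one_el]
      exact mEp 6 _ _ _ _ (by norm_num) (by decide +kernel)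
    rw [pow_add, pow_mul, pow_mul, ← mul_assoc, pow_agree p1, mul_right_comm, pow_fixed p2]
  have h9 : E9 * X 1 ^ (36 * i + 10 * j) = E9 * X 1 ^ j := by
    have p1 : E9 * X 1 ^ 10 = E9 * X 1 := by
      rw [X1_el]; exact mEp 6 _ _ _ _ (by norm_num) (by decide +kernel)
    have p2 : E9 * X 1 ^ 36 = E9 := by
      rw [← mul_one E9, one_el, X1_el, mul_assoc, ← one_el, one_mul, one_el]
      exact mEp 6 _ _ _ _ (by norm_num) (by decide +kernel)
    rw [pow_add, pow_mul, pow_mul, ← mul_assoc, pow_fixed p2, pow_agree p1]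
  generalize 36 * i + 10 * j = k at h5 h9
  have hu : (X 1 ^ (44 * k) * r) * st (X 1 ^ (44 * k) * r) = 1 := unit_mul (unit_pow unit_X1 _) hr
  have hk : X 1 ^ k * X 1 ^ (44 * k) = 1 := by
    rw [← pow_add, show k + 44 * k = 45 * k by ring, pow_mul, X1_45, one_pow]
  have c5 : E5 * (X 1 ^ (44 * k) * r) = E5 := by
    rw [mul_left_comm, hi, ← h5, mul_left_comm, mul_comm (X 1 ^ (44 * k)), hk, mul_one]
  have c9 : E9 * (X 1 ^ (44 * k) * r) = E9 := by
    rw [mul_left_comm, hj, ← h9, mul_left_comm, mul_comm (X 1 ^ (44 * k)), hk, mul_one]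
  have hr' : r = X 1 ^ k * (X 1 ^ (44 * k) * r) := by rw [← mul_assoc, hk, one_mul]
  generalize X 1 ^ (44 * k) * r = s at hu c5 c9 hr'
  have c1 := all1 s hu
  obtain ⟨a, c3⟩ := all3 s hu
  obtain ⟨b, cf⟩ := allf s hu
  obtain ⟨n, cg⟩ := allg s hu
  have hU := U_unit a b n
  refine ⟨k, a, b, n, ?_⟩
  rw [hr', X1]
  refine congrArg (fun z => X (k : Z) * z) ?_
  have k1 : E1 * U a b n = E1 := U_fix _ (mE1 _ _ _ (by decide +kernel)) (mE1 _ _ _ (by decide +kernel)) (mE1 _ _ _ (by decide +kernel)) a b n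
  have k5 : E5 * U a b n = E5 := U_fix _ (mE1 _ _ _ (by decide +kernel)) (mE1 _ _ _ (by decide +kernel)) (mE1 _ _ _ (by decide +kernel)) a b n
  have k9 : E9 * U a b n = E9 := U_fix _ (mE1 _ _ _ (by decide +kernel)) (mE1 _ _ _ (by decide +kernel)) (mE1 _ _ _ (by decide +kernel)) a b n
  have k3 : E3 * s = E3 * U a b n := by
    have t1 : E3 * df = E3 := mE1 _ _ _ (by decide +kernel)
    have t2 : E3 * dl = E3 := mE1 _ _ _ (by decide +kernel)
    rw [c3]; unfold U
    rw [mul_assoc, mul_left_comm, ← mul_assoc E3, pow_fixed t1, pow_fixed t2, mul_comm]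
  have kf : Ef * s = Ef * U a b n := by
    have t1 : Ef * d3 = Ef := mE1 _ _ _ (by decide +kernel)
    have t2 : Ef * dl = Ef := mE1 _ _ _ (by decide +kernel)
    rw [cf]; unfold U
    rw [← mul_assoc, ← mul_assoc, pow_fixed t1, mul_right_comm, pow_fixed t2]
  have kg : Eg * s = Eg * U a b n := by
    have t1 : Eg * d3 = Eg := mE1 _ _ _ (by decide +kernel)
    have t2 : Eg * df = Eg := mE1 _ _ _ (by decide +kernel)
    rw [cg]; unfold U
    rw [← mul_assoc, ← mul_assoc, pow_fixed t1, pow_fixed t2]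
  have kf' := star_agree hu hU kf
  have kg' := star_agree hu hU kg
  rw [← one_mul s, ← one_mul (U a b n), ← E_sum]
  simp only [add_mul]
  rw [c1, k1, c5, k5, c9, k9, k3, kf, kg, kf', kg']

end Cls2

section Walk
open Classical

/-! ### symmetry reduction -/
def AllG (n : ℕ) : Prop := ∀ a b, Good (U a b n)

theorem pow_congr {x : A} {N i j : ℕ} (hx : x ^ N = 1) (h : i ≡ j [MOD N]) : x ^ i = x ^ j := by
  rw [← pow_mod_orderOf x i, ← pow_mod_orderOf x j]
  congr 1
  exact h.of_dvd (orderOf_dvd_of_pow_eq_one hx)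

theorem AllG_congr {n m : ℕ} (h : n ≡ m [MOD 4095]) (hn : AllG n) : AllG m := by
  intro a b
  have := hn a b
  unfold U at this ⊢
  rwa [← pow_congr dl_4095 h]

theorem AllG_two {n : ℕ} (hn : AllG n) : AllG (2 * n) := by
  intro a b
  have h := good_sq _ (hn (2 * a) (8 * b))
  have e : (U (2 * a) (8 * b) n) ^ 2 = U a b (2 * n) := by
    unfold U
    rw [mul_pow, mul_pow, ← pow_mul, ← pow_mul, ← pow_mul, mul_comm n 2]
    rw [pow_congr d3_3 (show 2 * a * 2 ≡ a [MOD 3] by unfold Nat.ModEq; omega),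
      pow_congr df_15 (show 8 * b * 2 ≡ b [MOD 15] by unfold Nat.ModEq; omega)]
  rwa [e] at h

theorem AllG_neg {n : ℕ} (hn : AllG n) : AllG (4094 * n) := by
  intro a b
  refine good_inv _ _ ?_ (hn (2 * a) (14 * b))
  unfold U
  have e : d3 ^ (2 * a) * df ^ (14 * b) * dl ^ n * (d3 ^ a * df ^ b * dl ^ (4094 * n)) =
      (d3 ^ (2 * a) * d3 ^ a) * (df ^ (14 * b) * df ^ b) * (dl ^ n * dl ^ (4094 * n)) := by ring
  rw [e, ← pow_add, ← pow_add, ← pow_add, show 2 * a + a = 3 * a by ring, show 14 * b + b = 15 * b by ring,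
    show n + 4094 * n = 4095 * n by ring, pow_mul, pow_mul, pow_mul, d3_3, df_15, dl_4095]
  simp

theorem AllG_of_lt {n : ℕ} (h : ∀ a < 3, ∀ b < 15, Good (U a b n)) : AllG n := by
  intro a b
  have := h (a % 3) (Nat.mod_lt _ (by norm_num)) (b % 15) (Nat.mod_lt _ (by norm_num))
  unfold U at this ⊢
  rwa [pow_congr d3_3 (Nat.mod_modEq a 3), pow_congr df_15 (Nat.mod_modEq b 15)] at this

/-- mask of the orbit of `n` under doubling and negation -/
noncomputable def orb : ℕ → ℕ → ℕ → ℕ :=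
  Nat.rec (motive := fun _ => ℕ → ℕ → ℕ) (fun _ m => m)
    (fun _ ih n m => foN n fun n => foN m fun m =>
      ih (Nat.mod (Nat.mul 2 n) 4095) (Nat.lor (Nat.lor m (Nat.pow 2 n)) (Nat.pow 2 (Nat.mod (Nat.mul 4094 n) 4095))))

theorem orb_succ (f n m : ℕ) : orb (f + 1) n m = foN n fun n => foN m fun m =>
      orb f (Nat.mod (Nat.mul 2 n) 4095) (Nat.lor (Nat.lor m (Nat.pow 2 n)) (Nat.pow 2 (Nat.mod (Nat.mul 4094 n) 4095))) := rfl

theorem orb_spec (f : ℕ) : ∀ (n m : ℕ), AllG n → (∀ i, m.testBit i = true → AllG i) →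
    ∀ i, (orb f n m).testBit i = true → AllG i := by
  induction f with
  | zero => intro n m _ h; exact h
  | succ f ih =>
    intro n m hn hm
    rw [orb_succ, foN_eq, foN_eq]
    apply ih
    · exact AllG_congr (Nat.mod_modEq _ _).symm (AllG_two hn)
    · intro i hi
      change ((m ||| 2 ^ n) ||| 2 ^ (4094 * n % 4095)).testBit i = true at hi
      rw [Nat.testBit_or, Nat.testBit_or, Nat.testBit_two_pow, Nat.testBit_two_pow] at hi
      simp only [Bool.or_eq_true, decide_eq_true_eq] at hi
      rcases hi with (hi | rfl) | rfl
      · exact hm i hi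
      · exact hn
      · exact AllG_congr (Nat.mod_modEq _ _).symm (AllG_neg hn)

noncomputable def orbs (l : List (ℕ × ℕ)) : ℕ → ℕ :=
  List.rec (motive := fun _ => ℕ → ℕ) (fun m => m) (fun x _ ih m => foN m fun m => ih (orb 12 x.1 m)) l

theorem orbs_cons (x : ℕ × ℕ) (l : List (ℕ × ℕ)) (m : ℕ) : orbs (x :: l) m = foN m fun m => orbs l (orb 12 x.1 m) := rfl

theorem orbs_spec (l : List (ℕ × ℕ)) : ∀ m, (∀ x ∈ l, AllG x.1) → (∀ i, m.testBit i = true → AllG i) →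
    ∀ i, (orbs l m).testBit i = true → AllG i := by
  induction l with
  | nil => intro m _ h; exact h
  | cons x l ih =>
    intro m hl hm
    rw [orbs_cons, foN_eq]
    exact ih _ (fun y hy => hl y (List.mem_cons_of_mem _ hy)) (orb_spec 12 _ _ (hl x List.mem_cons_self) hm)

/-! ### the checks -/
noncomputable def rdW : ℕ → ℕ → ℕ → ℕ :=
  Nat.rec (motive := fun _ => ℕ → ℕ → ℕ) (fun x _ => x)
    (fun _ ih x q => ih (sP x (Nat.pow 2 (Nat.mul 72 (f0 (Nat.mod q 64))))) (Nat.div q 64))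

theorem rdW_spec (c : ℕ) : ∀ (x : A) (q : ℕ), ∃ y : A, rdW c (S x) q = S y := by
  induction c with
  | zero => intro x q; exact ⟨x, rfl⟩
  | succ c ih =>
    intro x q
    have e : rdW (c + 1) (S x) q = rdW c (sP (S x) (Nat.pow 2 (Nat.mul 72 (f0 (Nat.mod q 64))))) (Nat.div q 64) := rfl
    have e2 : Nat.pow 2 (Nat.mul 72 (f0 (Nat.mod q 64))) = S (X ((q % 64 : ℕ) : Z)) := by
      rw [S_X, ZMod.val_natCast]; rfl
    rw [e, e2, sP_eq]
    exact ih _ _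

noncomputable def low (w sr : ℕ) : Bool :=
  an (Nat.ble 1 (Nat.mod w m72)) (Nat.ble (Nat.add (Nat.mod w m72) (Nat.mod (mulS w sr) m72)) 13)

theorem low_spec (y r : A) (h : low (S y) (S r) = true) : Good r := by
  obtain ⟨h1, h2⟩ := an_spec h
  have h1 := Nat.le_of_ble_eq_true h1
  have h2 := Nat.le_of_ble_eq_true h2
  rw [mulS_eq, mod_raw, mod_raw, m72_eq, S_wt, S_wt] at h2
  rw [mod_raw, m72_eq, S_wt] at h1
  refine good_of_low r y ?_ (Nat.lt_succ_of_le h2)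
  rintro rfl
  have : wt 0 = 0 := by simp [wt, co_zero]
  omega

noncomputable def ent (V : Sv) (sr srs q : ℕ) (k : ℕ → Bool) : Bool :=
  fo (Nat.mod q 8) fun t => fo (Nat.div q 8) fun q =>
    Nat.rec (motive := fun _ => Bool) (an (autChk V sr srs 0 1) (k q))
      (fun t _ => Bool.rec (motive := fun _ => Bool)
        (fo (rdW t 1 q) fun w => an (low w sr) (k (Nat.div q (Nat.pow 64 t))))
        (an (autChk V sr srs (Nat.mod q 64) (Nat.mod (Nat.div q 64) 64)) (k (Nat.div q 4096)))
        (Nat.beq t 6)) t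

theorem ent_spec (r : A) (hr : r * st r = 1) (q : ℕ) (k : ℕ → Bool)
    (h : ent (mkSv fam) (S r) (S (st r)) q k = true) : Good r ∧ ∃ q', k q' = true := by
  unfold ent at h
  rw [fo_eq, fo_eq] at h
  generalize Nat.mod q 8 = t at h
  cases t with
  | zero =>
    obtain ⟨h1, h2⟩ := an_spec h
    exact ⟨autChk_spec r hr _ _ h1, _, h2⟩
  | succ t =>
    dsimp only at h
    generalize Nat.beq t 6 = u at h
    cases u with
    | true =>
      obtain ⟨h1, h2⟩ := an_spec h
      exact ⟨autChk_spec r hr _ _ h1, _, h2⟩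
    | false =>
      dsimp only at h
      rw [fo_eq] at h
      obtain ⟨h1, h2⟩ := an_spec h
      refine ⟨?_, _, h2⟩
      have := rdW_spec t 1 (Nat.div q 8)
      rw [S_one] at this
      obtain ⟨y, hy⟩ := this
      rw [hy] at h1
      exact low_spec y r h1

/-- fixed data for a walk -/
structure Fx where
  V : Sv
  w1 : ℕ
  w2 : ℕ
  w3 : ℕ
  p3 : ℕ
  q3 : ℕ
  pf : ℕ
  qf : ℕ

structure Fx.Ok (F : Fx) : Prop where
  V : F.V = mkSv fam
  w1 : ∃ y, F.w1 = S y
  w2 : ∃ y, F.w2 = S y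
  w3 : ∃ y, F.w3 = S y
  p3 : F.p3 = S d3
  q3 : F.q3 = S (st d3)
  pf : F.pf = S df
  qf : F.qf = S (st df)

noncomputable def orr (a x y : Bool) : Bool := Bool.rec (motive := fun _ => Bool) x y a
theorem orr_spec {a x y : Bool} (h : orr a x y = true) : (a = true ∧ y = true) ∨ x = true := by
  cases a
  · exact .inr h
  · exact .inl ⟨rfl, h⟩

noncomputable def stp (F : Fx) (sr srs q : ℕ) (k : ℕ → Bool) : Bool :=
  orr (low F.w1 sr) (orr (low F.w2 sr) (orr (low F.w3 sr) (ent F.V sr srs q k) (k q)) (k q)) (k q)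

theorem stp_spec (F : Fx) (hF : F.Ok) (r : A) (hr : r * st r = 1) (q : ℕ) (k : ℕ → Bool)
    (h : stp F (S r) (S (st r)) q k = true) : Good r ∧ ∃ q', k q' = true := by
  unfold stp at h
  obtain ⟨y1, h1⟩ := hF.w1
  obtain ⟨y2, h2⟩ := hF.w2
  obtain ⟨y3, h3⟩ := hF.w3
  rw [h1, h2, h3] at h
  rcases orr_spec h with ⟨e, e'⟩ | h
  · exact ⟨low_spec _ _ e, _, e'⟩
  rcases orr_spec h with ⟨e, e'⟩ | h
  · exact ⟨low_spec _ _ e, _, e'⟩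
  rcases orr_spec h with ⟨e, e'⟩ | h
  · exact ⟨low_spec _ _ e, _, e'⟩
  rw [hF.V] at h
  exact ent_spec r hr q k h

noncomputable def wkA (F : Fx) (k : ℕ → Bool) : ℕ → ℕ → ℕ → ℕ → Bool :=
  Nat.rec (motive := fun _ => ℕ → ℕ → ℕ → Bool) (fun _ _ q => k q)
    (fun _ ih p ps q => fo p fun p => fo ps fun ps => fo q fun q =>
      stp F p ps q fun q => ih (mulS p F.p3) (mulS ps F.q3) q)

theorem wkA_succ (F : Fx) (k : ℕ → Bool) (m p ps q : ℕ) : wkA F k (m + 1) p ps q =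
    fo p fun p => fo ps fun ps => fo q fun q => stp F p ps q fun q => wkA F k m (mulS p F.p3) (mulS ps F.q3) q := rfl

theorem wkA_spec (F : Fx) (hF : F.Ok) (k : ℕ → Bool) (m : ℕ) : ∀ (r : A), r * st r = 1 → ∀ q,
    wkA F k m (S r) (S (st r)) q = true → (∀ a < m, Good (r * d3 ^ a)) ∧ ∃ q', k q' = true := by
  induction m with
  | zero => intro r _ q h; exact ⟨fun a ha => absurd ha (Nat.not_lt_zero a), q, h⟩
  | succ m ih =>
    intro r hr q h
    rw [wkA_succ, fo_eq, fo_eq, fo_eq] at h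
    obtain ⟨h1, q', h2⟩ := stp_spec F hF r hr q _ h
    rw [hF.p3, hF.q3, mulS_eq, mulS_eq, ← map_mul] at h2
    obtain ⟨h3, h4⟩ := ih _ (unit_mul hr u3) _ h2
    refine ⟨fun a ha => ?_, h4⟩
    cases a with
    | zero => rwa [pow_zero, mul_one]
    | succ a => rw [pow_succ', ← mul_assoc]; exact h3 a (by omega)

noncomputable def wkB (F : Fx) : ℕ → ℕ → ℕ → ℕ → Bool :=
  Nat.rec (motive := fun _ => ℕ → ℕ → ℕ → Bool) (fun _ _ _ => true)
    (fun _ ih p ps q => fo p fun p => fo ps fun ps =>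
      wkA F (fun q => ih (mulS p F.pf) (mulS ps F.qf) q) 3 p ps q)

theorem wkB_succ (F : Fx) (m p ps q : ℕ) : wkB F (m + 1) p ps q =
    fo p fun p => fo ps fun ps => wkA F (fun q => wkB F m (mulS p F.pf) (mulS ps F.qf) q) 3 p ps q := rfl

theorem wkB_spec (F : Fx) (hF : F.Ok) (m : ℕ) : ∀ (r : A), r * st r = 1 → ∀ q,
    wkB F m (S r) (S (st r)) q = true → ∀ a < 3, ∀ b < m, Good (r * df ^ b * d3 ^ a) := by
  induction m with
  | zero => intro r _ q _ a _ b hb; exact absurd hb (Nat.not_lt_zero b)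
  | succ m ih =>
    intro r hr q h
    rw [wkB_succ, fo_eq, fo_eq] at h
    obtain ⟨h1, q', h2⟩ := wkA_spec F hF _ 3 r hr q h
    rw [hF.pf, hF.qf, mulS_eq, mulS_eq, ← map_mul] at h2
    have h3 := ih _ (unit_mul hr uf) _ h2
    intro a ha b hb
    cases b with
    | zero => rw [pow_zero, mul_one]; exact h1 a ha
    | succ b => rw [pow_succ', ← mul_assoc r]; exact h3 a ha b (by omega)

noncomputable def rws (F : Fx) (pl ql : ℕ) (l : List (ℕ × ℕ)) : Bool :=
  List.rec (motive := fun _ => Bool) true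
    (fun x _ ih => an (an (Nat.ble x.1 4095) (wkB F 15 (pwS 12 pl x.1) (pwS 12 ql x.1) x.2)) ih) l

theorem rws_cons (F : Fx) (pl ql : ℕ) (x : ℕ × ℕ) (l : List (ℕ × ℕ)) : rws F pl ql (x :: l) =
   an (an (Nat.ble x.1 4095) (wkB F 15 (pwS 12 pl x.1) (pwS 12 ql x.1) x.2)) (rws F pl ql l) := rfl

theorem rws_spec (F : Fx) (hF : F.Ok) (l : List (ℕ × ℕ)) (h : rws F (S dl) (S (st dl)) l = true) :
    ∀ x ∈ l, AllG x.1 := by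
  induction l with
  | nil => intro x hx; cases hx
  | cons y l ih =>
    rw [rws_cons] at h
    obtain ⟨h1, h2⟩ := an_spec h
    obtain ⟨h0, h1⟩ := an_spec h1
    have h0 := Nat.le_of_ble_eq_true h0
    intro x hx
    rcases List.mem_cons.1 hx with rfl | hx
    · have hlt : x.1 < 2 ^ 12 := lt_of_le_of_lt h0 (by norm_num)
      rw [pwS_eq 12 _ _ hlt, pwS_eq 12 _ _ hlt, ← map_pow] at h1
      have := wkB_spec F hF 15 _ (unit_pow ul _) _ h1
      refine AllG_of_lt fun a ha b hb => ?_
      have h3 := this a ha b hb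
      unfold U
      rwa [mul_comm (d3 ^ a * df ^ b), mul_comm (d3 ^ a), ← mul_assoc]
    · exact ih h2 x hx

noncomputable def mainChk (l : List (ℕ × ℕ)) : Bool :=
  fo (sp 35434561569) fun w1 => fo (sp 68853957121) fun w2 => fo (sp 9663971337) fun w3 =>
  fo (sp 15079016609498) fun a1 => fo (sR 15079016609498) fun a2 =>
  fo (sp 16144201005754) fun a3 => fo (sR 16144201005754) fun a4 =>
  fo (sp 31138145117550) fun a5 => fo (sR 31138145117550) fun a6 =>
  rws ⟨mkSv fam, w1, w2, w3, a1, a2, a3, a4⟩ a5 a6 l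

theorem ok_mk {w1 w2 w3 : ℕ} (y1 y2 y3 : A) (h1 : w1 = S y1) (h2 : w2 = S y2) (h3 : w3 = S y3) {a b c d : ℕ}
    (ha : a = S d3) (hb : b = S (st d3)) (hc : c = S df) (hd : d = S (st df)) {V : Sv} (hV : V = mkSv fam) :
    Fx.Ok ⟨V, w1, w2, w3, a, b, c, d⟩ := ⟨hV, ⟨_, h1⟩, ⟨_, h2⟩, ⟨_, h3⟩, ha, hb, hc, hd⟩

theorem mainChk_spec (l : List (ℕ × ℕ)) (h : mainChk l = true) : ∀ x ∈ l, AllG x.1 := by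
  unfold mainChk at h
  rw [fo_eq, fo_eq, fo_eq, fo_eq, fo_eq, fo_eq, fo_eq, fo_eq, fo_eq] at h
  have e1 : sp 31138145117550 = S dl := (S_el _).symm
  have e2 : sR 31138145117550 = S (st dl) := (S_st_el _).symm
  rw [e1, e2] at h
  exact rws_spec _ (ok_mk (el 35434561569) (el 68853957121) (el 9663971337) (S_el _).symm (S_el _).symm (S_el _).symm
    (S_el _).symm (S_st_el _).symm (S_el _).symm (S_st_el _).symm rfl) l h

theorem tb_raw (n i : ℕ) (h : i < n) : (Nat.sub (Nat.pow 2 n) 1).testBit i = true := by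
  have : Nat.sub (Nat.pow 2 n) 1 = 2 ^ n - 1 := rfl
  rw [this, Nat.testBit_two_pow_sub_one]
  exact decide_eq_true h

theorem all_good (l : List (ℕ × ℕ)) (hl : ∀ x ∈ l, AllG x.1) (hm : Nat.beq (orbs l 0) (Nat.sub (Nat.pow 2 4095) 1) = true)
    (r : A) (hr : r * st r = 1) : Good r := by
  obtain ⟨k, a, b, n, rfl⟩ := cls r hr
  apply good_shift
  have h : AllG (n % 4095) := by
    apply orbs_spec l 0 hl
    · intro i hi; rw [Nat.zero_testBit] at hi; cases hi
    · rw [Nat.eq_of_beq_eq_true hm]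
      exact tb_raw _ _ (Nat.mod_lt _ (by norm_num))
  exact AllG_congr (Nat.mod_modEq _ _) h a b

end Walk

/-! ## The data -/
section Data
open Classical

def l0 : List (ℕ × ℕ) := [(0, 5324248364424140945728684205994325056222330),
 (1, 3763096670689727524971649190956765381064363593613613086180261741321762989797741907813867118536104618816883801161126383150),
 (3, 21139878251725308560715988572487115192608325096137824344313980755136735621030080630167206179432),
 (5, 3304362330449503165265183583308891727203225506296658854048943233764337046946803842172848407424),
 (7, 12681511285801449641915651012349692449740295083434297739351747530357607903805616)]
def l1 : List (ℕ × ℕ) := [(9, 631922007525352239277398571464479084102400187396471098884958273101227958112503198241287746718038468391116326),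
 (11, 13593234866636989502660936832588086680915058324635199027724501954134070418780989969041422),
 (13, 1535285867896028097119595262188365795936333728096214877996869624806758642644649137880895192261944368396738889320512983907786649220963886131159142),
 (15, 9202568004407965155729367234781049578461611408772540157206219342655562315484425009972608451939441169585326470691810714367793726),
 (17, 13077594209924009150890294580595737840547326393325593713305214148740630)]
def l2 : List (ℕ × ℕ) := [(19, 10333897605032962025044206072875133619804992976418735480737931521677924500025456),
 (21, 18026217586029776216208081988543543170090477227996884322512503890149481046428334905321124510864360771410955997770048713857574),
 (23, 12795552650590513488076565364759676192764425629546877215196716021994776978869904297674295968691987852329200),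
 (25, 2588503136946022632535142854125800011348052459035031709912431149504034744031624382553897868081318449373558581309),
 (27, 1283286851793739787721057448380280992119600553747727295773303454573049059038179813943128683020552755304360487735158215222010032),
 (29, 813906063022733899722620552824040790851836175197539222319592215923797995612653323705466921159694068442658796235769835776613453),
 (31, 284550844930171869724016681974062109709278510645980011182191002935665118768868803856443563418568945558127503116977162669407783386782465124025063772206)]
def l3 : List (ℕ × ℕ) := [(33, 2779125639329433849284575435185240187688222787147244858954686710029446485019135769414520541765),
 (35, 4390688477507012118008158443331572762244584342813112235542756862533578069319813371625390721528989802449310521879410710574),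
 (37, 67994116049708835192490194470860212429340311225025323468864552959742077890818795951956500645500017924390267357418160852161298242184968123630449204973013013),
 (39, 208731696802834767592944454992332354932208923378935245103976793960450855763252671272060877043217727653918),
 (41, 20769411848766892134610414132688916936360610777070802629272779530610797478579729051311466322127624354168343559534964750748385180323255152688166238294550),
 (43, 88472525813312109439033021071865065382500277280541845746872749341545773741897717053955864890173050771939393303111671179361310568085648848518430556305230886),
 (45, 547975602851740368123273569950732344650622464610624546621891236349985715808796854683152036486256659998),
 (47, 167710228691873831323132764932893863225033651361509901054381378708550368484280676643258797897336344069233960666532561837056)]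
def l4 : List (ℕ × ℕ) := [(49, 18015112822511608597325018037171205654630864210348893206537524852570209323890828071077642684744612888246039747307379689434749931924062),
 (51, 54718343986631482861404092507526643923409408946728702019981214199657913154633374699793998015737744970973219840),
 (53, 16946119960563771627956956540249962916903412023975170612030620175818099778075606766376614534837143784895183924397991794287419343158010716587542),
 (55, 467170168764978462992871876087705088861431881986335952217665341094864974132028127188856982946173777664701496842395291710),
 (57, 1233177010025475018255534950649733897677669736963426399044290916395156841189616),
 (59, 971516583249189810296288127792408139746529618875763839409916407662157673616164128030072363660183054)]
def l5 : List (ℕ × ℕ) := [(61, 63642984822855436096874357299995411201739958942416204834724071848947717728472132422290878658386685156429791418365022768),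
 (63, 1482577587796387883523968399652908334453709063270080734000112413867682345640584622302286190469342728354600987520816835309371090914204449543590934),
 (65, 211283071496366891553368061186722617522701699137322594621874015440398),
 (67, 7897243254020057205114314992154089093658347658224456341151750287863055158107097844593881914803236376406303964088676037326800398),
 (69, 88646923555328564893419976683363838719836918442529236814391166490987428441956440374761392152772638734269172525868488071642731048837238292405064205),
 (71, 900435611751246131958896821135210413740231029730675643681917571502165216388763329099072048345031749)]
def l6 : List (ℕ × ℕ) := [(73, 479304945912956234346333169148963217997471412941154779297674850052881348566301148947234950174),
 (75, 214525795310186401102830422403906727986452601248484879138476055611824149263631931670007815981517063567625032323240),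
 (77, 1753433959938261494228433288745346214361628044052822454932707915084448480499100016675366),
 (79, 3434988738736025353975798470667751823378745555440668382693609648185973125254247711313859680334)]
def l7 : List (ℕ × ℕ) := [(81, 1065646284119015146535496070967389219507741693145720070389577768383020222394553170561045),
 (83, 1235465580664081275923042401676401479120577757794569054957940736155576622083145154853543504168347714983966),
 (85, 11055014283907190075701608985683044650595711800329209960278398598518512733),
 (87, 84797433181548571466408902528842520652379111340593316730840910772457484740248939441230440),
 (89, 94704198553773059671530712121639431134401422567536765160462389885517305703948088751413003841422065459002829995077210551611476187995243695508245718896187454),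
 (91, 53011752530597044819058483346407214624097262494126502076791060330176579127540728709030372008967020108)]
def l8 : List (ℕ × ℕ) := [(93, 53115136413403250601744048923762109301714380613881541927970394333758872640979012559410251098139302486),
 (95, 261967613710879900212480169835387385988774837905173209849396269649058799629025555469478282742384734378036315992655671790102),
 (97, 25757223105273486342574621785139572125758906515050814815190697530084091709012657316672025251955358988858089138898657781299933359349039631315304796457510),
 (99, 50998927740458612329716034440224650747471202090675396852628232697461897431591504939106373373608395632),
 (101, 1583032420843897771369876288147778370179149325950333381295012233885021256405625155217074128926)]
def l9 : List (ℕ × ℕ) := [(103, 262213638505671557265656249185000849323360978703299159829881955616348641596686249405089348378792),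
 (105, 270814037220131558279993340110513370572315729483420272441174682829660627884902868958587642124365),
 (107, 5866847520295240744534386393046224858216435323860264910030458633901261399108348688584337220906217700249124095323103946299007108203008166935831055893),
 (109, 88587662889499903177440819642616391735997140451376432857361231937351510703271463809985579490834278952726308471571922277731398146880381756860077086),
 (111, 418196976142640189829655691182602640792867674909068880452139499085228998877460362121894261264046545228417438922303350160809143902248437588695618141443196787806),
 (113, 55234564351275608843730571386799931970456248127136018227157112158628719397547447826108960120180580464),
 (115, 3970483896816599100249392977945827594893183066908012752310420746297658529782003127577041645115949193229)]
def l10 : List (ℕ × ℕ) := [(117, 14633898391260965579678496378878390676281871588293730668327383140961191096643300430775024),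
 (119, 45065563768330151088046009531492366726790901384868616092409298297325471399239400420222810453387146438467846144),
 (121, 55023853508210937974405319505971451303422879650753813583092655740920341106610470122340871769663311406),
 (123, 13906020918198739402385868636143916613240489449580402114881874366588580151022968438281316353524121750744150)]
def l11 : List (ℕ × ℕ) := [(133, 262221050007708287809437135894961169222936343508033057994213838005250255387559598062783093501049452937328),
 (135, 76041019237621314657997274294945725638128399690223316129940610695191161204959465208566843009136358171531873310),
 (137, 14543097148769740286179869040682420109329244922341131264032310972350633512692091330154406342840482722517022),
 (139, 1886915606625114852287290541462838583631432211179991726530250466353936351666669883141778032527374)]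
def l12 : List (ℕ × ℕ) := [(141, 777013231985226612440900700229996933286897690638680706522896104001692139834301609365837141822680888888465280),
 (143, 29566072026743747897148246962257498026029591198441521394791936251524452714270259929562116199494),
 (145, 3939741023808933535966111163820826629932402758640110097655768122498698102763695130741375756081688903611713378406168238571848985134712100414),
 (147, 177153634958477622376167671628413038169304262482758618821900001314688)]
def l13 : List (ℕ × ℕ) := [(149, 14552487973593731132845790459082813250938705833347935152245547448527774067877652217300997848606550790873142),
 (151, 1329268927554155913680300748388681489577815485045664795040619445853692338950377899388871667131100052800770290431627172519317840961067075042502952402653734),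
 (153, 13305354724352742101595431821354663128629020314983665410254844283370142536908946376037171309894627911900269),
 (155, 16866836175874260848099470567797328240985740857253355382192555550144806407277522267302770945315754767071238999510046),
 (157, 836070071923959505831465109063758612836805378725427542677901083464400548263150064),
 (163, 19246241950320543416649494457385869690975986174234193173624688012618737789630485856426078770871693693977147637776406974150646799034390547893294),
 (165, 291019789335605668195979818180087091347573489523295025950727515255700374896865515628098800153053969784475767570736),
 (167, 302804523305627340251920759355819781438357586395351363621716625359232834960548743863729656178528054212031630246272039588916)]
def l14 : List (ℕ × ℕ) := [(169, 2421052710255972134844264420072562744201533052639961189640454489520466726633106393338514855633155307492167383572584),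
 (171, 835561553246017472025033836646471395548661032629130078005245642212505510356719449403395937317910540757652495103790606),
 (173, 390271812617399254457230707521411164758130539894669935667095681567530667284754996121150019975017885120391918595154832840996298495876567681496922203059055401006),
 (175, 269859384308881610861886830475588106150389242188768699506074485489090897145299515951527820186129213867430076066103708645371925047836),
 (177, 3434318218358175033262834800201342440301554176502090758754494934340635892947246595589878531625918920181075204685940030614969174292034612739233517606),
 (179, 20166195671781835142778091459676511448174448358994631649456452031069984215136840750453642224913714146916716089429815359283654235325964),
 (181, 79424615127929632290871786702331378357851177798808481246206480260108258631127956989908604814105777677435091609025124686664927254),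
 (183, 4261037323047341701596470619962072989211988228869665001593902330646640508566825189333425253963437165022440874352),
 (185, 84752106495452250996725704200347284316063360262451157527086119267288988832446785464263201501532278442644535885381825320343113960)]
def l15 : List (ℕ × ℕ) := [(187, 272746272410869998680891952108247487746084543791855592957971992680140365520927159735463633479105921129022),
 (189, 4458593993680283579134649684521896625690104520884232293636326981824404614876611636431303256302469383621791310232643224593358726125359194523306528302),
 (195, 214356437088512969363971575595635982612865749789946927920273610682500498320770201119425086256465007965762516459556),
 (197, 60152003023777846773804299005627843682920528073178375948846551650798278167224224422825313423001729624963505560279250646139930633509595695075073613),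
 (199, 64186497698644089669854364559589423603813313296083949932887530410167617449797846702471230839899086912203104310),
 (201, 129126214703940591212090239381220789508227848457112078924169978775054)]
def l16 : List (ℕ × ℕ) := [(203, 6931509701712162278624514660285486036158261136611749497109646202416690576391323342906852736),
 (205, 8677173307467419542469640057615665306529940805611590388873760260404426913477684624697870105009960687373217453971769183668246),
 (207, 16791394002154540407954261198112678701007012480364446807623932008217937099051809476319107877296434113733168),
 (209, 414355022443524663931806284292695304431123798149654424658676906576296519298164724758)]
def l17 : List (ℕ × ℕ) := [(211, 1487544028756473654277273755185732110717636024189703904934122998325176048634121623363124145480368),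
 (213, 55838023638016846061468037018145859279119487095837756707832880854954253603917770868359962680),
 (215, 348554421253779874709666595170751446104500490298294788564044865785842757340819479778225204474488130815696241623236484326114115927781510292516),
 (217, 456856182363563149712545963508057035308490005782798776193639063996321534391793397968041661395456929795687324758),
 (219, 18107038431368388072600292274164246172645825332269898293460863159047094195571100708955439614386757254071473497756336)]
def l18 : List (ℕ × ℕ) := [(221, 52349585054589860316451864093901886073559742984981405877811034506433711530814989415391270),
 (227, 4152569944720382929523221919689158561455243939963470866229415179432713752183688579714401122183950820610760940582347024933738960844367235094),
 (229, 281321603719144135749010544806626253875335058156136091376066108935147324598820069926657427221125427292668452207030081916437),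
 (231, 1451419837425441446449133555947906778754628626656029859834923432170179543259590172371978),
 (233, 32249306513215770694238255477563007031920901915557416073782711231543071408)]
def l19 : List (ℕ × ℕ) := [(235, 144707086938622592209810830559054930284989001588185189388904731286048094880522808089339970669944417227344793156818446),
 (237, 13495259531745251175380742780238711901883596246502500839780480658576934),
 (239, 32706886934200196390042449947648260801613556846217311727790614878151311125560080400052993270469447857166798785886522200176),
 (273, 5324248364424140945728684205994325056222330),
 (275, 45363946549210046246832780305667793784463098057296006177087390249211392424912080141093474672)]
def l20 : List (ℕ × ℕ) := [(277, 2093456035301883802730861290871140340211222053400769267169751809173174613709962864917218731858534),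
 (279, 4112684268967843116862367879586406953039909484271741003882783158731782585136366467021987424042163378048),
 (281, 477665337161833510136169165519850912263282809528126191224767313990394137288450664),
 (283, 80889538584343289637568138726493473348731188920562694488305086389891672844781871430911903027544609130914646400),
 (285, 1533617461162720964124610819016762864989468935771379958748768983783338413889637224620844283460296106526729921669752475741945962431524329507755069)]
def l21 : List (ℕ × ℕ) := [(291, 17442669620210652921949099053390103634996461925309521019418730990670813198067323653348328765431878122280637526869007),
 (293, 7485514513769767111020451529039921224148487782889927882021986526166260312254246167636890604293302326),
 (295, 6075711521199966496422372075060304757537170673225012241203321461963794169639847102293275382710879799590012303375621536089475882705153040909966251534),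
 (297, 68715540056499697915771431858699976155275821447835659769153594850219586831196291535796776630103999790218913129976466890365114941),
 (299, 228163096121599453490218756925121857919211662513366249394125843046136611004603077173838)]
def l22 : List (ℕ × ℕ) := [(301, 92387627532607639104420157740701801691508488721640484861202044486943155634910700962582038),
 (307, 279714785898867568333161006583260745034186231623611706226164109196032094207089686196669717642265878816106905932697874718861550168678),
 (309, 17807564858730304145796390779761308046991223552566626140077283427919805141692832750389288499878940),
 (311, 1275231010567328904796549241155807568801297852564829347844545016052746212345070264039264938241883436011847868330263648708010195241920663015203690941100676),
 (313, 891679061586192781318641173111776627740766950868272758390045766070138619480524428400123228716584398887104880),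
 (315, 63883029377309008091170482490541545657746881941416619308645385923252275365571893208624850777726319034582832876521957429),
 (325, 311311234097932472182508222142056561018655358749727554709060599392439400539380366946235214990530273219428022229006)]
def l23 : List (ℕ × ℕ) := [(327, 259531441210412660717339257887815506621139589068592363551044471231910813126094883575894743061772440898642812996378233746416),
 (329, 13008421161244479802927815528765562751988933097186262069913518157277826548595559802212854811594624),
 (331, 76081136984968822216594617797043218676753881619133750514803678909962272973044367468234650418451062281956520112),
 (333, 3659623447947315535905607803714358019814125594068587729441760867151394544497040306986182397552589698472222695792),
 (339, 18014995805850311967254126385452428994874295777720251923505351456962576429215085933377463756386670825857418942740234534232702),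
 (341, 14060376149871580395925397047227042933345138094320632369455986847293156583355012867946820808896922307986575439380894762603566)]
def l24 : List (ℕ × ℕ) := [(343, 6478055414251469834237035453153530377039235168785266023015959563737586594074907312),
 (345, 1043068398952556103617083628459412805293696902946712248452902732458118807970056200829859855234632773897362501),
 (347, 1984265818804278582537757872124162467461279826889743441627249808988623910664615227110938286101)]
def l25 : List (ℕ × ℕ) := [(349, 56545803097702074316674650902513524417998812465014954513135898638),
 (355, 28134543886957717696846799886379646695846598627654756731370508242561929654999311795857546379223393647922751918142546540849185443873779808135115117796942),
 (357, 69968487551804393087264110083956399645293782632226799198742976435157445956206478462852788233695204875750950044179526),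
 (359, 14618971622776620199215767248059702862665245189357744436337792067351228279600001718134302),
 (361, 25627523428131788818916470370239495749255707497974855380941076653629756435022593077863994436691465644571265981721053002779757991668456604930513717135886)]
def l26 : List (ℕ × ℕ) := [(363, 479653422200506384258644860999656378170563441987995072948786542565893303266570022966711100815618444160),
 (365, 1114034512964211273545649658535511254421971393539754753563138998127114338686282209044480153991237926233065025672513459210329613),
 (371, 1008352835225608724392350763286794594885346314185360209297625440764084369358613175128624),
 (397, 4733720747011081048394109464554740938003173857775361073092600952099913009204474339521411981924936135761469401116841348134),
 (403, 19924676007431958192989454359966985115906476125079237257618388675755470807475650745517148657093431596316293304329186168447408240996032714649174343651902),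
 (405, 993161026972224922096477072104970792688744857002450778253725381456114507387349152589720180650621987401994048769362966),
 (407, 74484872062668684598090891880158632188894829681110128915106849729696032669478573755320785117460052645629032563429132607499884)]
def l27 : List (ℕ × ℕ) := [(409, 758851640211618762251635525289611766883397676369574709393991351400871492187885711395449707153394198),
 (411, 111760026255712718559282137468946057750711802912478231452344217030865201782274420891071562091399998171075248),
 (421, 3337502414194140011188085108807601482466604320920858529083317258934740256497182864337595554167091050817340025950),
 (423, 111679481760675550687109568055850948220892723493624897152275523510903729735379312437229171212894504),
 (425, 5254642910777576898101846139147791108700967782417485813708546660906760769354786409488233243045355559561495426180120948313621095459158322376585973259)]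
def l28 : List (ℕ × ℕ) := [(427, 289944523427615877449223870833804333512197203840206614118356238061345273644889721758330469207273610457264),
 (429, 1153837966207814842102723153512865194904697377449312210215689218085220960908198691616783079967506259696489510),
 (435, 13599812379136674030636493949809606935929764358445909153399819075610290252980848),
 (437, 1971722998466005321483713426308313558111302843554108893935066219211178643666942331950)]
def l29 : List (ℕ × ℕ) := [(439, 4241985565725399798181492585068546575554237445105973883978093854843224643540825574211802816613928461101905616560663563790),
 (441, 21549586418127824133645341445730250067508934603505464635014212588714264032645923009109378332806406392922055459966703158608253172805765185414765130421262),
 (455, 53011752530597044823375676391449984537143289698673099982522495522384652398326040330731678793825263180),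
 (585, 196594886771618965437972501694243530432019337902968413713381040650593897045177387163008),
 (587, 5437655856921442123220131501425508549134827865987244384666638383394342910050182516106595739461820870390628812023440582682057304744018528086430076000633987686),
 (589, 17454483064608767258893682643449190446509062086363936206053864551303642729549218616453628285397541465041483),
 (595, 1686734330574746984909466750073364819172300258688635579163366985519954892288286029675792666365478),
 (597, 4664728914359202611123389503974001005151319156853243782000702730894912316865266062908772055977598236270440702174826052973649816431025550023895521846)]
def l30 : List (ℕ × ℕ) := [(603, 40170150452645664749119439323865774435439851417795026072867196205559715762551790464),
 (613, 1042594764039204120004581660325670480597349524805806789966981800925379834196385041209185235901941476707867238),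
 (619, 20689726904315747287664575611605846128018443839589481242534452927322555509865161453936)]
def l31 : List (ℕ × ℕ) := [(661, 108567014690481796713383734207936135115647989544903685253009769489543367160631830),
 (683, 16764063908763030509497442978610858711051255813572289933037741557136233910046037751888087781536432),
 (685, 58715213554261038609941657416447412097491258789574360809394479669487568273347885036211457388808847996061740762446717040),
 (691, 3828069014140882631432638502667680050365303814573486281426940263745824247240650186637775424690124886582),
 (693, 21587959488333601660838513821759976263180233970637372957343443734829204567022593355394150914191531860504971927753780850446592476652281104482157082451502),
 (715, 108748788523914211065252283643448352081465548924074297044071505327925947871656863356507532562232082568585060664162864537510373403226013170290886516857872966)]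
def l32 : List (ℕ × ℕ) := [(717, 15557751944336210146108722190358859506343506160824336663332513343463741261562104208989774),
 (819, 5324248364424140945728684205994325056222330),
 (1365, 5324248364424140945728684205994325056222330)]

def t0 : mainChk l0 = true := by decide +kernel
def t1 : mainChk l1 = true := by decide +kernel
def t2 : mainChk l2 = true := by decide +kernel
def t3 : mainChk l3 = true := by decide +kernel
def t4 : mainChk l4 = true := by decide +kernel
def t5 : mainChk l5 = true := by decide +kernel
def t6 : mainChk l6 = true := by decide +kernel
def t7 : mainChk l7 = true := by decide +kernel
def t8 : mainChk l8 = true := by decide +kernel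
def t9 : mainChk l9 = true := by decide +kernel
def t10 : mainChk l10 = true := by decide +kernel
def t11 : mainChk l11 = true := by decide +kernel
def t12 : mainChk l12 = true := by decide +kernel
def t13 : mainChk l13 = true := by decide +kernel
def t14 : mainChk l14 = true := by decide +kernel
def t15 : mainChk l15 = true := by decide +kernel
def t16 : mainChk l16 = true := by decide +kernel
def t17 : mainChk l17 = true := by decide +kernel
def t18 : mainChk l18 = true := by decide +kernel
def t19 : mainChk l19 = true := by decide +kernel
def t20 : mainChk l20 = true := by decide +kernel
def t21 : mainChk l21 = true := by decide +kernel
def t22 : mainChk l22 = true := by decide +kernel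
def t23 : mainChk l23 = true := by decide +kernel
def t24 : mainChk l24 = true := by decide +kernel
def t25 : mainChk l25 = true := by decide +kernel
def t26 : mainChk l26 = true := by decide +kernel
def t27 : mainChk l27 = true := by decide +kernel
def t28 : mainChk l28 = true := by decide +kernel
def t29 : mainChk l29 = true := by decide +kernel
def t30 : mainChk l30 = true := by decide +kernel
def t31 : mainChk l31 = true := by decide +kernel
def t32 : mainChk l32 = true := by decide +kernel

def lA : List (ℕ × ℕ) := l0 ++ l1 ++ l2 ++ l3 ++ l4 ++ l5 ++ l6 ++ l7 ++ l8 ++ l9 ++ l10 ++ l11 ++ l12 ++ l13 ++ l14 ++ l15 ++ l16 ++ l17 ++ l18 ++ l19 ++ l20 ++ l21 ++ l22 ++ l23 ++ l24 ++ l25 ++ l26 ++ l27 ++ l28 ++ l29 ++ l30 ++ l31 ++ l32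

theorem lA_all : ∀ x ∈ lA, AllG x.1 := by
  unfold lA
  simp only [List.mem_append]
  rintro x ((((((((((((((((((((((((((((((((h | h) | h) | h) | h) | h) | h) | h) | h) | h) | h) | h) | h) | h) | h) | h) | h) | h) | h) | h) | h) | h) | h) | h) | h) | h) | h) | h) | h) | h) | h) | h) | h)
  · exact mainChk_spec _ t0 x h
  · exact mainChk_spec _ t1 x h
  · exact mainChk_spec _ t2 x h
  · exact mainChk_spec _ t3 x h
  · exact mainChk_spec _ t4 x h
  · exact mainChk_spec _ t5 x h
  · exact mainChk_spec _ t6 x h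
  · exact mainChk_spec _ t7 x h
  · exact mainChk_spec _ t8 x h
  · exact mainChk_spec _ t9 x h
  · exact mainChk_spec _ t10 x h
  · exact mainChk_spec _ t11 x h
  · exact mainChk_spec _ t12 x h
  · exact mainChk_spec _ t13 x h
  · exact mainChk_spec _ t14 x h
  · exact mainChk_spec _ t15 x h
  · exact mainChk_spec _ t16 x h
  · exact mainChk_spec _ t17 x h
  · exact mainChk_spec _ t18 x h
  · exact mainChk_spec _ t19 x h
  · exact mainChk_spec _ t20 x h
  · exact mainChk_spec _ t21 x h
  · exact mainChk_spec _ t22 x h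
  · exact mainChk_spec _ t23 x h
  · exact mainChk_spec _ t24 x h
  · exact mainChk_spec _ t25 x h
  · exact mainChk_spec _ t26 x h
  · exact mainChk_spec _ t27 x h
  · exact mainChk_spec _ t28 x h
  · exact mainChk_spec _ t29 x h
  · exact mainChk_spec _ t30 x h
  · exact mainChk_spec _ t31 x h
  · exact mainChk_spec _ t32 x h

theorem lA_orb : Nat.beq (orbs lA 0) (Nat.sub (Nat.pow 2 4095) 1) = true := by decide +kernel

end Data

theorem aut_group_pure_dcc_90_45_14 (R : Matrix (Fin 45) (Fin 45) (ZMod 2))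
    (hR : IsCirculant R) (hsd : IsSelfDual (pureDCC R))
    (hmin : MinWeightIs (pureDCC R) 14) :
    autGroupOrder (pureDCC R) = 90 := by
  obtain ⟨v, rfl⟩ := hR
  have e := pureDCC_eq v
  have hu := unitary_of_selfDual _ (e ▸ hsd)
  have hg := all_good lA lA_all lA_orb _ hu
  exact e ▸ hg (e ▸ hmin)
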